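/- Let u be a weak solution of problem (P) and suppose f satisfies condition (a). Then there are mutually disjoint open balls B_{R_k}(z_k) ⊂ B_R (z_k ∈ B_R, R_k > 0, k = 1,…,m, m ∈ ℕ ∪ {+∞}) such that B_R = (⋃_{k=1}^m B_{R_k}(z_k)) ∪ {x : u(x) = 0}, and for each k there is U_k ∈ C^1([0,R_k]) with u(x) = U_k(|x−z_k|) for x ∈ B_{R_k}(z_k), U_k(R_k) = 0, and U_k'(r) < 0 for r ∈ (0,R_k). -/

import Mathlib

open Set Metric MeasureTheory Bornology
open scoped RealInnerProductSpace Classical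

noncomputable section

/-- The vector field `y ↦ (g(|y|)/|y|)·y`, with the convention that it vanishes at `y = 0`. -/
def gvec {N : ℕ} (g : ℝ → ℝ) (y : EuclideanSpace ℝ (Fin N)) : EuclideanSpace ℝ (Fin N) :=
  if y = 0 then 0 else (g ‖y‖ / ‖y‖) • y

/-- `φ` is a smooth test function compactly supported in `Ω`. -/
def IsTestFun {N : ℕ} (Ω : Set (EuclideanSpace ℝ (Fin N)))
    (φ : EuclideanSpace ℝ (Fin N) → ℝ) : Prop :=
  ContDiff ℝ (⊤ : ℕ∞) φ ∧ HasCompactSupport φ ∧ tsupport φ ⊆ Ω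

/-- Conditions (2.1)-(2.2): `g ∈ C[0,∞) ∩ C¹(0,∞)`, `g(0) = 0`, `g'(t) > 0` for `t > 0`. -/
def GCond (g : ℝ → ℝ) : Prop :=
  ContinuousOn g (Ici 0) ∧ ContDiffOn ℝ 1 g (Ioi 0) ∧ g 0 = 0 ∧
    ∀ t : ℝ, 0 < t → 0 < deriv g t

/-- Conditions (2.3)-(2.4): `f ∈ C([0,R] × [0,∞))`, `r ↦ f(r,t)` non-increasing. -/
def FCond (R : ℝ) (f : ℝ → ℝ → ℝ) : Prop :=
  ContinuousOn (fun q : ℝ × ℝ => f q.1 q.2) (Icc 0 R ×ˢ Ici 0) ∧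
    ∀ t : ℝ, 0 ≤ t → ∀ r₁ ∈ Icc (0:ℝ) R, ∀ r₂ ∈ Icc (0:ℝ) R, r₁ ≤ r₂ → f r₂ t ≤ f r₁ t

/-- `u` solves `-div((g(|∇u|)/|∇u|)∇u) = f(|x|,u)` distributionally in the ball `B_R`. -/
def IsDistribSolBall {N : ℕ} (R : ℝ) (g : ℝ → ℝ) (f : ℝ → ℝ → ℝ)
    (u : EuclideanSpace ℝ (Fin N) → ℝ) : Prop :=
  ∀ φ : EuclideanSpace ℝ (Fin N) → ℝ, IsTestFun (ball 0 R) φ →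
    (∫ x in ball (0:EuclideanSpace ℝ (Fin N)) R, ⟪gvec g (gradient u x), gradient φ x⟫) =
      ∫ x in ball (0:EuclideanSpace ℝ (Fin N)) R, f ‖x‖ (u x) * φ x

/-- `u` is a weak solution of problem (P): `u ∈ C¹(clos B_R)`, `u ≥ 0`, `u ≢ 0`,
`u = 0` on `∂B_R`, and the equation holds distributionally. -/
def IsWeakSolP {N : ℕ} (R : ℝ) (g : ℝ → ℝ) (f : ℝ → ℝ → ℝ)
    (u : EuclideanSpace ℝ (Fin N) → ℝ) : Prop :=
  ContDiffOn ℝ 1 u (closedBall 0 R) ∧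
  (∀ x ∈ closedBall (0:EuclideanSpace ℝ (Fin N)) R, 0 ≤ u x) ∧
  (∃ x ∈ closedBall (0:EuclideanSpace ℝ (Fin N)) R, u x ≠ 0) ∧
  (∀ x ∈ sphere (0:EuclideanSpace ℝ (Fin N)) R, u x = 0) ∧
  IsDistribSolBall R g f u

/-- `U` is `C¹` on `[a,b]` with (continuous) derivative `U'`. -/
def C1On (U U' : ℝ → ℝ) (a b : ℝ) : Prop :=
  ContinuousOn U' (Icc a b) ∧ ∀ r ∈ Icc a b, HasDerivWithinAt U (U' r) (Icc a b) r

/-- Definition 2.1: `u` is locally symmetric in `B_R`. -/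
def LocallySymmetric {N : ℕ} (R : ℝ) (u : EuclideanSpace ℝ (Fin N) → ℝ) : Prop :=
  ∃ (K : Set ℕ) (z : ℕ → EuclideanSpace ℝ (Fin N)) (ri ro : ℕ → ℝ) (U U' : ℕ → ℝ → ℝ),
    (∀ k ∈ K, z k ∈ ball (0:EuclideanSpace ℝ (Fin N)) R ∧ 0 ≤ ri k ∧ ri k < ro k) ∧
    K.PairwiseDisjoint (fun k => ball (z k) (ro k) \ closedBall (z k) (ri k)) ∧
    ball (0:EuclideanSpace ℝ (Fin N)) R =
      (⋃ k ∈ K, ball (z k) (ro k) \ closedBall (z k) (ri k)) ∪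
        {x ∈ ball (0:EuclideanSpace ℝ (Fin N)) R | gradient u x = 0} ∧
    ∀ k ∈ K,
      C1On (U k) (U' k) (ri k) (ro k) ∧
      (∀ x ∈ ball (z k) (ro k) \ closedBall (z k) (ri k), u x = U k ‖x - z k‖) ∧
      (∀ r ∈ Ioo (ri k) (ro k), U' k r < 0) ∧
      (∀ x ∈ ball (z k) (ri k), U k (ri k) ≤ u x)

/-- `H(t) = t·g(t) - ∫₀ᵗ g(s) ds`. -/
def Hfun (g : ℝ → ℝ) (t : ℝ) : ℝ := t * g t - ∫ s in (0:ℝ)..t, g s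

/-- The inverse of `H` on `[0,∞)`. -/
def Hinv (g : ℝ → ℝ) : ℝ → ℝ := Function.invFunOn (Hfun g) (Ici 0)

/-- The class `A_g` of Definition 3.1. -/
def MemAg (g φ : ℝ → ℝ) : Prop :=
  ContinuousOn φ (Ici 0) ∧ (∀ t : ℝ, 0 ≤ t → 0 ≤ φ t) ∧ φ 0 = 0 ∧
  ((∃ d > (0:ℝ), ∀ t ∈ Icc (0:ℝ) d, φ t = 0) ∨
    ∃ δ > (0:ℝ), (∀ t ∈ Ioo (0:ℝ) δ, 0 < φ t) ∧
      ∫⁻ t in Ioc (0:ℝ) δ, ENNReal.ofReal (1 / Hinv g (∫ s in (0:ℝ)..t, φ s)) = ⊤)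

/-- `u` satisfies `div((g(|∇u|)/|∇u|)∇u) ≤ φ(u)` distributionally in `Ω`. -/
def DistribSupIneq {N : ℕ} (Ω : Set (EuclideanSpace ℝ (Fin N))) (g φ : ℝ → ℝ)
    (u : EuclideanSpace ℝ (Fin N) → ℝ) : Prop :=
  ∀ ψ : EuclideanSpace ℝ (Fin N) → ℝ, IsTestFun Ω ψ → (∀ x, 0 ≤ ψ x) →
    -(∫ x in Ω, ⟪gvec g (gradient u x), gradient ψ x⟫) ≤ ∫ x in Ω, φ (u x) * ψ x

/-- Condition (a) of Lemma 3.7. -/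
def CondA (R : ℝ) (g : ℝ → ℝ) (f : ℝ → ℝ → ℝ) : Prop :=
  ∀ ρ ∈ Ico (0:ℝ) R, ∀ τ : ℝ, 0 < τ → f ρ τ = 0 →
    ∃ δ ∈ Ioo (0:ℝ) τ, ∃ φ : ℝ → ℝ, MemAg g φ ∧
      ∀ t ∈ Icc (τ - δ) τ, ∀ r ∈ Icc (ρ - δ) (ρ + δ) ∩ Icc (0:ℝ) R, f r t ≤ φ (τ - t)

/-- Condition (b) of Lemma 3.8. -/
def CondB (R : ℝ) (g : ℝ → ℝ) (f : ℝ → ℝ → ℝ) : Prop :=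
  ∀ ρ ∈ Ico (0:ℝ) R, f ρ 0 = 0 →
    ∃ δ > (0:ℝ), ∃ φ : ℝ → ℝ, MemAg g φ ∧
      ∀ r ∈ Ico (0:ℝ) R, ∀ t ∈ Icc (0:ℝ) δ, -f r t ≤ φ t

/-- Condition (c) of Theorem 3.9. -/
def CondC (R : ℝ) (g : ℝ → ℝ) (f : ℝ → ℝ → ℝ) : Prop :=
  ∀ ρ ∈ Ico (0:ℝ) R, ∀ τ : ℝ, 0 ≤ τ → f ρ τ = 0 →
    ∃ δ > (0:ℝ), ∃ φ : ℝ → ℝ, MemAg g φ ∧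
      ∀ t ∈ Icc τ (τ + δ), ∀ r ∈ Icc (ρ - δ) (ρ + δ) ∩ Icc (0:ℝ) R, -f r t ≤ φ (t - τ)

/-- `u` solves `-div((g(|∇u|)/|∇u|)∇u) = f(u)` distributionally in `Ω` (autonomous case). -/
def IsDistribSolAut {N : ℕ} (Ω : Set (EuclideanSpace ℝ (Fin N))) (g f : ℝ → ℝ)
    (u : EuclideanSpace ℝ (Fin N) → ℝ) : Prop :=
  ∀ φ : EuclideanSpace ℝ (Fin N) → ℝ, IsTestFun Ω φ →
    (∫ x in Ω, ⟪gvec g (gradient u x), gradient φ x⟫) = ∫ x in Ω, f (u x) * φ x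

/-- `u` is a weak solution of problem (P) with autonomous right-hand side `f = f(u)`. -/
def IsWeakSolPAut {N : ℕ} (R : ℝ) (g f : ℝ → ℝ) (u : EuclideanSpace ℝ (Fin N) → ℝ) : Prop :=
  ContDiffOn ℝ 1 u (closedBall 0 R) ∧
  (∀ x ∈ closedBall (0:EuclideanSpace ℝ (Fin N)) R, 0 ≤ u x) ∧
  (∃ x ∈ closedBall (0:EuclideanSpace ℝ (Fin N)) R, u x ≠ 0) ∧
  (∀ x ∈ sphere (0:EuclideanSpace ℝ (Fin N)) R, u x = 0) ∧
  IsDistribSolAut (ball 0 R) g f u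

/-- `G(t) = ∫₀ᵗ g(s) ds`. -/
def Gfun (g : ℝ → ℝ) (t : ℝ) : ℝ := ∫ s in (0:ℝ)..t, g s

/-- The variational functional `J(v) = ∫_Ω (G(|∇v|) - F(v)) dx`. -/
def Jfun {N : ℕ} (g f : ℝ → ℝ) (Ω : Set (EuclideanSpace ℝ (Fin N)))
    (v : EuclideanSpace ℝ (Fin N) → ℝ) : ℝ :=
  ∫ x in Ω, (Gfun g ‖gradient v x‖ - Gfun f (v x))

/-- `v ∈ X`, i.e. `v ∈ C¹(clos Ω)` with `v = 0` on `∂Ω`. -/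
def MemX {N : ℕ} (Ω : Set (EuclideanSpace ℝ (Fin N)))
    (v : EuclideanSpace ℝ (Fin N) → ℝ) : Prop :=
  ContDiffOn ℝ 1 v (closure Ω) ∧ ∀ x ∈ frontier Ω, v x = 0

/-- `u` is a global minimizer of `J` in `X`. -/
def IsGlobalMinJ {N : ℕ} (g f : ℝ → ℝ) (Ω : Set (EuclideanSpace ℝ (Fin N)))
    (u : EuclideanSpace ℝ (Fin N) → ℝ) : Prop :=
  MemX Ω u ∧ ∀ v, MemX Ω v → Jfun g f Ω u ≤ Jfun g f Ω v

/-- `u` is a local minimizer of `J` in `X` (w.r.t. the `C¹` distance). -/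
def IsLocalMinJ {N : ℕ} (g f : ℝ → ℝ) (Ω : Set (EuclideanSpace ℝ (Fin N)))
    (u : EuclideanSpace ℝ (Fin N) → ℝ) : Prop :=
  MemX Ω u ∧ ∃ ε > (0:ℝ), ∀ v, MemX Ω v →
    (∀ x ∈ Ω, |v x - u x| + ‖gradient v x - gradient u x‖ < ε) →
    Jfun g f Ω u ≤ Jfun g f Ω v

/-- `Ω` has `C¹` boundary: near every boundary point, `Ω` is the sublevel set of a `C¹`
defining function with nonvanishing gradient. -/
def HasC1Boundary {N : ℕ} (Ω : Set (EuclideanSpace ℝ (Fin N))) : Prop :=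
  ∀ y ∈ frontier Ω, ∃ (V : Set (EuclideanSpace ℝ (Fin N))) (ρ : EuclideanSpace ℝ (Fin N) → ℝ),
    IsOpen V ∧ y ∈ V ∧ ContDiffOn ℝ 1 ρ V ∧ (∀ x ∈ V, (x ∈ Ω ↔ ρ x < 0)) ∧ gradient ρ y ≠ 0

/-- The Neumann condition `∂u/∂ν = 0` on `∂Ω`; for `u ∈ X` (so that `u` vanishes on the
boundary and all tangential derivatives vanish) this is equivalent to the vanishing of the
full derivative of `u` (within `clos Ω`) at every boundary point. -/
def NeumannZero {N : ℕ} (Ω : Set (EuclideanSpace ℝ (Fin N)))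
    (u : EuclideanSpace ℝ (Fin N) → ℝ) : Prop :=
  ∀ y ∈ frontier Ω, HasFDerivWithinAt u (0 : EuclideanSpace ℝ (Fin N) →L[ℝ] ℝ) (closure Ω) y

/-- `u` is radially symmetric and radially non-increasing on `clos B_R`, with `C¹`
profile `U` (with derivative `U'`). -/
def RadialNonincreasing {N : ℕ} (R : ℝ) (u : EuclideanSpace ℝ (Fin N) → ℝ)
    (U U' : ℝ → ℝ) : Prop :=
  C1On U U' 0 R ∧ AntitoneOn U (Icc 0 R) ∧
    ∀ x ∈ closedBall (0:EuclideanSpace ℝ (Fin N)) R, u x = U ‖x‖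

end

section
open Set Metric MeasureTheory Bornology
open scoped RealInnerProductSpace Classical

namespace CS

/-- Displacement of midpoints. -/
def phi (s d m : ℝ) : ℝ := min m (max (m - d) s)

lemma phi_le (s d m : ℝ) : phi s d m ≤ m := min_le_left _ _

lemma le_phi {s d : ℝ} (hd : 0 ≤ d) (m : ℝ) : m - d ≤ phi s d m := by
  unfold phi; exact le_min (by linarith) (le_max_left _ _)

lemma phi_lip (s d m m' : ℝ) : |phi s d m - phi s d m'| ≤ |m - m'| := by
  unfold phi
  refine (abs_min_sub_min_le_max _ _ _ _).trans (max_le le_rfl ?_)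
  refine (abs_max_sub_max_le_max _ _ _ _).trans (max_le ?_ ?_)
  · simp
  · simp

lemma phi_phi {s d d' : ℝ} (hd : 0 ≤ d) (hd' : 0 ≤ d') (m : ℝ) :
    phi s d (phi s d' m) = phi s (d + d') m := by
  unfold phi
  rcases le_total m s with h | h
  · rw [min_eq_left (le_max_of_le_right h), min_eq_left (le_max_of_le_right h),
      min_eq_left (le_max_of_le_right h)]
  · rcases le_total (m - d') s with h1 | h1
    · rw [max_eq_right h1, min_eq_right h, max_eq_right (by linarith : s - d ≤ s), min_self,
        max_eq_right (by linarith), min_eq_right h]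
    · rw [max_eq_left h1, min_eq_right (by linarith : m - d' ≤ m)]
      rw [show m - (d + d') = m - d' - d by ring]
      rw [min_eq_right (max_le (by linarith) h1), min_eq_right (max_le (by linarith) h)]

lemma phi_zero (s m : ℝ) : phi s 0 m = m := by
  unfold phi; simp

/-- One step of the symmetrization. -/
def T (s d : ℝ) (A : Set ℝ) : Set ℝ :=
  {r | ∃ m l : ℝ, |r - phi s d m| < l ∧ ∀ x, |x - m| < l → x ∈ A}

/-- The symmetrization. -/
def S (s t : ℝ) (A : Set ℝ) : Set ℝ := ⋃ k : ℕ, (T s (t / 2 ^ k))^[2 ^ k] A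

lemma T_mono {s d : ℝ} {A B : Set ℝ} (h : A ⊆ B) : T s d A ⊆ T s d B := by
  rintro r ⟨m, l, h1, h2⟩; exact ⟨m, l, h1, fun x hx => h (h2 x hx)⟩

lemma Tn_mono {s d : ℝ} {A B : Set ℝ} (h : A ⊆ B) (n : ℕ) :
    (T s d)^[n] A ⊆ (T s d)^[n] B := by
  have : Monotone (T s d) := fun A B h => T_mono h
  exact this.iterate n h

lemma S_mono {s t : ℝ} {A B : Set ℝ} (h : A ⊆ B) : S s t A ⊆ S s t B :=
  iUnion_mono fun _ => Tn_mono h _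

lemma T_two {s d : ℝ} (hd : 0 ≤ d) (A : Set ℝ) : T s (2 * d) A ⊆ T s d (T s d A) := by
  rintro r ⟨m, l, h1, h2⟩
  refine ⟨phi s d m, l, ?_, fun x hx => ⟨m, l, hx, h2⟩⟩
  rw [phi_phi hd hd, ← two_mul]; exact h1

lemma Tn_two {s d : ℝ} (hd : 0 ≤ d) (n : ℕ) (A : Set ℝ) :
    (T s (2 * d))^[n] A ⊆ (T s d)^[2 * n] A := by
  induction n generalizing A with
  | zero => simp
  | succ n ih =>
    rw [show 2 * (n + 1) = 2 * n + 2 by ring, Function.iterate_succ_apply,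
      Function.iterate_add_apply]
    exact (Tn_mono (T_two hd A) n).trans (ih _)

lemma S_dir {s t : ℝ} (ht : 0 ≤ t) (A : Set ℝ) :
    Monotone (fun k : ℕ => (T s (t / 2 ^ k))^[2 ^ k] A) := by
  refine monotone_nat_of_le_succ fun k => ?_
  have := Tn_two (s := s) (d := t / 2 ^ (k + 1)) (by positivity) (2 ^ k) A
  rw [show 2 * (t / 2 ^ (k + 1)) = t / 2 ^ k by rw [pow_succ]; field_simp] at this
  rw [show 2 ^ (k + 1) = 2 * 2 ^ k by rw [pow_succ]; ring]
  exact_mod_cast this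

lemma T_open (s d : ℝ) (A : Set ℝ) : IsOpen (T s d A) := by
  rw [isOpen_iff_mem_nhds]
  rintro r ⟨m, l, h1, h2⟩
  have : {r' | |r' - phi s d m| < l} ∈ nhds r := by
    have ho : IsOpen {r' | |r' - phi s d m| < l} := isOpen_lt (by fun_prop) (by fun_prop)
    exact ho.mem_nhds (by simpa using h1)
  filter_upwards [this] with r' hr'
  exact ⟨m, l, hr', h2⟩

lemma Tn_open {s d : ℝ} {A : Set ℝ} (hA : IsOpen A) (n : ℕ) : IsOpen ((T s d)^[n] A) := by
  cases n with
  | zero => simpa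
  | succ n => rw [Function.iterate_succ_apply']; exact T_open _ _ _

lemma S_open {s t : ℝ} {A : Set ℝ} (hA : IsOpen A) : IsOpen (S s t A) :=
  isOpen_iUnion fun _ => Tn_open hA _

/-- T commutes with increasing unions of open sets -/
lemma T_iUnion {s d : ℝ} {A : ℕ → Set ℝ} (hA : ∀ n, IsOpen (A n)) (hm : Monotone A) :
    T s d (⋃ n, A n) = ⋃ n, T s d (A n) := by
  apply Subset.antisymm _ (iUnion_subset fun n => T_mono (subset_iUnion A n))
  rintro r ⟨m, l, h1, h2⟩
  obtain ⟨l', hl1, hl2⟩ := exists_between h1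
  have hc : IsCompact (Icc (m - l') (m + l')) := isCompact_Icc
  have hsub : Icc (m - l') (m + l') ⊆ ⋃ n, A n := fun x hx =>
    h2 x (lt_of_le_of_lt (abs_le.2 ⟨by linarith [hx.1], by linarith [hx.2]⟩) hl2)
  obtain ⟨n, hn⟩ := hc.elim_directed_cover A hA hsub (hm.directed_le)
  refine mem_iUnion.2 ⟨n, m, l', hl1, fun x hx => hn ?_⟩
  have := abs_lt.1 hx
  exact ⟨by linarith, by linarith⟩

lemma Tn_iUnion {s d : ℝ} (k : ℕ) : ∀ {A : ℕ → Set ℝ} (_ : ∀ n, IsOpen (A n)) (_ : Monotone A),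
    (T s d)^[k] (⋃ n, A n) = ⋃ n, (T s d)^[k] (A n) := by
  induction k with
  | zero => intros; rfl
  | succ k ih =>
    intro A hA hm
    rw [Function.iterate_succ_apply, T_iUnion hA hm,
      ih (fun n => T_open _ _ _) (fun a b h => T_mono (hm h))]
    rfl

lemma S_iUnion {s t : ℝ} {A : ℕ → Set ℝ} (hA : ∀ n, IsOpen (A n)) (hm : Monotone A) :
    S s t (⋃ n, A n) = ⋃ n, S s t (A n) := by
  unfold S
  simp_rw [Tn_iUnion _ hA hm]
  exact iUnion_comm _

lemma T_empty (s d : ℝ) : T s d ∅ = ∅ := by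
  ext r; simp only [T, mem_ofPred_eq, mem_empty_iff_false, iff_false]
  rintro ⟨m, l, h1, h2⟩
  exact h2 m (by simpa using lt_of_le_of_lt (abs_nonneg _) h1)

lemma S_empty (s t : ℝ) : S s t ∅ = ∅ := by
  unfold S
  have : ∀ d n, (T s d)^[n] ∅ = ∅ := by
    intro d n; exact Function.iterate_fixed (T_empty s d) n
  simp [this]

/-- Minkowski property -/
def Mink (h : ℝ) (A B : Set ℝ) : Prop := ∀ x ∈ A, ∀ y, |y - x| ≤ h → y ∈ B

lemma T_mink {s d h : ℝ} {A B : Set ℝ} (hAB : Mink h A B) : Mink h (T s d A) (T s d B) := by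
  rintro r ⟨m, l, h1, h2⟩ r' hr'
  have hh : 0 ≤ h := (abs_nonneg _).trans hr'
  have hl : 0 < l := (abs_nonneg _).trans_lt h1
  refine ⟨m, l + h, ?_, ?_⟩
  · calc |r' - phi s d m| ≤ |r' - r| + |r - phi s d m| := abs_sub_le _ _ _
      _ < l + h := by linarith
  · intro x hx
    -- contract x toward m
    have hlh : 0 < l + h := by linarith
    set y := m + (l / (l + h)) * (x - m)
    refine hAB y (h2 y ?_) x ?_
    · have : y - m = (l / (l + h)) * (x - m) := by simp [y]
      rw [this, abs_mul, abs_of_pos (by positivity)]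
      rw [div_mul_eq_mul_div, div_lt_iff₀ hlh]
      exact mul_lt_mul_of_pos_left hx hl
    · have : x - y = (h / (l + h)) * (x - m) := by
        simp only [y]; field_simp; ring
      rw [this, abs_mul, abs_of_nonneg (by positivity)]
      rw [div_mul_eq_mul_div, div_le_iff₀ hlh]
      exact mul_le_mul_of_nonneg_left hx.le hh

lemma Tn_mink {s d h : ℝ} (n : ℕ) : ∀ {A B : Set ℝ}, Mink h A B →
    Mink h ((T s d)^[n] A) ((T s d)^[n] B) := by
  induction n with
  | zero => intro A B h; exact h
  | succ n ih => intro A B h; exact ih (T_mink h)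

lemma S_mink {s t h : ℝ} {A B : Set ℝ} (hAB : Mink h A B) : Mink h (S s t A) (S s t B) := by
  intro x hx y hy
  obtain ⟨k, hk⟩ := mem_iUnion.1 hx
  exact mem_iUnion.2 ⟨k, Tn_mink _ hAB x hk y hy⟩

lemma T_near {s d : ℝ} (hd : 0 ≤ d) {A : Set ℝ} {r : ℝ} (hr : r ∈ T s d A) :
    ∃ r' ∈ A, |r - r'| ≤ d := by
  obtain ⟨m, l, h1, h2⟩ := hr
  refine ⟨r - phi s d m + m, h2 _ (by simpa using h1), ?_⟩
  have := phi_le s d m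
  have := le_phi (s := s) hd m
  rw [abs_le]; constructor <;> linarith

lemma Tn_near {s d : ℝ} (hd : 0 ≤ d) (n : ℕ) : ∀ {A : Set ℝ} {r : ℝ} (_ : r ∈ (T s d)^[n] A),
    ∃ r' ∈ A, |r - r'| ≤ n * d := by
  induction n with
  | zero => intro A r hr; exact ⟨r, hr, by simp⟩
  | succ n ih =>
    intro A r hr
    rw [Function.iterate_succ_apply] at hr
    obtain ⟨r1, h1, h2⟩ := ih hr
    obtain ⟨r2, h3, h4⟩ := T_near hd h1
    refine ⟨r2, h3, ?_⟩
    push_cast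
    have := abs_sub_le r r1 r2
    linarith

lemma S_near {s t : ℝ} (ht : 0 ≤ t) {A : Set ℝ} {r : ℝ} (hr : r ∈ S s t A) :
    ∃ r' ∈ A, |r - r'| ≤ t := by
  obtain ⟨k, hk⟩ := mem_iUnion.1 hr
  obtain ⟨r', h1, h2⟩ := Tn_near (by positivity) _ hk
  refine ⟨r', h1, h2.trans (le_of_eq ?_)⟩
  push_cast; field_simp

lemma S_interval {s t : ℝ} {A : Set ℝ} {m l : ℝ} (h : ∀ x, |x - m| < l → x ∈ A) {r : ℝ}
    (hr : |r - phi s t m| < l) : r ∈ S s t A := by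
  refine mem_iUnion.2 ⟨0, ?_⟩
  simp only [pow_zero, div_one, Function.iterate_one]
  exact ⟨m, l, hr, h⟩

/-- Isolation step. -/
lemma T_isol {s d q m l p : ℝ} (hd : 0 ≤ d) (hl : 0 < l) {A : Set ℝ} (h1 : q < m - l)
    (h2 : m + l < p) (hA : ∀ x ∈ A, x ≤ q ∨ |x - m| < l ∨ p ≤ x) :
    ∀ x ∈ T s d A, x ≤ q ∨ |x - phi s d m| < l ∨ p - d ≤ x := by
  rintro r ⟨m', l', h3, h4⟩
  have hl' : 0 < l' := (abs_nonneg _).trans_lt h3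
  have a1 := phi_le s d m'
  have a2 := le_phi (s := s) hd m'
  have a3 := abs_lt.1 h3
  have hm' : m' ∈ A := h4 m' (by simpa using hl')
  have key : ∀ y, m' - l' < y → y < m' + l' → (y ≤ q ∨ |y - m| < l ∨ p ≤ y) :=
    fun y y1 y2 => hA y (h4 y (by rw [abs_lt]; constructor <;> linarith))
  rcases hA m' hm' with h5 | h5 | h5
  · -- left
    left
    have : m' + l' ≤ q := by
      by_contra hcon
      push Not at hcon
      obtain ⟨y, hy1, hy2⟩ := exists_between (lt_min hcon h1)
      have hy3 := lt_min_iff.1 hy2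
      rcases key y (by linarith) (by linarith) with h6 | h6 | h6
      · linarith
      · have := abs_lt.1 h6; linarith
      · linarith
    linarith
  · right; left
    have h5' := abs_lt.1 h5
    have b1 : m' + l' ≤ m + l := by
      by_contra hcon
      push Not at hcon
      obtain ⟨y, hy1, hy2⟩ := exists_between (lt_min hcon h2)
      have hy3 := lt_min_iff.1 hy2
      rcases key y (by linarith) (by linarith) with h6 | h6 | h6
      · linarith
      · have := abs_lt.1 h6; linarith
      · linarith
    have b2 : m - l ≤ m' - l' := by
      by_contra hcon
      push Not at hcon
      obtain ⟨y, hy1, hy2⟩ := exists_between (max_lt hcon h1)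
      have hy3 := max_lt_iff.1 hy1
      rcases key y (by linarith) (by linarith) with h6 | h6 | h6
      · linarith
      · have := abs_lt.1 h6; linarith
      · linarith
    have b3 : |m' - m| ≤ l - l' := abs_le.2 ⟨by linarith, by linarith⟩
    have b4 := phi_lip s d m' m
    have b5 := abs_sub_le r (phi s d m') (phi s d m)
    linarith
  · right; right
    have : p ≤ m' - l' := by
      by_contra hcon
      push Not at hcon
      obtain ⟨y, hy1, hy2⟩ := exists_between (max_lt hcon h2)
      have hy3 := max_lt_iff.1 hy1
      rcases key y (by linarith) (by linarith) with h6 | h6 | h6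
      · linarith
      · have := abs_lt.1 h6; linarith
      · linarith
    linarith

lemma Tn_isol {s d q m l p : ℝ} (hd : 0 ≤ d) (hl : 0 < l) {A : Set ℝ}
    (hA : ∀ x ∈ A, x ≤ q ∨ |x - m| < l ∨ p ≤ x) (n : ℕ) (h1 : q < m - l - n * d)
    (h2 : m + l < p - n * d) :
    ∀ x ∈ (T s d)^[n] A, x ≤ q ∨ |x - phi s (n * d) m| < l ∨ p - n * d ≤ x := by
  induction n with
  | zero => simpa [phi_zero] using hA
  | succ n ih =>
    push_cast at h1 h2 ⊢
    rw [Function.iterate_succ_apply']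
    have hnd : 0 ≤ n * d := by positivity
    have := T_isol (s := s) (q := q) (m := phi s (n * d) m) (l := l) (p := p - n * d) hd hl
      (by have := le_phi (s := s) hnd m; linarith) (by have := phi_le s (n * d) m; linarith)
      (ih (by linarith) (by linarith))
    rw [phi_phi hd hnd] at this
    rw [show (n + 1 : ℝ) * d = d + n * d by ring, show p - (d + n * d) = p - n * d - d by ring]
    exact this

lemma S_isol {s t q m l p : ℝ} (ht : 0 ≤ t) (hl : 0 < l) {A : Set ℝ}
    (hA : ∀ x ∈ A, x ≤ q ∨ |x - m| < l ∨ p ≤ x) (h1 : q < m - l - t)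
    (h2 : m + l < p - t) :
    ∀ x ∈ S s t A, x ≤ q ∨ |x - phi s t m| < l ∨ p - t ≤ x := by
  intro x hx
  obtain ⟨k, hk⟩ := mem_iUnion.1 hx
  have e : ((2 ^ k : ℕ) : ℝ) * (t / 2 ^ k) = t := by push_cast; field_simp
  have := Tn_isol (s := s) (d := t / 2 ^ k) (n := 2 ^ k) (by positivity) hl hA
    (by rw [e]; exact h1) (by rw [e]; exact h2) x hk
  rwa [e] at this

end CS
end

section
open Set Metric MeasureTheory Bornology
open scoped RealInnerProductSpace Classical

namespace CS

/-- union of a finite family of intervals -/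
def UF (F : Finset (ℝ × ℝ)) : Set ℝ := ⋃ p ∈ F, Ioo p.1 p.2

lemma mem_UF {F : Finset (ℝ × ℝ)} {x : ℝ} : x ∈ UF F ↔ ∃ p ∈ F, p.1 < x ∧ x < p.2 := by
  simp only [UF, mem_iUnion, mem_Ioo, exists_prop]

def Good (F : Finset (ℝ × ℝ)) : Prop :=
  (∀ p ∈ F, p.1 < p.2) ∧ (F : Set (ℝ × ℝ)).PairwiseDisjoint (fun p => Ioo p.1 p.2)

noncomputable def sg (s d : ℝ) (p : ℝ × ℝ) : ℝ := phi s d ((p.1 + p.2) / 2) - (p.1 + p.2) / 2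

noncomputable def sh (s d : ℝ) (p : ℝ × ℝ) : ℝ × ℝ := (p.1 + sg s d p, p.2 + sg s d p)

lemma UF_open (F : Finset (ℝ × ℝ)) : IsOpen (UF F) :=
  isOpen_biUnion fun _ _ => isOpen_Ioo

lemma T_UF {s d : ℝ} {F : Finset (ℝ × ℝ)} (hF : Good F) :
    T s d (UF F) = UF (F.image (sh s d)) := by
  ext r
  constructor
  · rintro ⟨m, l, h1, h2⟩
    have hl : 0 < l := (abs_nonneg _).trans_lt h1
    obtain ⟨p, hp, hp1⟩ := mem_UF.1 (h2 m (by simpa using hl))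
    have hsub : Ioo (m - l) (m + l) ⊆ Ioo p.1 p.2 := by
      refine isPreconnected_Ioo.subset_left_of_subset_union (v := UF (F.erase p)) isOpen_Ioo
        (UF_open _) ?_ ?_ ⟨m, by constructor <;> linarith, hp1⟩
      · rw [UF, disjoint_iUnion₂_right]
        intro q hq
        have := Finset.mem_erase.1 hq
        exact hF.2 hp this.2 (Ne.symm this.1)
      · intro x hx
        obtain ⟨q, hq, hq1⟩ := mem_UF.1 (h2 x (by rw [abs_lt]; constructor <;> linarith [hx.1, hx.2]))
        by_cases hpq : q = p
        · left; subst hpq; exact hq1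
        · right; exact mem_UF.2 ⟨q, Finset.mem_erase.2 ⟨hpq, hq⟩, hq1⟩
    have hss := (Ioo_subset_Ioo_iff (by linarith)).1 hsub
    refine mem_UF.2 ⟨sh s d p, Finset.mem_image_of_mem _ hp, ?_⟩
    have b3 : |m - (p.1 + p.2) / 2| ≤ (p.2 - p.1) / 2 - l :=
      abs_le.2 ⟨by linarith [hss.1, hss.2], by linarith [hss.1, hss.2]⟩
    have b4 := (phi_lip s d m ((p.1 + p.2) / 2)).trans b3
    have b5 := abs_le.1 b4
    have b6 := abs_lt.1 h1
    simp only [sh, sg]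
    constructor <;> linarith
  · intro hr
    obtain ⟨q, hq, hq1, hq2⟩ := mem_UF.1 hr
    obtain ⟨p, hp, rfl⟩ := Finset.mem_image.1 hq
    simp only [sh, sg] at hq1 hq2
    refine ⟨(p.1 + p.2) / 2, (p.2 - p.1) / 2, abs_lt.2 ⟨by linarith, by linarith⟩, ?_⟩
    intro x hx
    have := abs_lt.1 hx
    exact mem_UF.2 ⟨p, hp, by linarith, by linarith⟩

lemma merge (n : ℕ) : ∀ F : Finset (ℝ × ℝ), F.card ≤ n → (∀ p ∈ F, p.1 < p.2) →
    ∃ F', Good F' ∧ UF F' = UF F ∧ F'.card ≤ F.card ∧ (¬ Good F → F'.card < F.card) := by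
  induction n with
  | zero =>
    intro F hF h
    have : F = ∅ := Finset.card_eq_zero.1 (by omega)
    subst this
    have hg : Good ∅ := ⟨by simp, by simp⟩
    exact ⟨∅, hg, rfl, le_rfl, fun h => absurd hg h⟩
  | succ n ih =>
    intro F hF h
    by_cases hg : Good F
    · exact ⟨F, hg, rfl, le_rfl, fun h => absurd hg h⟩
    have : ∃ p ∈ F, ∃ q ∈ F, p ≠ q ∧ ¬ Disjoint (Ioo p.1 p.2) (Ioo q.1 q.2) := by
      by_contra hcon
      push Not at hcon
      exact hg ⟨h, fun p hp q hq hpq => hcon p hp q hq hpq⟩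
    obtain ⟨p, hp, q, hq, hpq, hd⟩ := this
    obtain ⟨y, hy1, hy2⟩ := Set.not_disjoint_iff.1 hd
    have hU : Ioo (min p.1 q.1) (max p.2 q.2) = Ioo p.1 p.2 ∪ Ioo q.1 q.2 := by
      ext x
      have := hy1.1; have := hy1.2; have := hy2.1; have := hy2.2
      simp only [mem_Ioo, mem_union, min_lt_iff, lt_max_iff]
      constructor
      · rintro ⟨h1 | h1, h2 | h2⟩
        · left; exact ⟨h1, h2⟩
        · by_cases hx : x < p.2
          · left; exact ⟨h1, hx⟩
          · right; exact ⟨by linarith, h2⟩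
        · by_cases hx : x < q.2
          · right; exact ⟨h1, hx⟩
          · left; exact ⟨by linarith, h2⟩
        · right; exact ⟨h1, h2⟩
      · rintro (⟨h1, h2⟩ | ⟨h1, h2⟩)
        · exact ⟨Or.inl h1, Or.inl h2⟩
        · exact ⟨Or.inr h1, Or.inr h2⟩
    set F1 := insert (min p.1 q.1, max p.2 q.2) ((F.erase p).erase q) with hF1
    have hq' : q ∈ F.erase p := Finset.mem_erase.2 ⟨Ne.symm hpq, hq⟩
    have hc : F1.card < F.card := by
      have c1 : F1.card ≤ ((F.erase p).erase q).card + 1 := Finset.card_insert_le _ _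
      have c2 := Finset.card_erase_of_mem hq'
      have c3 := Finset.card_erase_of_mem hp
      have c4 : 0 < (F.erase p).card := Finset.card_pos.2 ⟨q, hq'⟩
      omega
    have hUF : UF F1 = UF F := by
      have e1 : F = insert p (insert q ((F.erase p).erase q)) := by
        rw [Finset.insert_erase hq', Finset.insert_erase hp]
      rw [e1]
      simp only [UF, hF1, Finset.set_biUnion_insert]
      rw [hU, union_assoc]
    obtain ⟨F', g1, g2, g3, -⟩ := ih F1 (by omega) (by
      intro r hr
      rcases Finset.mem_insert.1 hr with rfl | hr
      · have := h p hp
        exact lt_of_le_of_lt (min_le_left _ _) (lt_of_lt_of_le this (le_max_left _ _))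
      · exact h r (Finset.mem_of_mem_erase (Finset.mem_of_mem_erase hr)))
    exact ⟨F', g1, g2.trans hUF, by omega, fun _ => by omega⟩

lemma sh_good {s d : ℝ} {F : Finset (ℝ × ℝ)} (hF : Good F) :
    ∀ p ∈ F.image (sh s d), p.1 < p.2 := by
  intro q hq
  obtain ⟨p, hp, rfl⟩ := Finset.mem_image.1 hq
  have := hF.1 p hp
  simp only [sh]; linarith

lemma Tn_UF {s d : ℝ} (n : ℕ) : ∀ {F : Finset (ℝ × ℝ)}, Good F →
    ∃ F', Good F' ∧ (T s d)^[n] (UF F) = UF F' := by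
  induction n with
  | zero => intro F hF; exact ⟨F, hF, rfl⟩
  | succ n ih =>
    intro F hF
    rw [Function.iterate_succ_apply, T_UF hF]
    obtain ⟨F1, h1, h2, -⟩ := merge _ (F.image (sh s d)) le_rfl (sh_good hF)
    rw [← h2]
    exact ih h1

lemma open_approx {A : Set ℝ} (hA : IsOpen A) : ∃ F : ℕ → Finset (ℝ × ℝ),
    (∀ n, Good (F n)) ∧ Monotone (fun n => UF (F n)) ∧ ⋃ n, UF (F n) = A := by
  obtain ⟨e, he⟩ := exists_surjective_nat (ℚ × ℚ)
  let F : ℕ → Finset (ℝ × ℝ) := fun n =>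
    ((Finset.range n).image (fun i => (((e i).1 : ℝ), ((e i).2 : ℝ)))).filter
      (fun p => p.1 < p.2 ∧ Ioo p.1 p.2 ⊆ A)
  have hF : ∀ n, ∃ F', Good F' ∧ UF F' = UF (F n) := fun n => by
    obtain ⟨F', h1, h2, -⟩ := merge _ (F n) le_rfl (fun p hp => (Finset.mem_filter.1 hp).2.1)
    exact ⟨F', h1, h2⟩
  choose F' h1 h2 using hF
  refine ⟨F', h1, ?_, ?_⟩
  · simp only [h2]
    intro a b hab x hx
    obtain ⟨p, hp, hp1⟩ := mem_UF.1 hx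
    refine mem_UF.2 ⟨p, ?_, hp1⟩
    rw [Finset.mem_filter] at hp ⊢
    refine ⟨Finset.image_subset_image ?_ hp.1, hp.2⟩
    exact Finset.range_subset_range.2 hab
  · simp only [h2]
    apply Subset.antisymm
    · refine iUnion_subset fun n x hx => ?_
      obtain ⟨p, hp, hp1⟩ := mem_UF.1 hx
      exact (Finset.mem_filter.1 hp).2.2 hp1
    · intro x hx
      obtain ⟨l, hl, hlA⟩ := Metric.isOpen_iff.1 hA x hx
      rw [Real.ball_eq_Ioo] at hlA
      obtain ⟨a, ha1, ha2⟩ := exists_rat_btwn (show x - l < x by linarith)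
      obtain ⟨b, hb1, hb2⟩ := exists_rat_btwn (show x < x + l by linarith)
      obtain ⟨i, hi⟩ := he (a, b)
      refine mem_iUnion.2 ⟨i + 1, mem_UF.2 ⟨((a : ℝ), (b : ℝ)), ?_, ha2, hb1⟩⟩
      rw [Finset.mem_filter]
      refine ⟨Finset.mem_image.2 ⟨i, by simp, by rw [hi]⟩, by simpa using ha2.trans hb1, ?_⟩
      exact (Ioo_subset_Ioo ha1.le hb2.le).trans hlA

/-- one interval -/
lemma sh_lint {s d : ℝ} (hs : 0 ≤ s) (hd : 0 ≤ d) {κ : ℝ → ENNReal}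
    (hκ : ∀ r r', |r| ≤ |r'| → κ r ≤ κ r') (p : ℝ × ℝ) :
    ∫⁻ r in Ioo (sh s d p).1 (sh s d p).2, κ r ≤ ∫⁻ r in Ioo p.1 p.2, κ r := by
  rcases le_or_gt p.2 p.1 with hp | hp
  · rw [Ioo_eq_empty (by simp only [sh]; linarith)]; simp
  by_cases h0 : sg s d p = 0
  · simp [sh, h0]
  have hsg : sg s d p ≤ 0 := by have := phi_le s d ((p.1 + p.2) / 2); simp only [sg]; linarith
  set c := (p.1 + p.2) / 2 + sg s d p / 2 with hc
  have hc0 : 0 ≤ c := by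
    have : s ≤ phi s d ((p.1 + p.2) / 2) := by
      unfold phi
      rcases min_choice ((p.1 + p.2) / 2) (max ((p.1 + p.2) / 2 - d) s) with h | h
      · exfalso; apply h0; simp only [sg, phi, h, sub_self]
      · rw [h]; exact le_max_right _ _
    have e : phi s d ((p.1 + p.2) / 2) = (p.1 + p.2) / 2 + sg s d p := by simp only [sg]; ring
    rw [e] at this
    simp only [hc]; linarith
  set I := Ioo p.1 p.2
  set J := Ioo (sh s d p).1 (sh s d p).2 with hJ
  have hIm : MeasurableSet I := measurableSet_Ioo
  have hJm : MeasurableSet J := measurableSet_Ioo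
  rw [← lintegral_inter_add_sdiff κ J hIm, ← lintegral_inter_add_sdiff κ I hJm, inter_comm]
  refine add_le_add le_rfl ?_
  have hmp := Measure.measurePreserving_sub_left (volume : Measure ℝ) (2 * c)
  have hpre : (fun r => 2 * c - r) ⁻¹' (I \ J) = J \ I := by
    ext r
    simp only [mem_preimage, I, hJ, sh, mem_diff, mem_Ioo, hc]
    constructor
    · rintro ⟨h1, h2⟩
      refine ⟨⟨by linarith, by linarith⟩, fun h3 => h2 ⟨by linarith, by linarith⟩⟩
    · rintro ⟨h1, h2⟩
      refine ⟨⟨by linarith, by linarith⟩, fun h3 => h2 ⟨by linarith, by linarith⟩⟩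
  have := hmp.setLIntegral_comp_preimage_emb
    ((MeasurableEquiv.subLeft (2 * c)).measurableEmbedding) κ (I \ J)
  rw [hpre] at this
  rw [← this]
  refine setLIntegral_mono' (hJm.diff hIm) fun r hr => hκ _ _ ?_
  simp only [I, hJ, sh, mem_diff, mem_Ioo] at hr
  have h1 : r ≤ p.1 := by
    by_contra hcon; push Not at hcon
    exact hr.2 ⟨hcon, by linarith [hr.1.2]⟩
  have h2 : r ≤ c := by simp only [hc]; linarith [hr.1.2]
  rw [abs_of_nonneg (show 0 ≤ 2 * c - r by linarith), abs_le]
  constructor <;> linarith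

lemma T_lint {s d : ℝ} (hs : 0 ≤ s) (hd : 0 ≤ d) {κ : ℝ → ENNReal}
    (hκ : ∀ r r', |r| ≤ |r'| → κ r ≤ κ r') {F : Finset (ℝ × ℝ)} (hF : Good F) :
    ∫⁻ r in T s d (UF F), κ r ≤ ∫⁻ r in UF F, κ r := by
  rw [T_UF hF, ← withDensity_apply _ (UF_open _).measurableSet,
    ← withDensity_apply _ (UF_open _).measurableSet]
  set ν := (volume : Measure ℝ).withDensity κ
  calc ν (UF (F.image (sh s d))) ≤ ∑ p ∈ F, ν (Ioo (sh s d p).1 (sh s d p).2) := by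
        rw [UF, Finset.set_biUnion_finset_image]
        exact measure_biUnion_finset_le _ _
    _ ≤ ∑ p ∈ F, ν (Ioo p.1 p.2) := by
        refine Finset.sum_le_sum fun p _ => ?_
        rw [withDensity_apply _ measurableSet_Ioo, withDensity_apply _ measurableSet_Ioo]
        exact sh_lint hs hd hκ p
    _ = ν (UF F) := (measure_biUnion_finset hF.2 fun _ _ => measurableSet_Ioo).symm

lemma Tn_lint {s d : ℝ} (hs : 0 ≤ s) (hd : 0 ≤ d) {κ : ℝ → ENNReal}
    (hκ : ∀ r r', |r| ≤ |r'| → κ r ≤ κ r') {F : Finset (ℝ × ℝ)} (hF : Good F) (n : ℕ) :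
    ∫⁻ r in (T s d)^[n] (UF F), κ r ≤ ∫⁻ r in UF F, κ r := by
  induction n with
  | zero => simp
  | succ n ih =>
    rw [Function.iterate_succ_apply']
    obtain ⟨F', h1, h2⟩ := Tn_UF (s := s) (d := d) n hF
    rw [h2] at ih ⊢
    exact (T_lint hs hd hκ h1).trans ih

lemma S_lint {s t : ℝ} (hs : 0 ≤ s) (ht : 0 ≤ t) {κ : ℝ → ENNReal}
    (hκ : ∀ r r', |r| ≤ |r'| → κ r ≤ κ r') {A : Set ℝ} (hA : IsOpen A) :
    ∫⁻ r in S s t A, κ r ≤ ∫⁻ r in A, κ r := by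
  obtain ⟨F, h1, h2, h3⟩ := open_approx hA
  rw [← h3, S_iUnion (fun n => UF_open _) h2]
  have hSo : ∀ n, IsOpen (S s t (UF (F n))) := fun n => S_open (UF_open _)
  rw [← withDensity_apply _ (isOpen_iUnion hSo).measurableSet]
  set ν := (volume : Measure ℝ).withDensity κ with hν
  have hm : Monotone fun n => S s t (UF (F n)) := fun a b h => S_mono (h2 h)
  rw [hm.measure_iUnion]
  refine iSup_le fun n => ?_
  rw [S, (S_dir ht _).measure_iUnion]
  refine iSup_le fun k => ?_
  rw [withDensity_apply _ (Tn_open (UF_open _) _).measurableSet]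
  refine (Tn_lint hs (by positivity) hκ (h1 n) _).trans ?_
  exact lintegral_mono_set (subset_iUnion (fun n => UF (F n)) n)

lemma UF_vol {F : Finset (ℝ × ℝ)} (hF : Good F) :
    volume (UF F) = ENNReal.ofReal (∑ p ∈ F, (p.2 - p.1)) := by
  rw [UF, measure_biUnion_finset hF.2 fun _ _ => measurableSet_Ioo,
    ENNReal.ofReal_sum_of_nonneg fun p hp => by linarith [hF.1 p hp]]
  exact Finset.sum_congr rfl fun p _ => Real.volume_Ioo

lemma T_loss {s d : ℝ} (hd : 0 ≤ d) {F : Finset (ℝ × ℝ)} (hF : Good F) :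
    volume (UF F) ≤ volume (T s d (UF F)) + ENNReal.ofReal (F.card * d) := by
  have hsub : (⋃ p ∈ F, Ioo (p.1 + d + sg s d p) (p.2 + sg s d p)) ⊆ T s d (UF F) := by
    rw [T_UF hF]
    intro x hx
    simp only [mem_iUnion, mem_Ioo] at hx
    obtain ⟨p, hp, h1, h2⟩ := hx
    exact mem_UF.2 ⟨sh s d p, Finset.mem_image_of_mem _ hp, by simp only [sh]; linarith,
      by simp only [sh]; linarith⟩
  have hb : ∀ p : ℝ × ℝ, -d ≤ sg s d p ∧ sg s d p ≤ 0 := fun p => by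
    have := phi_le s d ((p.1 + p.2) / 2)
    have := le_phi (s := s) hd ((p.1 + p.2) / 2)
    simp only [sg]; constructor <;> linarith
  have hdis : (F : Set (ℝ × ℝ)).PairwiseDisjoint
      (fun p => Ioo (p.1 + d + sg s d p) (p.2 + sg s d p)) := by
    refine hF.2.mono_on fun p hp => Ioo_subset_Ioo ?_ ?_
    · have := hb p; linarith
    · have := hb p; linarith
  have h1 := measure_mono (μ := volume) hsub
  rw [measure_biUnion_finset hdis fun _ _ => measurableSet_Ioo] at h1
  calc volume (UF F) = ∑ p ∈ F, ENNReal.ofReal (p.2 - p.1) := by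
        rw [UF, measure_biUnion_finset hF.2 fun _ _ => measurableSet_Ioo]
        simp
    _ ≤ ∑ p ∈ F, (volume (Ioo (p.1 + d + sg s d p) (p.2 + sg s d p)) + ENNReal.ofReal d) := by
        refine Finset.sum_le_sum fun p _ => ?_
        rw [Real.volume_Ioo]
        refine le_trans (ENNReal.ofReal_le_ofReal ?_) ENNReal.ofReal_add_le
        linarith
    _ = ∑ p ∈ F, volume (Ioo (p.1 + d + sg s d p) (p.2 + sg s d p))
          + ENNReal.ofReal (F.card * d) := by
        rw [Finset.sum_add_distrib, Finset.sum_const, ENNReal.ofReal_mul (by positivity)]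
        simp
    _ ≤ _ := by gcongr

lemma T_noloss {s d : ℝ} {F : Finset (ℝ × ℝ)} (hF : Good F)
    (h : Good (F.image (sh s d))) (hc : (F.image (sh s d)).card = F.card) :
    volume (T s d (UF F)) = volume (UF F) := by
  have hinj := Finset.card_image_iff.1 hc
  rw [T_UF hF, UF_vol h, UF_vol hF, Finset.sum_image hinj]
  congr 1
  refine Finset.sum_congr rfl fun p _ => ?_
  simp only [sh]; ring

lemma Tn_loss {s d : ℝ} (hd : 0 ≤ d) (n : ℕ) : ∀ {F : Finset (ℝ × ℝ)}, Good F →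
    volume (UF F) ≤ volume ((T s d)^[n] (UF F)) + ENNReal.ofReal ((F.card : ℝ) ^ 2 * d) := by
  induction n with
  | zero => intro F hF; simp
  | succ n ih =>
    intro F hF
    rw [Function.iterate_succ_apply]
    obtain ⟨F1, h1, h2, h3, h4⟩ := merge _ (F.image (sh s d)) le_rfl (sh_good hF)
    have hic := Finset.card_image_le (s := F) (f := sh s d)
    have hTF : T s d (UF F) = UF F1 := by rw [T_UF hF, h2]
    by_cases hcase : Good (F.image (sh s d)) ∧ (F.image (sh s d)).card = F.card
    · rw [← T_noloss hF hcase.1 hcase.2, hTF]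
      refine (ih h1).trans ?_
      have : (F1.card : ℝ) ≤ F.card := by exact_mod_cast h3.trans hic
      gcongr
    · have hlt : F1.card + 1 ≤ F.card := by
        by_cases hg : Good (F.image (sh s d))
        · have : (F.image (sh s d)).card ≠ F.card := fun h => hcase ⟨hg, h⟩
          omega
        · have := h4 hg; omega
      have hl := T_loss (s := s) hd hF
      rw [hTF] at hl ⊢
      calc volume (UF F) ≤ volume (UF F1) + ENNReal.ofReal (F.card * d) := hl
        _ ≤ volume ((T s d)^[n] (UF F1)) + ENNReal.ofReal ((F1.card : ℝ) ^ 2 * d)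
            + ENNReal.ofReal (F.card * d) := by gcongr; exact ih h1
        _ = volume ((T s d)^[n] (UF F1)) + ENNReal.ofReal ((F1.card : ℝ) ^ 2 * d
            + F.card * d) := by rw [ENNReal.ofReal_add (by positivity) (by positivity), add_assoc]
        _ ≤ _ := by
          gcongr
          have : (F1.card : ℝ) + 1 ≤ F.card := by exact_mod_cast hlt
          rw [← add_mul]
          gcongr
          have : (0:ℝ) ≤ F1.card := by positivity
          nlinarith

lemma S_vol {s t : ℝ} (hs : 0 ≤ s) (ht : 0 ≤ t) {A : Set ℝ} (hA : IsOpen A) :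
    volume (S s t A) = volume A := by
  apply le_antisymm
  · have := S_lint hs ht (κ := fun _ => 1) (fun _ _ _ => le_rfl) hA
    simpa using this
  · obtain ⟨F, h1, h2, h3⟩ := open_approx hA
    conv_lhs => rw [← h3]
    rw [h2.measure_iUnion]
    refine iSup_le fun n => ?_
    have hsub : S s t (UF (F n)) ⊆ S s t A := S_mono (h3 ▸ subset_iUnion (fun n => UF (F n)) n)
    refine le_trans ?_ (measure_mono hsub)
    have hk : ∀ k : ℕ, volume (UF (F n)) ≤ volume (S s t (UF (F n))) +
        ENNReal.ofReal (((F n).card : ℝ) ^ 2 * (t / 2 ^ k)) := fun k => by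
      refine (Tn_loss (s := s) (d := t / 2 ^ k) (by positivity) (2 ^ k) (h1 n)).trans ?_
      gcongr
      exact subset_iUnion (fun k : ℕ => (T s (t / 2 ^ k))^[2 ^ k] (UF (F n))) k
    have hlim : Filter.Tendsto (fun k : ℕ => volume (S s t (UF (F n))) +
        ENNReal.ofReal (((F n).card : ℝ) ^ 2 * (t / 2 ^ k))) Filter.atTop
        (nhds (volume (S s t (UF (F n))) + 0)) := by
      refine Filter.Tendsto.add tendsto_const_nhds ?_
      rw [← ENNReal.ofReal_zero]
      refine ENNReal.tendsto_ofReal ?_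
      have h4 : Filter.Tendsto (fun k : ℕ => t * (1 / 2 : ℝ) ^ k) Filter.atTop (nhds (t * 0)) :=
        (tendsto_pow_atTop_nhds_zero_of_lt_one (by norm_num) (by norm_num)).const_mul t
      have h5 := h4.const_mul (((F n).card : ℝ) ^ 2)
      simp only [mul_zero] at h5
      refine h5.congr fun k => ?_
      rw [one_div, inv_pow]; rfl
    rw [add_zero] at hlim
    exact ge_of_tendsto' hlim hk

end CS
end

section
open Set Metric MeasureTheory Bornology
open scoped RealInnerProductSpace Classical

namespace CS

section ND
variable {V : Type*} [NormedAddCommGroup V] [InnerProductSpace ℝ V]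

/-- projection orthogonal to `e` -/
noncomputable def pr (e x : V) : V := x - (⟪x, e⟫ : ℝ) • e

/-- slice through `x` -/
def sl (e : V) (A : Set V) (x : V) : Set ℝ := {ρ | pr e x + ρ • e ∈ A}

/-- N-dimensional continuous symmetrization of sets -/
def SS (s t : ℝ) (e : V) (A : Set V) : Set V := {x | (⟪x, e⟫ : ℝ) ∈ S s t (sl e A x)}

lemma pr_self (e x : V) : pr e x + (⟪x, e⟫ : ℝ) • e = x := by simp [pr]

lemma inner_pr {e : V} (he : ‖e‖ = 1) (x : V) : (⟪pr e x, e⟫ : ℝ) = 0 := by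
  simp [pr, inner_sub_left, inner_smul_left, he]

lemma inner_pr_add {e : V} (he : ‖e‖ = 1) (x : V) (ρ : ℝ) : (⟪pr e x + ρ • e, e⟫ : ℝ) = ρ := by
  simp [inner_add_left, inner_pr he, inner_smul_left, he]

lemma pr_pr_add {e : V} (he : ‖e‖ = 1) (x : V) (ρ : ℝ) : pr e (pr e x + ρ • e) = pr e x := by
  conv_lhs => rw [pr, inner_pr_add he]
  simp

lemma pr_sub (e x y : V) : pr e x - pr e y = pr e (x - y) := by
  simp only [pr, inner_sub_left, sub_smul]; abel

lemma norm_sq_pr_add {e : V} (he : ‖e‖ = 1) (x : V) (ρ : ℝ) :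
    ‖pr e x + ρ • e‖ ^ 2 = ‖pr e x‖ ^ 2 + ρ ^ 2 := by
  rw [norm_add_sq_real, inner_smul_right, inner_pr he, norm_smul, he]
  simp

lemma sl_mono {e : V} {A B : Set V} (h : A ⊆ B) (x : V) : sl e A x ⊆ sl e B x :=
  fun _ hρ => h hρ

lemma SS_mono {s t : ℝ} {e : V} {A B : Set V} (h : A ⊆ B) : SS s t e A ⊆ SS s t e B :=
  fun x hx => S_mono (sl_mono h x) hx

lemma sl_open {e : V} {A : Set V} (hA : IsOpen A) (x : V) : IsOpen (sl e A x) :=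
  hA.preimage (f := fun ρ : ℝ => pr e x + ρ • e) (by fun_prop)

lemma sl_SS {s t : ℝ} {e : V} (he : ‖e‖ = 1) (A : Set V) (x : V) :
    sl e (SS s t e A) x = S s t (sl e A x) := by
  ext ρ
  show (⟪pr e x + ρ • e, e⟫ : ℝ) ∈ S s t (sl e A (pr e x + ρ • e)) ↔ _
  rw [inner_pr_add he]
  have : sl e A (pr e x + ρ • e) = sl e A x := by
    ext r; simp only [sl, mem_ofPred_eq, pr_pr_add he]
  rw [this]

lemma SS_iUnion {s t : ℝ} {e : V} {A : ℕ → Set V} (hA : ∀ n, IsOpen (A n)) (hm : Monotone A) :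
    SS s t e (⋃ n, A n) = ⋃ n, SS s t e (A n) := by
  ext x
  simp only [SS, mem_ofPred_eq, mem_iUnion]
  have : sl e (⋃ n, A n) x = ⋃ n, sl e (A n) x := by
    ext r; simp [sl]
  rw [this, S_iUnion (fun n => sl_open (hA n) x) (fun a b h => sl_mono (hm h) x), mem_iUnion]

lemma SS_empty (s t : ℝ) (e : V) : SS s t e ∅ = ∅ := by
  ext x
  have : sl e ∅ x = ∅ := by ext r; simp [sl]
  simp [SS, this, S_empty]

lemma SS_thick {s t h : ℝ} {e : V} (he : ‖e‖ = 1) {A B : Set V}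
    (hAB : ∀ x ∈ A, ∀ y, ‖y - x‖ ≤ h → y ∈ B) :
    ∀ x ∈ SS s t e A, ∀ y, ‖y - x‖ ≤ h → y ∈ SS s t e B := by
  intro x hx y hy
  have hm : Mink |(⟪y, e⟫ : ℝ) - ⟪x, e⟫| (sl e A x) (sl e B y) := by
    intro ρ hρ ρ' hρ'
    refine hAB _ hρ _ ?_
    have e1 : pr e y + ρ' • e - (pr e x + ρ • e) = pr e (y - x) + (ρ' - ρ) • e := by
      rw [← pr_sub, sub_smul]; abel
    rw [e1]
    refine le_trans ?_ hy
    rw [← abs_of_nonneg (norm_nonneg (pr e (y - x) + (ρ' - ρ) • e)),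
      ← abs_of_nonneg (norm_nonneg (y - x)), ← sq_le_sq, norm_sq_pr_add he]
    conv_rhs => rw [← pr_self e (y - x), norm_sq_pr_add he, inner_sub_left]
    have := sq_le_sq.2 hρ'
    linarith
  exact S_mink hm _ hx _ le_rfl

lemma SS_open {s t : ℝ} {e : V} (he : ‖e‖ = 1) {A : Set V} (hA : IsOpen A) :
    IsOpen (SS s t e A) := by
  let An : ℕ → Set V := fun n => {y | ENNReal.ofReal (1 / (n + 1)) < infEDist y Aᶜ}
  have h1 : ∀ n, IsOpen (An n) := fun n =>
    isOpen_lt continuous_const continuous_infEDist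
  have h2 : Monotone An := by
    intro a b hab y hy
    refine lt_of_le_of_lt (ENNReal.ofReal_le_ofReal ?_) hy
    gcongr
  have h3 : ⋃ n, An n = A := by
    apply Subset.antisymm
    · refine iUnion_subset fun n y hy => ?_
      by_contra hcon
      have : infEDist y Aᶜ = 0 := infEDist_zero_of_mem hcon
      simp only [An, mem_ofPred_eq, this] at hy
      exact absurd hy (by simp)
    · intro y hy
      have : infEDist y Aᶜ ≠ 0 := by
        intro h
        have := mem_closure_iff_infEDist_zero.2 h
        rw [hA.isClosed_compl.closure_eq] at this
        exact this hy
      obtain ⟨n, hn⟩ := ENNReal.exists_inv_nat_lt this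
      refine mem_iUnion.2 ⟨n, lt_of_le_of_lt ?_ hn⟩
      rcases Nat.eq_zero_or_pos n with rfl | hn0
      · simp
      rw [← ENNReal.ofReal_natCast, ← ENNReal.ofReal_inv_of_pos (by exact_mod_cast hn0), ← one_div]
      refine ENNReal.ofReal_le_ofReal ?_
      apply one_div_le_one_div_of_le (by exact_mod_cast hn0) (by linarith)
  rw [isOpen_iff]
  intro x hx
  rw [← h3, SS_iUnion h1 h2] at hx
  obtain ⟨n, hn⟩ := mem_iUnion.1 hx
  refine ⟨1 / (n + 1), by positivity, fun y hy => ?_⟩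
  refine SS_thick (h := 1 / (n + 1)) he ?_ x hn y ?_
  · intro z hz w hw
    by_contra hcon
    have h4 : infEDist z Aᶜ ≤ edist z w := infEDist_le_edist_of_mem hcon
    have h5 : edist z w ≤ ENNReal.ofReal (1 / (n + 1)) := by
      rw [edist_dist]
      refine ENNReal.ofReal_le_ofReal ?_
      rw [dist_comm, dist_eq_norm]; exact hw
    exact absurd (lt_of_lt_of_le hz (h4.trans h5)) (lt_irrefl _)
  · rw [← dist_eq_norm]; exact (mem_ball.1 hy).le

lemma T_center {s d l : ℝ} (hs : 0 ≤ s) (hd : 0 ≤ d) {A : Set ℝ} (hA : ∀ x ∈ A, |x| < l) :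
    ∀ x ∈ T s d A, |x| < l := by
  rintro r ⟨m, k, h1, h2⟩
  have hk : 0 < k := (abs_nonneg _).trans_lt h1
  have h0 : phi s d 0 = 0 := by
    unfold phi; rw [min_eq_left]; exact le_max_of_le_right hs
  have h3 : |m| + k ≤ l := by
    refine le_of_forall_lt fun y hy => ?_
    rcases le_total 0 m with hm | hm
    · rw [abs_of_nonneg hm] at hy
      have := hA (max y m) (h2 _ (by
        rw [abs_of_nonneg (by simp)]; rcases max_cases y m with h | h <;> linarith))
      exact lt_of_le_of_lt ((le_max_left y m).trans (le_abs_self _)) this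
    · rw [abs_of_nonpos hm] at hy
      have := hA (min (-y) m) (h2 _ (by
        rw [abs_of_nonpos (by simp)]; rcases min_cases (-y) m with h | h <;> linarith))
      refine lt_of_le_of_lt ?_ this
      have := min_le_left (-y) m
      have := neg_abs_le (min (-y) m)
      linarith
  have h4 := phi_lip s d m 0
  rw [h0, sub_zero, sub_zero] at h4
  have h5 := abs_sub_abs_le_abs_sub r (phi s d m)
  linarith

lemma S_center {s t l : ℝ} (hs : 0 ≤ s) (ht : 0 ≤ t) {A : Set ℝ} (hA : ∀ x ∈ A, |x| < l) :
    ∀ x ∈ S s t A, |x| < l := by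
  intro x hx
  obtain ⟨k, hk⟩ := mem_iUnion.1 hx
  have : ∀ n, ∀ x ∈ (T s (t / 2 ^ k))^[n] A, |x| < l := by
    intro n
    induction n with
    | zero => exact hA
    | succ n ih => rw [Function.iterate_succ_apply']; exact T_center hs (by positivity) ih
  exact this _ x hk

lemma SS_ball {s t R : ℝ} {e : V} (he : ‖e‖ = 1) (hs : 0 ≤ s) (ht : 0 ≤ t) {A : Set V}
    (hA : A ⊆ ball 0 R) : SS s t e A ⊆ ball 0 R := by
  intro x hx
  have key : ∀ ρ ∈ sl e A x, |ρ| < √(R ^ 2 - ‖pr e x‖ ^ 2) := by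
    intro ρ hρ
    have h1 := hA hρ
    rw [mem_ball_zero_iff] at h1
    apply Real.lt_sqrt_of_sq_lt
    rw [sq_abs]
    have h2 := norm_sq_pr_add he x ρ
    have : ‖pr e x + ρ • e‖ ^ 2 < R ^ 2 := by gcongr
    linarith
  have h2 := S_center hs ht key _ hx
  have hpos : 0 < R ^ 2 - ‖pr e x‖ ^ 2 := by
    by_contra hcon
    push Not at hcon
    rw [Real.sqrt_eq_zero'.2 hcon] at h2
    exact absurd h2 (not_lt.2 (abs_nonneg _))
  have hR : 0 < R := by
    obtain ⟨r', h3, -⟩ := S_near ht hx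
    have := mem_ball_zero_iff.1 (hA h3)
    exact (norm_nonneg _).trans_lt this
  rw [mem_ball_zero_iff]
  rw [Real.lt_sqrt (abs_nonneg _), sq_abs] at h2
  have h4 := norm_sq_pr_add he x (⟪x, e⟫ : ℝ)
  rw [pr_self] at h4
  exact lt_of_pow_lt_pow_left₀ 2 hR.le (by linarith)

end ND

section Meas
variable {V : Type*} [NormedAddCommGroup V] [InnerProductSpace ℝ V] [FiniteDimensional ℝ V]
  [MeasurableSpace V] [BorelSpace V]

/-- weight -/
noncomputable def wt (c : ℝ) : ENNReal := (Ioo (0:ℝ) 1).indicator 1 c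

lemma wt_meas : Measurable wt := measurable_one.indicator measurableSet_Ioo

lemma wt_int (c : ℝ) : ∫⁻ r, wt (c + r) = 1 := by
  rw [lintegral_add_left_eq_self (fun r => wt r) c]
  unfold wt
  rw [lintegral_indicator measurableSet_Ioo]
  simp

lemma line_lint {e : V} (he : ‖e‖ = 1) {F : V → ENNReal} (hF : Measurable F) :
    ∫⁻ x, F x = ∫⁻ y, wt (⟪y, e⟫ : ℝ) * ∫⁻ ρ : ℝ, F (pr e y + ρ • e) := by
  have i0 : Measurable fun x : V => (⟪x, e⟫ : ℝ) := by fun_prop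
  calc ∫⁻ x, F x = ∫⁻ x, ∫⁻ r : ℝ, F x * wt ((⟪x, e⟫ : ℝ) + r) := by
        refine lintegral_congr fun x => ?_
        have hm : Measurable fun r : ℝ => wt ((⟪x, e⟫ : ℝ) + r) := wt_meas.comp (by fun_prop)
        rw [lintegral_const_mul _ hm, wt_int, mul_one]
    _ = ∫⁻ r : ℝ, ∫⁻ x, F x * wt ((⟪x, e⟫ : ℝ) + r) := by
        refine lintegral_lintegral_swap (Measurable.aemeasurable ?_)
        exact (hF.comp measurable_fst).mul (wt_meas.comp ((i0.comp measurable_fst).add measurable_snd))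
    _ = ∫⁻ r : ℝ, ∫⁻ y, F (y - r • e) * wt (⟪y, e⟫ : ℝ) := by
        refine lintegral_congr fun r => ?_
        rw [← lintegral_sub_right_eq_self _ (r • e)]
        refine lintegral_congr fun y => ?_
        congr 2
        rw [inner_sub_left, inner_smul_left, real_inner_self_eq_norm_sq, he]; simp
    _ = ∫⁻ y, ∫⁻ r : ℝ, F (y - r • e) * wt (⟪y, e⟫ : ℝ) := by
        refine lintegral_lintegral_swap (Measurable.aemeasurable ?_)
        refine (hF.comp ?_).mul (wt_meas.comp (i0.comp measurable_snd))
        fun_prop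
    _ = _ := by
        refine lintegral_congr fun y => ?_
        have hm : Measurable fun r : ℝ => F (y - r • e) := hF.comp (by fun_prop)
        rw [lintegral_mul_const _ hm, mul_comm]
        congr 1
        rw [← lintegral_sub_left_eq_self (fun ρ : ℝ => F (pr e y + ρ • e)) (⟪y, e⟫ : ℝ)]
        refine lintegral_congr fun r => ?_
        congr 1
        rw [sub_smul, pr]; abel

lemma line_lint_set {e : V} (he : ‖e‖ = 1) {F : V → ENNReal} (hF : Measurable F) {A : Set V}
    (hA : IsOpen A) :
    ∫⁻ x in A, F x = ∫⁻ y, wt (⟪y, e⟫ : ℝ) * ∫⁻ ρ in sl e A y, F (pr e y + ρ • e) := by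
  rw [← lintegral_indicator hA.measurableSet, line_lint he (hF.indicator hA.measurableSet)]
  refine lintegral_congr fun y => ?_
  rw [← lintegral_indicator (sl_open hA y).measurableSet]
  rfl

lemma SS_lint {s t : ℝ} {e : V} (he : ‖e‖ = 1) (hs : 0 ≤ s) (ht : 0 ≤ t) {k : ℝ → ENNReal}
    (hk : Monotone k) {A : Set V} (hA : IsOpen A) :
    ∫⁻ x in SS s t e A, k ‖x‖ ≤ ∫⁻ x in A, k ‖x‖ := by
  have hm : Measurable fun x : V => k ‖x‖ := hk.measurable.comp measurable_norm
  rw [line_lint_set he hm hA, line_lint_set he hm (SS_open he hA)]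
  refine lintegral_mono fun y => ?_
  refine mul_le_mul_right ?_ _
  rw [sl_SS he]
  refine S_lint hs ht (κ := fun ρ => k ‖pr e y + ρ • e‖) ?_ (sl_open hA y)
  intro r r' h
  apply hk
  rw [← abs_of_nonneg (norm_nonneg (pr e y + r • e)),
      ← abs_of_nonneg (norm_nonneg (pr e y + r' • e)), ← sq_le_sq, norm_sq_pr_add he,
      norm_sq_pr_add he]
  have := sq_le_sq.2 h
  linarith

lemma SS_vol {s t : ℝ} {e : V} (he : ‖e‖ = 1) (hs : 0 ≤ s) (ht : 0 ≤ t) {A : Set V}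
    (hA : IsOpen A) : volume (SS s t e A) = volume A := by
  have h1 := line_lint_set he (F := fun _ => 1) measurable_const hA
  have h2 := line_lint_set he (F := fun _ => 1) measurable_const (SS_open (s := s) (t := t) he hA)
  simp only [lintegral_const, one_mul, Measure.restrict_apply MeasurableSet.univ, univ_inter] at h1 h2
  rw [h1, h2]
  refine lintegral_congr fun y => ?_
  rw [sl_SS he, S_vol hs ht (sl_open hA y)]

end Meas
end CS
end

section
open Set Metric MeasureTheory Bornology
open scoped RealInnerProductSpace Classical NNReal

namespace CS

section ND
variable {V : Type*} [NormedAddCommGroup V] [InnerProductSpace ℝ V]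

/-- admissible functions -/
structure Adm (K : ℝ≥0) (R : ℝ) (v : V → ℝ) : Prop where
  lip : LipschitzWith K v
  nn : ∀ x, 0 ≤ v x
  zero : ∀ x, x ∉ ball (0:V) R → v x = 0

lemma Adm.le {K : ℝ≥0} {R : ℝ} {v : V → ℝ} (hv : Adm K R v) (x y : V) :
    v x ≤ v y + K * ‖x - y‖ := by
  have := hv.lip.dist_le_mul x y
  rw [Real.dist_eq, dist_eq_norm] at this
  have := (abs_le.1 this).2
  linarith

lemma Adm.lev_open {K : ℝ≥0} {R : ℝ} {v : V → ℝ} (hv : Adm K R v) (l : ℝ) :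
    IsOpen {y | l < v y} := isOpen_lt continuous_const hv.lip.continuous

/-- symmetrized function -/
noncomputable def vt (s t : ℝ) (e : V) (v : V → ℝ) (x : V) : ℝ :=
  sSup {l : ℝ | 0 ≤ l ∧ x ∈ SS s t e {y | l < v y}}

variable {K : ℝ≥0} {R s t : ℝ} {e : V} {v : V → ℝ}

lemma SS_lev_bd (hv : Adm K R v) (ht : 0 ≤ t) (he : ‖e‖ = 1) {x : V} {l : ℝ}
    (h : x ∈ SS s t e {y | l < v y}) : l < v x + K * t := by
  obtain ⟨ρ, h1, h2⟩ := S_near ht h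
  have h3 : l < v (pr e x + ρ • e) := h1
  have h4 := hv.le (pr e x + ρ • e) x
  have h5 : ‖pr e x + ρ • e - x‖ ≤ t := by
    have : pr e x + ρ • e - x = (ρ - (⟪x, e⟫ : ℝ)) • e := by rw [pr, sub_smul]; abel
    rw [this, norm_smul, he, mul_one, Real.norm_eq_abs, abs_sub_comm]; exact h2
  have h6 : (K : ℝ) * ‖pr e x + ρ • e - x‖ ≤ K * t := by gcongr
  linarith

lemma vt_bdd (hv : Adm K R v) (ht : 0 ≤ t) (he : ‖e‖ = 1) (x : V) :
    BddAbove {l : ℝ | 0 ≤ l ∧ x ∈ SS s t e {y | l < v y}} :=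
  ⟨v x + K * t, fun _ hl => (SS_lev_bd hv ht he hl.2).le⟩

lemma lt_vt (hv : Adm K R v) (ht : 0 ≤ t) (he : ‖e‖ = 1) {x : V} {l : ℝ} (hl : 0 ≤ l) :
    l < vt s t e v x ↔ x ∈ SS s t e {y | l < v y} := by
  constructor
  · intro h
    have hne : {l : ℝ | 0 ≤ l ∧ x ∈ SS s t e {y | l < v y}}.Nonempty := by
      by_contra hcon
      rw [not_nonempty_iff_eq_empty] at hcon
      rw [vt, hcon, Real.sSup_empty] at h
      linarith
    obtain ⟨l', h1, h2⟩ := exists_lt_of_lt_csSup hne h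
    exact SS_mono (fun y (hy : l' < v y) => show l < v y from h2.trans hy) h1.2
  · intro h
    have hU : {y | l < v y} = ⋃ n : ℕ, {y | l + 1 / (n + 1) < v y} := by
      ext y
      simp only [mem_ofPred_eq, mem_iUnion]
      constructor
      · intro h
        obtain ⟨n, hn⟩ := exists_nat_one_div_lt (sub_pos.2 h)
        exact ⟨n, by linarith⟩
      · rintro ⟨n, hn⟩
        have : (0:ℝ) < 1 / (n + 1) := by positivity
        linarith
    rw [hU, SS_iUnion (fun n => hv.lev_open _)] at h
    · obtain ⟨n, hn⟩ := mem_iUnion.1 h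
      have : (0:ℝ) < 1 / (n + 1) := by positivity
      have h2 : l + 1 / (n + 1) ≤ vt s t e v x :=
        le_csSup (vt_bdd hv ht he x) ⟨by linarith, hn⟩
      linarith
    · intro a b hab y (hy : l + 1 / (a + 1) < v y)
      show l + 1 / (b + 1) < v y
      refine lt_of_le_of_lt ?_ hy
      gcongr

lemma vt_nonneg (x : V) : 0 ≤ vt s t e v x := Real.sSup_nonneg fun _ h => h.1

lemma vt_adm (hv : Adm K R v) (hs : 0 ≤ s) (ht : 0 ≤ t) (he : ‖e‖ = 1) :
    Adm K R (vt s t e v) := by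
  refine ⟨?_, vt_nonneg, ?_⟩
  · refine LipschitzWith.of_le_add_mul K fun x y => ?_
    refine le_of_forall_lt fun l hl => ?_
    rw [dist_eq_norm]
    by_contra hcon
    push Not at hcon
    have h0 : 0 ≤ vt s t e v y := vt_nonneg y
    have hK : 0 ≤ (K : ℝ) * ‖x - y‖ := by positivity
    have hl0 : 0 ≤ l := by linarith
    have h1 := (lt_vt hv ht he hl0).1 hl
    have h2 : y ∈ SS s t e {z | l - K * ‖x - y‖ < v z} := by
      refine SS_thick (h := ‖y - x‖) he ?_ x h1 y le_rfl
      intro z (hz : l < v z) w hw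
      show l - K * ‖x - y‖ < v w
      have h3 := hv.le z w
      have h4 : (K : ℝ) * ‖z - w‖ ≤ K * ‖x - y‖ := by
        rw [norm_sub_rev z w, norm_sub_rev x y]; gcongr
      linarith
    have h3 := (lt_vt hv ht he (by linarith)).2 h2
    linarith
  · intro x hx
    by_contra hcon
    have h1 : 0 < vt s t e v x := lt_of_le_of_ne (vt_nonneg x) (Ne.symm hcon)
    refine hx (SS_ball he hs ht ?_ ((lt_vt hv ht he le_rfl).1 h1))
    intro y (hy : 0 < v y)
    by_contra hy2
    rw [hv.zero y hy2] at hy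
    exact lt_irrefl _ hy

lemma vt_near (hv : Adm K R v) (ht : 0 ≤ t) (he : ‖e‖ = 1) (x : V) :
    |vt s t e v x - v x| ≤ K * t := by
  rw [abs_le]
  have hKt : 0 ≤ (K : ℝ) * t := by positivity
  constructor
  · by_contra hcon
    push Not at hcon
    have h0 : 0 ≤ vt s t e v x := vt_nonneg x
    set l := vt s t e v x with hl
    obtain ⟨c, hc1, hc2⟩ := exists_between (show l < v x - K * t by linarith)
    -- choose room
    obtain ⟨η, hη, hη2⟩ : ∃ η : ℝ, 0 < η ∧ c < v x - K * (t + η) := by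
      refine ⟨(v x - K * t - c) / (K + 1), by apply div_pos <;> [linarith; positivity], ?_⟩
      have hK1 : (0:ℝ) < K + 1 := by positivity
      have : (K : ℝ) * ((v x - K * t - c) / (K + 1)) < v x - K * t - c := by
        rw [← mul_div_assoc, div_lt_iff₀ hK1]; nlinarith [K.2]
      nlinarith
    have h1 : x ∈ SS s t e {y | c < v y} := by
      refine S_interval (m := (⟪x, e⟫ : ℝ)) (l := t + η) ?_ ?_
      · intro ρ hρ
        show c < v (pr e x + ρ • e)
        have h3 := hv.le x (pr e x + ρ • e)
        have h4 : ‖x - (pr e x + ρ • e)‖ ≤ t + η := by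
          have : x - (pr e x + ρ • e) = ((⟪x, e⟫ : ℝ) - ρ) • e := by rw [pr, sub_smul]; abel
          rw [this, norm_smul, he, mul_one, Real.norm_eq_abs, abs_sub_comm]; exact hρ.le
        have h5 : (K : ℝ) * ‖x - (pr e x + ρ • e)‖ ≤ K * (t + η) := by gcongr
        linarith
      · have := phi_le s t (⟪x, e⟫ : ℝ)
        have := le_phi (s := s) ht (⟪x, e⟫ : ℝ)
        rw [abs_lt]; constructor <;> linarith
    have := (lt_vt hv ht he (by linarith)).2 h1
    linarith
  · by_contra hcon
    push Not at hcon
    have h0 := hv.nn x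
    have h1 := SS_lev_bd hv ht he ((lt_vt hv ht he (by linarith)).1
      (show v x + K * t < vt s t e v x by linarith))
    linarith

end ND

section Meas
variable {V : Type*} [NormedAddCommGroup V] [InnerProductSpace ℝ V] [FiniteDimensional ℝ V]
  [MeasurableSpace V] [BorelSpace V]
variable {K : ℝ≥0} {R s t : ℝ} {e : V} {v : V → ℝ}

lemma Adm.supp (hv : Adm K R v) : Function.support v ⊆ ball 0 R := by
  intro x hx
  by_contra hcon
  exact hx (hv.zero x hcon)

lemma Adm.compact (hv : Adm K R v) : HasCompactSupport v :=
  HasCompactSupport.of_support_subset_isCompact (isCompact_closedBall (0:V) R)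
    (hv.supp.trans ball_subset_closedBall)

lemma Adm.integrable (hv : Adm K R v) : Integrable v :=
  hv.lip.continuous.integrable_of_hasCompactSupport hv.compact

lemma vt_int (hv : Adm K R v) (hs : 0 ≤ s) (ht : 0 ≤ t) (he : ‖e‖ = 1) :
    ∫ x, vt s t e v x = ∫ x, v x := by
  have hw := vt_adm (s := s) (t := t) hv hs ht he
  rw [integral_eq_lintegral_of_nonneg_ae (.of_forall hw.nn) hw.integrable.1,
    integral_eq_lintegral_of_nonneg_ae (.of_forall hv.nn) hv.integrable.1]
  rw [lintegral_eq_lintegral_meas_lt _ (.of_forall hw.nn) hw.lip.continuous.aemeasurable,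
    lintegral_eq_lintegral_meas_lt _ (.of_forall hv.nn) hv.lip.continuous.aemeasurable]
  congr 1
  refine setLIntegral_congr_fun measurableSet_Ioi fun l hl => ?_
  have : {x | l < vt s t e v x} = SS s t e {x | l < v x} := by
    ext x; exact lt_vt hv ht he (le_of_lt hl)
  show volume {x | l < vt s t e v x} = volume {x | l < v x}
  rw [this, SS_vol he hs ht (hv.lev_open l)]

/-- f-term: layer cake -/
lemma vt_layer (hv : Adm K R v) (hs : 0 ≤ s) (ht : 0 ≤ t) (he : ‖e‖ = 1)
    {k : ℝ → ℝ → ℝ} (hkc : Continuous (fun q : ℝ × ℝ => k q.1 q.2))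
    (hk0 : ∀ r l, 0 ≤ k r l) (hkm : ∀ l, Monotone fun r => k r l) :
    ∫ x in ball (0:V) R, (∫ l in (0:ℝ)..(vt s t e v x), k ‖x‖ l) ≤
      ∫ x in ball (0:V) R, (∫ l in (0:ℝ)..(v x), k ‖x‖ l) := by
  have hw := vt_adm (s := s) (t := t) hv hs ht he
  -- general formula
  have gen : ∀ w : V → ℝ, Adm K R w →
      ENNReal.ofReal (∫ x in ball (0:V) R, (∫ l in (0:ℝ)..(w x), k ‖x‖ l)) =
      ∫⁻ l in Ioi (0:ℝ), ∫⁻ x in {x | l < w x}, ENNReal.ofReal (k ‖x‖ l) := by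
    intro w hw
    have hc : Continuous fun x => ∫ l in (0:ℝ)..(w x), k ‖x‖ l := by
      have := intervalIntegral.continuous_parametric_intervalIntegral_of_continuous
        (f := fun (x : V) l => k ‖x‖ l) (a₀ := 0) (μ := volume) (by
          exact hkc.comp (f := fun p : V × ℝ => (‖p.1‖, p.2)) (by fun_prop)) hw.lip.continuous
      exact this
    have hnn : ∀ x, 0 ≤ ∫ l in (0:ℝ)..(w x), k ‖x‖ l := fun x =>
      intervalIntegral.integral_nonneg (hw.nn x) fun l _ => hk0 _ _
    have hz : ∀ x, x ∉ ball (0:V) R → ∫ l in (0:ℝ)..(w x), k ‖x‖ l = 0 := by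
      intro x hx; rw [hw.zero x hx]; simp
    rw [setIntegral_eq_integral_of_forall_compl_eq_zero hz]
    rw [ofReal_integral_eq_lintegral_ofReal _ (.of_forall hnn)]
    · have h1 : ∀ x, ENNReal.ofReal (∫ l in (0:ℝ)..(w x), k ‖x‖ l) =
          ∫⁻ l in Ioi (0:ℝ), {q : V × ℝ | q.2 < w q.1}.indicator
            (fun q => ENNReal.ofReal (k ‖q.1‖ q.2)) (x, l) := by
        intro x
        have hkx : Continuous (k ‖x‖) := hkc.comp (f := fun l : ℝ => (‖x‖, l)) (by fun_prop)
        rw [intervalIntegral.integral_of_le (hw.nn x), ofReal_integral_eq_lintegral_ofReal]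
        · rw [restrict_Ioo_eq_restrict_Ioc.symm]
          rw [← lintegral_indicator measurableSet_Ioo, ← lintegral_indicator measurableSet_Ioi]
          refine lintegral_congr fun l => ?_
          simp only [indicator, mem_Ioo, mem_Ioi, mem_ofPred_eq]
          split_ifs <;> simp_all
        · exact (hkx.integrableOn_Icc (a := 0) (b := w x)).mono_set Ioc_subset_Icc_self
        · exact .of_forall fun l => hk0 _ _
      simp_rw [h1]
      have hms : MeasurableSet {q : V × ℝ | q.2 < w q.1} :=
        (isOpen_lt continuous_snd (hw.lip.continuous.comp continuous_fst)).measurableSet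
      rw [lintegral_lintegral_swap]
      · refine lintegral_congr fun l => ?_
        rw [← lintegral_indicator (hw.lev_open l).measurableSet]
        rfl
      · refine Measurable.aemeasurable ?_
        refine Measurable.indicator ?_ hms
        exact (hkc.comp (f := fun p : V × ℝ => (‖p.1‖, p.2)) (by fun_prop)).measurable.ennreal_ofReal
    · refine hc.integrable_of_hasCompactSupport ?_
      refine HasCompactSupport.of_support_subset_isCompact (isCompact_closedBall (0:V) R) ?_
      intro x hx
      by_contra hcon
      exact hx (hz x fun h => hcon (ball_subset_closedBall h))
  rw [← ENNReal.ofReal_le_ofReal_iff, gen v hv, gen _ hw]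
  · refine setLIntegral_mono' measurableSet_Ioi fun l hl => ?_
    have : {x | l < vt s t e v x} = SS s t e {x | l < v x} := by
      ext x; exact lt_vt hv ht he (le_of_lt hl)
    rw [this]
    exact SS_lint he hs ht (k := fun r => ENNReal.ofReal (k r l))
      (fun a b h => ENNReal.ofReal_le_ofReal (hkm l h)) (hv.lev_open l)
  · exact integral_nonneg fun x =>
      intervalIntegral.integral_nonneg (hv.nn x) fun l _ => hk0 _ _

end Meas
end CS
end

section
open Set Metric MeasureTheory Bornology Filter Topology
open scoped RealInnerProductSpace Classical NNReal

namespace CS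

set_option linter.unusedSectionVars false
set_option linter.unusedVariables false

section Gfacts
variable {g : ℝ → ℝ}

lemma g_smono (hg : GCond g) : StrictMonoOn g (Ici 0) := by
  refine strictMonoOn_of_deriv_pos (convex_Ici 0) hg.1 ?_
  intro x hx
  rw [interior_Ici] at hx
  exact hg.2.2.2 x hx

lemma g_nonneg (hg : GCond g) {t : ℝ} (ht : 0 ≤ t) : 0 ≤ g t := by
  have := (g_smono hg).monotoneOn (mem_Ici.2 le_rfl) (mem_Ici.2 ht) ht
  rw [hg.2.2.1] at this; exact this

lemma g_pos (hg : GCond g) {t : ℝ} (ht : 0 < t) : 0 < g t := by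
  have := (g_smono hg) (mem_Ici.2 le_rfl) (mem_Ici.2 ht.le) ht
  rw [hg.2.2.1] at this; exact this

lemma g_ii (hg : GCond g) {a b : ℝ} (ha : 0 ≤ a) (hb : 0 ≤ b) :
    IntervalIntegrable g volume a b :=
  (hg.1.mono (fun x hx => by
    rw [mem_uIcc] at hx; rcases hx with h | h <;> exact mem_Ici.2 (by linarith))).intervalIntegrable

/-- convexity of G -/
lemma G_conv (hg : GCond g) {τ p : ℝ} (hτ : 0 ≤ τ) (hp : 0 ≤ p) :
    g τ * (p - τ) ≤ Gfun g p - Gfun g τ := by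
  unfold Gfun
  rw [intervalIntegral.integral_interval_sub_left (g_ii hg le_rfl hp) (g_ii hg le_rfl hτ)]
  rcases le_total τ p with h | h
  · have : ∫ _ in τ..p, g τ ≤ ∫ x in τ..p, g x := by
      refine intervalIntegral.integral_mono_on h (by simp) (g_ii hg hτ hp) fun x hx => ?_
      exact (g_smono hg).monotoneOn (mem_Ici.2 hτ) (mem_Ici.2 (hτ.trans hx.1)) hx.1
    simp only [intervalIntegral.integral_const, smul_eq_mul] at this
    linarith
  · have : ∫ x in p..τ, g x ≤ ∫ _ in p..τ, g τ := by
      refine intervalIntegral.integral_mono_on h (g_ii hg hp hτ) (by simp) fun x hx => ?_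
      exact (g_smono hg).monotoneOn (mem_Ici.2 (hp.trans hx.1)) (mem_Ici.2 hτ) hx.2
    simp only [intervalIntegral.integral_const, smul_eq_mul] at this
    rw [intervalIntegral.integral_symm]
    linarith

lemma G_zero : Gfun g 0 = 0 := by simp [Gfun]

lemma H_eq (t : ℝ) : Hfun g t = t * g t - Gfun g t := rfl

lemma H_nonneg (hg : GCond g) {t : ℝ} (ht : 0 ≤ t) : 0 ≤ Hfun g t := by
  have := G_conv hg ht le_rfl
  rw [G_zero] at this
  rw [H_eq]; linarith

lemma G_nonneg (hg : GCond g) {t : ℝ} (ht : 0 ≤ t) : 0 ≤ Gfun g t := by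
  have := G_conv hg le_rfl ht
  rw [G_zero, hg.2.2.1] at this
  linarith

lemma H_zero : Hfun g 0 = 0 := by simp [Hfun]

lemma fenchel (hg : GCond g) {τ p : ℝ} (hτ : 0 ≤ τ) (hp : 0 ≤ p) :
    g τ * p - Hfun g τ ≤ Gfun g p := by
  have := G_conv hg hτ hp
  rw [H_eq]; linarith

lemma G_mono (hg : GCond g) {a b : ℝ} (ha : 0 ≤ a) (hab : a ≤ b) : Gfun g a ≤ Gfun g b := by
  have := G_conv hg ha (ha.trans hab)
  have := mul_nonneg (g_nonneg hg ha) (sub_nonneg.2 hab)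
  linarith

end Gfacts

section Energy
variable {V : Type*} [NormedAddCommGroup V] [InnerProductSpace ℝ V] [FiniteDimensional ℝ V]
  [MeasurableSpace V] [BorelSpace V] [CompleteSpace V]
variable {K : ℝ≥0} {R s t : ℝ} {e : V} {v : V → ℝ} {g : ℝ → ℝ}

/-- sup-convolution -/
noncomputable def Qc (g : ℝ → ℝ) (K : ℝ≥0) (ε : ℝ) (v : V → ℝ) (x : V) : ℝ :=
  ⨆ i : Icc (0:ℝ) K × closedBall (0:V) 1, (v (x + (ε * g i.1) • (i.2 : V)) - ε * Hfun g i.1)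

lemma Qc_term (hg : GCond g) (hv : Adm K R v) {ε : ℝ} (hε : 0 ≤ ε) (x : V)
    (i : Icc (0:ℝ) K × closedBall (0:V) 1) :
    v (x + (ε * g i.1) • (i.2 : V)) - ε * Hfun g i.1 ≤ v x + ε * (K * g K) := by
  have h1 := hv.le (x + (ε * g i.1) • (i.2 : V)) x
  have hi := i.1.2
  have h2 : g i.1 ≤ g K := (g_smono hg).monotoneOn (mem_Ici.2 hi.1) (mem_Ici.2 K.2) hi.2
  have h0 := g_nonneg hg hi.1
  have hb : ‖(i.2 : V)‖ ≤ 1 := mem_closedBall_zero_iff.1 i.2.2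
  have h3 : ‖x + (ε * g i.1) • (i.2 : V) - x‖ ≤ ε * g K := by
    rw [add_sub_cancel_left, norm_smul, Real.norm_eq_abs, abs_of_nonneg (by positivity)]
    calc ε * g i.1 * ‖(i.2 : V)‖ ≤ ε * g i.1 * 1 := by gcongr
      _ ≤ ε * g K := by rw [mul_one]; gcongr
  have h4 := mul_nonneg hε (H_nonneg hg hi.1)
  have h5 : (K : ℝ) * ‖x + (ε * g i.1) • (i.2 : V) - x‖ ≤ K * (ε * g K) := by gcongr
  linarith

lemma Qc_bdd (hg : GCond g) (hv : Adm K R v) {ε : ℝ} (hε : 0 ≤ ε) (x : V) :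
    BddAbove (range fun i : Icc (0:ℝ) K × closedBall (0:V) 1 =>
      (v (x + (ε * g i.1) • (i.2 : V)) - ε * Hfun g i.1)) :=
  ⟨_, by rintro _ ⟨i, rfl⟩; exact Qc_term hg hv hε x i⟩

def i0 (K : ℝ≥0) : Icc (0:ℝ) K × closedBall (0:V) 1 :=
  (⟨0, le_rfl, K.2⟩, ⟨0, by simp⟩)

instance inst_i0 (K : ℝ≥0) : Nonempty (Icc (0:ℝ) K × closedBall (0:V) 1) := ⟨i0 K⟩

lemma le_Qc (hg : GCond g) (hv : Adm K R v) {ε : ℝ} (hε : 0 ≤ ε) (x : V) :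
    v x ≤ Qc g K ε v x := by
  have := le_ciSup (Qc_bdd hg hv hε x) (i0 K)
  have e1 : v (x + (ε * g (i0 (V := V) K).1) • ((i0 (V := V) K).2 : V)) - ε * Hfun g (i0 (V := V) K).1 = v x := by
    simp [i0, H_zero]
  rw [e1] at this
  exact this

lemma Qc_le (hg : GCond g) (hv : Adm K R v) {ε : ℝ} (hε : 0 ≤ ε) (x : V) :
    Qc g K ε v x ≤ v x + ε * (K * g K) := ciSup_le (Qc_term hg hv hε x)

lemma lt_Qc (hg : GCond g) (hv : Adm K R v) {ε : ℝ} (hε : 0 ≤ ε) {x : V} {l : ℝ} :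
    l < Qc g K ε v x ↔ ∃ i : Icc (0:ℝ) K × closedBall (0:V) 1,
      l < v (x + (ε * g i.1) • (i.2 : V)) - ε * Hfun g i.1 :=
  lt_ciSup_iff (Qc_bdd hg hv hε x)

lemma Qc_open (hg : GCond g) (hv : Adm K R v) {ε : ℝ} (hε : 0 ≤ ε) (l : ℝ) :
    IsOpen {x | l < Qc g K ε v x} := by
  simp only [lt_Qc hg hv hε]
  have : {x : V | ∃ i : Icc (0:ℝ) K × closedBall (0:V) 1,
      l < v (x + (ε * g i.1) • (i.2 : V)) - ε * Hfun g i.1} = ⋃ i : Icc (0:ℝ) K × closedBall (0:V) 1,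
      {x | l < v (x + (ε * g i.1) • (i.2 : V)) - ε * Hfun g i.1} := by
    ext x; simp only [mem_ofPred_eq, mem_iUnion]
  rw [this]
  refine isOpen_iUnion fun i => isOpen_lt continuous_const ?_
  have := hv.lip.continuous
  fun_prop

lemma Qc_meas (hg : GCond g) (hv : Adm K R v) {ε : ℝ} (hε : 0 ≤ ε) :
    Measurable (Qc g K ε v) :=
  measurable_of_Ioi fun l => (Qc_open hg hv hε l).measurableSet

lemma Qc_zero (hg : GCond g) (hv : Adm K R v) {ε : ℝ} (hε : 0 ≤ ε) (hε1 : ε ≤ 1) {x : V}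
    (hx : x ∉ ball (0:V) (R + g K)) : Qc g K ε v x = 0 := by
  have hgK : 0 ≤ g (K : ℝ) := g_nonneg hg K.2
  have hx' : R + g K ≤ ‖x‖ := by simpa using hx
  apply le_antisymm
  · refine ciSup_le fun i => ?_
    have hi := i.1.2
    have h2 : g i.1 ≤ g K := (g_smono hg).monotoneOn (mem_Ici.2 hi.1) (mem_Ici.2 K.2) hi.2
    have h0 := g_nonneg hg hi.1
    have hb : ‖(i.2 : V)‖ ≤ 1 := mem_closedBall_zero_iff.1 i.2.2
    have h3 : ‖(ε * g i.1) • (i.2 : V)‖ ≤ g K := by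
      rw [norm_smul, Real.norm_eq_abs, abs_of_nonneg (by positivity)]
      calc ε * g i.1 * ‖(i.2 : V)‖ ≤ 1 * g K * 1 := by gcongr
        _ = g K := by ring
    have : v (x + (ε * g i.1) • (i.2 : V)) = 0 := by
      apply hv.zero
      rw [mem_ball_zero_iff, not_lt]
      have := norm_sub_norm_le x (-((ε * g i.1) • (i.2 : V)))
      rw [sub_neg_eq_add, norm_neg] at this
      linarith
    rw [this]
    have h4 := mul_nonneg hε (H_nonneg hg hi.1)
    linarith
  · exact (hv.nn x).trans (le_Qc hg hv hε x)

lemma Qc_integrable (hg : GCond g) (hv : Adm K R v) {ε : ℝ} (hε : 0 ≤ ε) (hε1 : ε ≤ 1) :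
    Integrable (Qc g K ε v) := by
  have hgK : 0 ≤ g (K : ℝ) := g_nonneg hg K.2
  have hb : Integrable (fun x => v x + (ball (0:V) (R + g K)).indicator (fun _ => (K * g K : ℝ)) x) := by
    refine hv.integrable.add ?_
    rw [integrable_indicator_iff measurableSet_ball]
    exact integrableOn_const (by exact measure_ball_lt_top.ne)
  refine hb.mono' (Qc_meas hg hv hε).aestronglyMeasurable (.of_forall fun x => ?_)
  rw [Real.norm_eq_abs, abs_of_nonneg ((hv.nn x).trans (le_Qc hg hv hε x))]
  by_cases hx : x ∈ ball (0:V) (R + g K)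
  · simp only [hx, indicator_of_mem]
    refine (Qc_le hg hv hε x).trans ?_
    have : ε * (K * g K) ≤ 1 * (K * g K) := by gcongr
    linarith
  · rw [Qc_zero hg hv hε hε1 hx, indicator_of_notMem hx, add_zero]; exact hv.nn x

lemma Qc_vt (hg : GCond g) (hv : Adm K R v) (hs : 0 ≤ s) (ht : 0 ≤ t) (he : ‖e‖ = 1)
    {ε : ℝ} (hε : 0 ≤ ε) (hε1 : ε ≤ 1) :
    ∫ x, Qc g K ε (vt s t e v) x ≤ ∫ x, Qc g K ε v x := by
  have hw := vt_adm (s := s) (t := t) hv hs ht he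
  have n1 : ∀ x, 0 ≤ Qc g K ε v x := fun x => (hv.nn x).trans (le_Qc hg hv hε x)
  have n2 : ∀ x, 0 ≤ Qc g K ε (vt s t e v) x := fun x => (hw.nn x).trans (le_Qc hg hw hε x)
  rw [integral_eq_lintegral_of_nonneg_ae (.of_forall n2) (Qc_integrable hg hw hε hε1).1,
    integral_eq_lintegral_of_nonneg_ae (.of_forall n1) (Qc_integrable hg hv hε hε1).1]
  apply ENNReal.toReal_mono
  · exact (Qc_integrable hg hv hε hε1).lintegral_lt_top.ne
  rw [lintegral_eq_lintegral_meas_lt _ (.of_forall n2) (Qc_meas hg hw hε).aemeasurable,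
    lintegral_eq_lintegral_meas_lt _ (.of_forall n1) (Qc_meas hg hv hε).aemeasurable]
  refine setLIntegral_mono' measurableSet_Ioi fun l hl => ?_
  have hl : 0 < l := hl
  rw [← SS_vol he hs ht (Qc_open hg hv hε l)]
  refine measure_mono fun x hx => ?_
  obtain ⟨i, hi⟩ := (lt_Qc hg hw hε).1 hx
  have hi1 := i.1.2
  have hH := mul_nonneg hε (H_nonneg hg hi1.1)
  have h0 := g_nonneg hg hi1.1
  have hb : ‖(i.2 : V)‖ ≤ 1 := mem_closedBall_zero_iff.1 i.2.2
  have h1 := (lt_vt hv ht he (show 0 ≤ l + ε * Hfun g i.1 by linarith)).1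
    (show l + ε * Hfun g i.1 < vt s t e v (x + (ε * g i.1) • (i.2 : V)) by linarith)
  refine SS_thick (h := ε * g i.1) he ?_ _ h1 x ?_
  · intro z (hz : l + ε * Hfun g i.1 < v z) w hw'
    show l < Qc g K ε v w
    rw [lt_Qc hg hv hε]
    rcases (mul_nonneg hε h0).eq_or_lt with h | h
    · rw [← h] at hw'
      have : w = z := by
        have := norm_le_zero_iff.1 hw'; exact sub_eq_zero.1 this
      subst this
      refine ⟨(i.1, ⟨0, by simp⟩), ?_⟩
      simp only [smul_zero, add_zero]; linarith
    · refine ⟨(i.1, ⟨(ε * g i.1)⁻¹ • (z - w), ?_⟩), ?_⟩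
      · rw [mem_closedBall_zero_iff, norm_smul, Real.norm_eq_abs, abs_of_pos (by positivity),
          norm_sub_rev, inv_mul_le_iff₀ h, mul_one]
        exact hw'
      · simp only [smul_inv_smul₀ h.ne', add_sub_cancel]; linarith
  · rw [sub_add_cancel_left, norm_neg, norm_smul, Real.norm_eq_abs, abs_of_nonneg (by positivity)]
    calc ε * g i.1 * ‖(i.2 : V)‖ ≤ ε * g i.1 * 1 := by gcongr
      _ = _ := mul_one _

lemma grad_le (hv : Adm K R v) (x : V) : ‖gradient v x‖ ≤ K := by
  rw [gradient, LinearIsometryEquiv.norm_map]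
  exact norm_fderiv_le_of_lipschitz ℝ hv.lip

lemma Qc_lim (hg : GCond g) (hv : Adm K R v) {x : V} (hx : DifferentiableAt ℝ v x)
    {η : ℝ} (hη : 0 < η) : ∀ᶠ ε in 𝓝[>] (0:ℝ),
      |(Qc g K ε v x - v x) / ε - Gfun g ‖gradient v x‖| ≤ η := by
  have hgK : 0 ≤ g (K : ℝ) := g_nonneg hg K.2
  set p := gradient v x with hp
  have hpK : ‖p‖ ≤ K := grad_le hv x
  have hgp := g_nonneg hg (norm_nonneg p)
  have hgpK : g ‖p‖ ≤ g K := (g_smono hg).monotoneOn (mem_Ici.2 (norm_nonneg _)) (mem_Ici.2 K.2) hpK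
  obtain ⟨c, hc, hc2⟩ : ∃ c : ℝ, 0 < c ∧ c * g K ≤ η := by
    refine ⟨η / (g K + 1), by positivity, ?_⟩
    rw [div_mul_eq_mul_div, div_le_iff₀ (by positivity)]; nlinarith
  have hgrad := hx.hasGradientAt
  rw [hasGradientAt_iff_isLittleO] at hgrad
  have hev := hgrad.def hc
  rw [Metric.eventually_nhds_iff] at hev
  obtain ⟨r, hr, hev⟩ := hev
  have hdiff : ∀ k : V, ‖k‖ < r → |v (x + k) - v x - ⟪p, k⟫| ≤ c * ‖k‖ := by
    intro k hk
    have := @hev (x + k) (by rw [dist_eq_norm, add_sub_cancel_left]; exact hk)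
    rw [add_sub_cancel_left] at this
    exact this
  have hsmall : ∀ᶠ ε in 𝓝[>] (0:ℝ), ε * g K < r := by
    have : Tendsto (fun ε : ℝ => ε * g K) (𝓝[>] 0) (𝓝 (0 * g K)) :=
      (tendsto_id.mul_const _).mono_left nhdsWithin_le_nhds
    rw [zero_mul] at this
    exact this.eventually (gt_mem_nhds hr)
  filter_upwards [hsmall, self_mem_nhdsWithin] with ε hε1 hε
  have hε : 0 < ε := hε
  rw [abs_le]
  constructor
  · -- lower
    obtain ⟨h, hh1, hh2⟩ : ∃ h : V, ‖h‖ ≤ 1 ∧ (⟪p, h⟫ : ℝ) = ‖p‖ := by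
      rcases eq_or_ne p 0 with h0 | h0
      · exact ⟨0, by simp, by simp [h0]⟩
      · have hn : ‖p‖ ≠ 0 := norm_ne_zero_iff.2 h0
        refine ⟨(‖p‖)⁻¹ • p, ?_, ?_⟩
        · rw [norm_smul, norm_inv, norm_norm, inv_mul_cancel₀ hn]
        · rw [inner_smul_right, real_inner_self_eq_norm_sq]; field_simp
    have h1 := le_ciSup (Qc_bdd hg hv hε.le x)
      ((⟨‖p‖, norm_nonneg p, hpK⟩, ⟨h, by simpa using hh1⟩) : Icc (0:ℝ) K × closedBall (0:V) 1)
    change v (x + (ε * g ‖p‖) • h) - ε * Hfun g ‖p‖ ≤ Qc g K ε v x at h1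
    have hk : ‖(ε * g ‖p‖) • h‖ ≤ ε * g K := by
      rw [norm_smul, Real.norm_eq_abs, abs_of_nonneg (by positivity)]
      calc ε * g ‖p‖ * ‖h‖ ≤ ε * g K * 1 := by gcongr
        _ = _ := mul_one _
    have h2 := (abs_le.1 (hdiff _ (hk.trans_lt hε1))).1
    rw [inner_smul_right, hh2] at h2
    have h3 : c * ‖(ε * g ‖p‖) • h‖ ≤ ε * η := by
      calc c * ‖(ε * g ‖p‖) • h‖ ≤ c * (ε * g K) := by gcongr
        _ = ε * (c * g K) := by ring
        _ ≤ ε * η := by gcongr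
    rw [le_sub_iff_add_le, le_div_iff₀ hε]
    rw [H_eq] at h1
    nlinarith
  · rw [sub_le_iff_le_add, div_le_iff₀ hε, sub_le_iff_le_add]
    refine ciSup_le fun i => ?_
    have hi1 := i.1.2
    have h0 := g_nonneg hg hi1.1
    have hb : ‖(i.2 : V)‖ ≤ 1 := mem_closedBall_zero_iff.1 i.2.2
    have hgi : g i.1 ≤ g K := (g_smono hg).monotoneOn (mem_Ici.2 hi1.1) (mem_Ici.2 K.2) hi1.2
    have hk : ‖(ε * g i.1) • (i.2 : V)‖ ≤ ε * g K := by
      rw [norm_smul, Real.norm_eq_abs, abs_of_nonneg (by positivity)]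
      calc ε * g i.1 * ‖(i.2 : V)‖ ≤ ε * g K * 1 := by gcongr
        _ = _ := mul_one _
    have h2 := (abs_le.1 (hdiff _ (hk.trans_lt hε1))).2
    rw [inner_smul_right] at h2
    have h3 : c * ‖(ε * g i.1) • (i.2 : V)‖ ≤ ε * η := by
      calc c * ‖(ε * g i.1) • (i.2 : V)‖ ≤ c * (ε * g K) := by gcongr
        _ = ε * (c * g K) := by ring
        _ ≤ ε * η := by gcongr
    have h4 : (⟪p, (i.2 : V)⟫ : ℝ) ≤ ‖p‖ := by
      have := real_inner_le_norm p (i.2 : V)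
      nlinarith [norm_nonneg p]
    have h5 := fenchel hg hi1.1 (norm_nonneg p)
    have h6 : ε * g i.1 * (⟪p, (i.2 : V)⟫ : ℝ) ≤ ε * g i.1 * ‖p‖ := by gcongr
    have h7 : ε * (g i.1 * ‖p‖ - Hfun g i.1) ≤ ε * Gfun g ‖p‖ := by gcongr
    nlinarith

/-- the energy -/
noncomputable def En (g : ℝ → ℝ) (v : V → ℝ) : ℝ := ∫ x, Gfun g ‖gradient v x‖

lemma Qc_En (hg : GCond g) (hv : Adm K R v) :
    Tendsto (fun n : ℕ => ∫ x, (Qc g K (1 / ((n:ℝ) + 1)) v x - v x) / (1 / ((n:ℝ) + 1))) atTop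
      (𝓝 (En g v)) := by
  have hgK : 0 ≤ g (K : ℝ) := g_nonneg hg K.2
  have hpos : ∀ n : ℕ, (0:ℝ) < 1 / ((n:ℝ) + 1) := fun n => by positivity
  have hle : ∀ n : ℕ, 1 / ((n:ℝ) + 1) ≤ 1 := fun n => by
    rw [div_le_one (by positivity)]; linarith [(Nat.cast_nonneg n : (0:ℝ) ≤ n)]
  refine tendsto_integral_of_dominated_convergence
    ((ball (0:V) (R + g K)).indicator (fun _ => (K * g K : ℝ))) ?_ ?_ ?_ ?_
  · intro n
    exact (((Qc_meas hg hv (hpos n).le).sub hv.lip.continuous.measurable).div_const _).aestronglyMeasurable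
  · rw [integrable_indicator_iff measurableSet_ball]
    exact integrableOn_const (by exact measure_ball_lt_top.ne)
  · intro n
    refine .of_forall fun x => ?_
    have h1 := le_Qc hg hv (hpos n).le x
    have h2 := Qc_le hg hv (hpos n).le x
    rw [Real.norm_eq_abs, abs_of_nonneg (div_nonneg (by linarith) (hpos n).le)]
    by_cases hx : x ∈ ball (0:V) (R + g K)
    · rw [indicator_of_mem hx, div_le_iff₀ (hpos n)]; linarith
    · rw [indicator_of_notMem hx, Qc_zero hg hv (hpos n).le (hle n) hx, hv.zero]
      · simp
      · intro h; exact hx (ball_subset_ball (by linarith) h)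
  · filter_upwards [hv.lip.ae_differentiableAt (μ := volume)] with x hx
    have ht : Tendsto (fun n : ℕ => 1 / ((n:ℝ) + 1)) atTop (𝓝[>] 0) := by
      rw [tendsto_nhdsWithin_iff]
      exact ⟨tendsto_one_div_add_atTop_nhds_zero_nat, .of_forall hpos⟩
    rw [Metric.tendsto_atTop']
    intro η hη
    have h1 := ht.eventually (Qc_lim hg hv hx (half_pos hη))
    obtain ⟨n, hn⟩ := eventually_atTop.1 h1
    refine ⟨n, fun m hm => ?_⟩
    rw [Real.dist_eq]
    have := hn m hm.le
    linarith

lemma En_vt (hg : GCond g) (hv : Adm K R v) (hs : 0 ≤ s) (ht : 0 ≤ t) (he : ‖e‖ = 1) :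
    En g (vt s t e v) ≤ En g v := by
  have hw := vt_adm (s := s) (t := t) hv hs ht he
  refine le_of_tendsto_of_tendsto' (Qc_En hg hw) (Qc_En hg hv) fun n => ?_
  have hpos : (0:ℝ) < 1 / ((n:ℝ) + 1) := by positivity
  have hle : 1 / ((n:ℝ) + 1) ≤ 1 := by
    rw [div_le_one (by positivity)]; linarith [(Nat.cast_nonneg n : (0:ℝ) ≤ n)]
  rw [integral_div, integral_div]
  refine div_le_div_of_nonneg_right ?_ hpos.le
  rw [integral_sub (Qc_integrable hg hw hpos.le hle) hw.integrable,
    integral_sub (Qc_integrable hg hv hpos.le hle) hv.integrable, vt_int hv hs ht he]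
  have := Qc_vt hg hv hs ht he hpos.le hle
  linarith

end Energy
end CS
end

section
open Set Metric MeasureTheory Bornology Filter Topology
open scoped RealInnerProductSpace Classical NNReal

namespace CS
set_option linter.unusedSectionVars false
set_option linter.unusedVariables false

section
variable {N : ℕ} {g : ℝ → ℝ}
local notation "𝔼" => EuclideanSpace ℝ (Fin N)

lemma gvec_zero : gvec g (0 : 𝔼) = 0 := by simp [gvec]

lemma norm_gvec (hg : GCond g) (y : 𝔼) : ‖gvec g y‖ = g ‖y‖ := by
  unfold gvec
  split_ifs with h
  · subst h; simp [hg.2.2.1]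
  · have hn : ‖y‖ ≠ 0 := norm_ne_zero_iff.2 h
    rw [norm_smul, Real.norm_eq_abs, abs_of_nonneg (div_nonneg (g_nonneg hg (norm_nonneg _)) (norm_nonneg _))]
    field_simp

lemma gvec_inner (hg : GCond g) (y z : 𝔼) : ‖y‖ * (⟪gvec g y, z⟫ : ℝ) = g ‖y‖ * ⟪y, z⟫ := by
  unfold gvec
  split_ifs with h
  · subst h; simp
  · have hn : ‖y‖ ≠ 0 := norm_ne_zero_iff.2 h
    rw [inner_smul_left]
    simp only [conj_trivial]
    field_simp

lemma gvec_inner_self (hg : GCond g) (y : 𝔼) : (⟪gvec g y, y⟫ : ℝ) = g ‖y‖ * ‖y‖ := by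
  rcases eq_or_ne y 0 with h | h
  · subst h; simp
  · have hn : ‖y‖ ≠ 0 := norm_ne_zero_iff.2 h
    have := gvec_inner hg y y
    rw [real_inner_self_eq_norm_sq] at this
    apply mul_left_cancel₀ hn
    rw [this]; ring

lemma g_cont_norm (hg : GCond g) : Continuous fun y : 𝔼 => g ‖y‖ :=
  hg.1.comp_continuous continuous_norm fun y => norm_nonneg y

lemma gvec_cont (hg : GCond g) : Continuous (gvec g : 𝔼 → 𝔼) := by
  rw [continuous_iff_continuousAt]
  intro y
  rcases eq_or_ne y 0 with h | h
  · subst h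
    rw [ContinuousAt, gvec_zero, tendsto_zero_iff_norm_tendsto_zero]
    simp_rw [norm_gvec hg]
    have := (g_cont_norm (N := N) hg).tendsto 0
    simpa [hg.2.2.1] using this
  · have h1 : ContinuousAt (fun y : 𝔼 => (g ‖y‖ / ‖y‖) • y) y := by
      have hgc := g_cont_norm (N := N) hg
      have h2 : ContinuousAt (fun y : 𝔼 => g ‖y‖ / ‖y‖) y :=
        hgc.continuousAt.div continuous_norm.continuousAt (norm_ne_zero_iff.2 h)
      have h3 : ContinuousAt (fun y : 𝔼 => y) y := continuousAt_id
      exact h2.smul h3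
    refine h1.congr ?_
    have hnz : ∀ᶠ z : 𝔼 in 𝓝 y, z ≠ 0 := eventually_ne_nhds h
    filter_upwards [hnz] with z hz
    simp [gvec, hz]

lemma G_cont (hg : GCond g) : ContinuousOn (Gfun g) (Ici 0) := by
  have hc : Continuous fun s => g (max s 0) := hg.1.comp_continuous (by fun_prop) fun s => mem_Ici.2 (le_max_right _ _)
  have h1 : Continuous fun t => ∫ s in (0:ℝ)..t, g (max s 0) :=
    intervalIntegral.continuous_primitive (fun a b => hc.intervalIntegrable _ _) 0
  refine h1.continuousOn.congr fun t ht => ?_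
  unfold Gfun
  refine intervalIntegral.integral_congr fun s hs => ?_
  rw [uIcc_of_le ht] at hs
  simp [max_eq_left hs.1]

lemma G_cont_norm (hg : GCond g) : Continuous fun y : 𝔼 => Gfun g ‖y‖ :=
  (G_cont hg).comp_continuous continuous_norm fun y => norm_nonneg y

/-- strict convexity of G -/
lemma G_sconv (hg : GCond g) {τ p : ℝ} (hτ : 0 ≤ τ) (hp : 0 ≤ p) (hne : τ ≠ p) :
    g τ * (p - τ) < Gfun g p - Gfun g τ := by
  set m := (τ + p) / 2 with hm
  have hm0 : 0 ≤ m := by rw [hm]; linarith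
  have h1 := G_conv hg hτ hm0
  have h2 := G_conv hg hm0 hp
  have h3 : 0 < (g m - g τ) * (p - τ) := by
    rcases lt_or_gt_of_ne hne with h | h
    · have : g τ < g m := g_smono hg (mem_Ici.2 hτ) (mem_Ici.2 hm0) (by rw [hm]; linarith)
      exact mul_pos (by linarith) (by linarith)
    · have : g m < g τ := g_smono hg (mem_Ici.2 hm0) (mem_Ici.2 hτ) (by rw [hm]; linarith)
      exact mul_pos_of_neg_of_neg (by linarith) (by linarith)
  have e1 : m - τ = (p - τ) / 2 := by rw [hm]; ring
  have e2 : p - m = (p - τ) / 2 := by rw [hm]; ring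
  rw [e1] at h1
  rw [e2] at h2
  nlinarith

/-- Bregman distance -/
noncomputable def Br (g : ℝ → ℝ) (q p : 𝔼) : ℝ :=
  Gfun g ‖q‖ - Gfun g ‖p‖ - ⟪gvec g p, q - p⟫

lemma Br_pos (hg : GCond g) {q p : 𝔼} (h : q ≠ p) : 0 < Br g q p := by
  unfold Br
  rw [inner_sub_right, gvec_inner_self hg]
  rcases eq_or_ne p 0 with h0 | h0
  · subst h0
    have := G_sconv hg le_rfl (norm_nonneg q) (Ne.symm (norm_ne_zero_iff.2 h))
    rw [hg.2.2.1, zero_mul] at this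
    simp only [gvec_zero, inner_zero_left, norm_zero]
    linarith
  · have hn : 0 < ‖p‖ := norm_pos_iff.2 h0
    have hgp := g_pos hg hn
    have hcs : (⟪gvec g p, q⟫ : ℝ) ≤ g ‖p‖ * ‖q‖ := by
      have := real_inner_le_norm (gvec g p) q
      rwa [norm_gvec hg] at this
    by_cases hpq : ‖p‖ = ‖q‖
    · have hlt : (⟪gvec g p, q⟫ : ℝ) < g ‖p‖ * ‖q‖ := by
        refine lt_of_le_of_ne hcs fun heq => h ?_
        have h1 := gvec_inner hg p q
        rw [heq] at h1
        have h2 : (⟪p, q⟫ : ℝ) = ‖p‖ * ‖q‖ := by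
          apply mul_left_cancel₀ hgp.ne'
          linarith
        rw [inner_eq_norm_mul_iff_real, ← hpq] at h2
        exact (smul_right_injective _ hn.ne' h2).symm
      rw [← hpq] at hlt ⊢
      linarith
    · have := G_sconv hg (norm_nonneg p) (norm_nonneg q) hpq
      linarith

lemma Br_self (p : 𝔼) : Br g p p = 0 := by simp [Br]

lemma Br_nonneg (hg : GCond g) (q p : 𝔼) : 0 ≤ Br g q p := by
  rcases eq_or_ne q p with h | h
  · rw [h, Br_self]
  · exact (Br_pos hg h).le

lemma Br_cont (hg : GCond g) : Continuous fun z : 𝔼 × 𝔼 => Br g z.1 z.2 := by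
  unfold Br
  have h1 := G_cont_norm (N := N) hg
  have h2 := gvec_cont (N := N) hg
  exact ((h1.comp continuous_fst).sub (h1.comp continuous_snd)).sub
    (Continuous.inner (𝕜 := ℝ) (h2.comp continuous_snd) (continuous_fst.sub continuous_snd))

lemma Br_unif (hg : GCond g) (K : ℝ) {κ : ℝ} (hκ : 0 < κ) :
    ∃ c > 0, ∀ q p : 𝔼, ‖q‖ ≤ K → ‖p‖ ≤ K → κ ≤ ‖q - p‖ → c ≤ Br g q p := by
  let C : Set (𝔼 × 𝔼) := (closedBall 0 K ×ˢ closedBall 0 K) ∩ {z | κ ≤ ‖z.1 - z.2‖}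
  have hC : IsCompact C := by
    refine IsCompact.inter_right ((isCompact_closedBall _ _).prod (isCompact_closedBall _ _)) ?_
    exact isClosed_le continuous_const (by fun_prop)
  rcases C.eq_empty_or_nonempty with h | h
  · refine ⟨1, one_pos, fun q p hq hp hqp => ?_⟩
    have : (q, p) ∈ C := ⟨⟨by simpa using hq, by simpa using hp⟩, hqp⟩
    rw [h] at this
    exact this.elim
  · obtain ⟨z, hz, hmin⟩ := hC.exists_isMinOn h (Br_cont hg).continuousOn
    refine ⟨Br g z.1 z.2, Br_pos hg ?_, fun q p hq hp hqp => ?_⟩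
    · intro heq
      have : κ ≤ ‖z.1 - z.2‖ := hz.2
      rw [heq, sub_self, norm_zero] at this
      linarith
    · have : (q, p) ∈ C := ⟨⟨by simpa using hq, by simpa using hp⟩, hqp⟩
      exact (isMinOn_iff.1 hmin) (q, p) this

end
end CS
end

section
open Set Metric MeasureTheory Bornology Filter Topology
open scoped RealInnerProductSpace Classical NNReal

namespace CS
set_option linter.unusedSectionVars false
set_option linter.unusedVariables false

section
variable {N : ℕ} {g : ℝ → ℝ} {K : ℝ≥0} {R : ℝ}
local notation "𝔼" => EuclideanSpace ℝ (Fin N)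

lemma fderiv_meas' (ψ : 𝔼 → ℝ) : StronglyMeasurable (fun x => fderiv ℝ ψ x) :=
  (measurable_fderiv ℝ ψ).stronglyMeasurable

lemma fderiv_le {ψ : 𝔼 → ℝ} (h : LipschitzWith K ψ) (x : 𝔼) : ‖fderiv ℝ ψ x‖ ≤ K :=
  norm_fderiv_le_of_lipschitz ℝ h

/-- bump functions -/
noncomputable def bp (n : ℕ) : ContDiffBump (0 : 𝔼) where
  rIn := 1 / ((n:ℝ) + 1)
  rOut := 2 / ((n:ℝ) + 1)
  rIn_pos := by positivity
  rIn_lt_rOut := by gcongr; norm_num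

noncomputable def mol (n : ℕ) (ψ : 𝔼 → ℝ) (x : 𝔼) : ℝ :=
  ∫ y, (bp (N := N) n).normed volume y * ψ (x - y)

lemma mol_fderiv {ψ : 𝔼 → ℝ} (hψ : LipschitzWith K ψ) (n : ℕ) (x : 𝔼) :
    HasFDerivAt (mol n ψ) (∫ y, (bp (N := N) n).normed volume y • fderiv ℝ ψ (x - y)) x := by
  set φ := (bp (N := N) n).normed volume with hφ
  have hφc : Continuous φ := (bp (N := N) n).continuous_normed
  have hφs : HasCompactSupport φ := (bp (N := N) n).hasCompactSupport_normed
  have hφ0 : ∀ y, 0 ≤ φ y := fun y => (bp (N := N) n).nonneg_normed y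
  refine (hasFDerivAt_integral_of_dominated_loc_of_lip (μ := volume) (s := univ)
    (bound := fun y => φ y * K) (F := fun x y => φ y * ψ (x - y))
    (F' := fun y => φ y • fderiv ℝ ψ (x - y)) univ_mem ?_ ?_ ?_ ?_ ?_ ?_).2
  · refine .of_forall fun x => Continuous.aestronglyMeasurable ?_
    exact hφc.mul (hψ.continuous.comp (by fun_prop))
  · refine Continuous.integrable_of_hasCompactSupport ?_ ?_
    · exact hφc.mul (hψ.continuous.comp (by fun_prop))
    · exact hφs.mul_right
  · refine hφc.aestronglyMeasurable.smul ?_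
    exact ((fderiv_meas' ψ).comp_measurable (by fun_prop : Measurable fun y : 𝔼 => x - y)).aestronglyMeasurable
  · refine .of_forall fun y => LipschitzOnWith.of_dist_le_mul fun a _ b _ => ?_
    have h1 := hψ.dist_le_mul (a - y) (b - y)
    rw [dist_sub_right] at h1
    rw [Real.dist_eq] at h1 ⊢
    rw [← mul_sub, abs_mul, abs_of_nonneg (hφ0 y), Real.coe_nnabs,
      abs_of_nonneg (mul_nonneg (hφ0 y) K.coe_nonneg), mul_assoc]
    exact mul_le_mul_of_nonneg_left h1 (hφ0 y)
  · exact (hφc.integrable_of_hasCompactSupport hφs).mul_const _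
  · have h1 : ∀ᵐ y : 𝔼, DifferentiableAt ℝ ψ (x - y) :=
      (Measure.measurePreserving_sub_left volume x).quasiMeasurePreserving.ae hψ.ae_differentiableAt
    filter_upwards [h1] with y hy
    have h2 : HasFDerivAt (fun z : 𝔼 => ψ (z - y)) (fderiv ℝ ψ (x - y)) x := by
      have h3 := hy.hasFDerivAt.comp x ((hasFDerivAt_id x).sub_const y)
      exact h3
    exact h2.const_mul (φ y)

lemma mol_smooth {ψ : 𝔼 → ℝ} (hψ : LipschitzWith K ψ) (n : ℕ) : ContDiff ℝ (⊤ : ℕ∞) (mol n ψ) := by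
  have := (bp (N := N) n).hasCompactSupport_normed (μ := volume) |>.contDiff_convolution_left
    (ContinuousLinearMap.lsmul ℝ ℝ) (n := (⊤ : ℕ∞)) (bp (N := N) n).contDiff_normed
    (hψ.continuous.locallyIntegrable (μ := volume))
  exact this

lemma mol_bump_int (n : ℕ) : ∫ y, (bp (N := N) n).normed volume y = 1 :=
  (bp (N := N) n).integral_normed

lemma mol_near {ψ : 𝔼 → ℝ} (hψ : LipschitzWith K ψ) (n : ℕ) (x : 𝔼) :
    |mol n ψ x - ψ x| ≤ K * (2 / ((n:ℝ) + 1)) := by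
  have := (bp (N := N) n).dist_normed_convolution_le (μ := volume) (g := ψ) (x₀ := x) (ε := K * (2 / ((n:ℝ) + 1)))
    hψ.continuous.aestronglyMeasurable ?_
  · rw [Real.dist_eq] at this; exact this
  · intro y hy
    have h1 := hψ.dist_le_mul y x
    refine h1.trans ?_
    have h2 : dist y x ≤ 2 / ((n:ℝ) + 1) := (mem_ball.1 hy).le
    gcongr

lemma mol_zero {ψ : 𝔼 → ℝ} {R' : ℝ} (h0 : ∀ x, x ∉ ball (0:𝔼) R' → ψ x = 0) (n : ℕ) (x : 𝔼)
    (hx : R' + 2 / ((n:ℝ) + 1) ≤ ‖x‖) : mol n ψ x = 0 := by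
  unfold mol
  refine integral_eq_zero_of_ae (.of_forall fun y => ?_)
  show (bp (N := N) n).normed volume y * ψ (x - y) = (0:ℝ)
  by_cases hy : y ∈ ball (0:𝔼) (2 / ((n:ℝ) + 1))
  · rw [h0 (x - y), mul_zero]
    rw [mem_ball_zero_iff] at hy ⊢
    have := norm_sub_norm_le x y
    linarith
  · have : y ∉ Function.support ((bp (N := N) n).normed volume) := by
      rw [(bp (N := N) n).support_normed_eq]; exact hy
    rw [Function.notMem_support.1 this, zero_mul]

lemma mol_fderiv_tendsto {ψ : 𝔼 → ℝ} (hψ : LipschitzWith K ψ) :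
    ∀ᵐ x : 𝔼, Tendsto (fun n => fderiv ℝ (mol n ψ) x) atTop (𝓝 (fderiv ℝ ψ x)) := by
  have hli : LocallyIntegrable (fun x : 𝔼 => fderiv ℝ ψ x) volume := by
    refine LocallyIntegrable.mono (f := fun _ => (K:ℝ)) (continuous_const.locallyIntegrable)
      (fderiv_meas' ψ).aestronglyMeasurable (.of_forall fun x => ?_)
    rw [Real.norm_of_nonneg K.coe_nonneg]
    exact fderiv_le hψ x
  have hlim : Tendsto (fun n : ℕ => 2 / ((n:ℝ) + 1)) atTop (𝓝 0) := by
    have := (tendsto_one_div_add_atTop_nhds_zero_nat (𝕜 := ℝ)).const_mul 2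
    simpa [div_eq_mul_inv] using this
  have := ContDiffBump.ae_convolution_tendsto_right_of_locallyIntegrable (μ := volume)
    (φ := fun n => bp (N := N) n) (l := atTop) (K := 2) hlim ?_ hli
  · filter_upwards [this] with x hx
    refine hx.congr fun n => ?_
    rw [(mol_fderiv hψ n x).fderiv]
    rfl
  · refine .of_forall fun n => ?_
    show 2 / ((n:ℝ) + 1) ≤ 2 * (1 / ((n:ℝ) + 1))
    rw [mul_one_div]

lemma mol_lip {ψ : 𝔼 → ℝ} (hψ : LipschitzWith K ψ) (n : ℕ) (x : 𝔼) :
    ‖fderiv ℝ (mol n ψ) x‖ ≤ K := by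
  rw [(mol_fderiv hψ n x).fderiv]
  have h1 : Integrable ((bp (N := N) n).normed volume) := (bp (N := N) n).integrable_normed
  calc _ ≤ ∫ y, (bp (N := N) n).normed volume y * K := by
        refine norm_integral_le_of_norm_le (h1.mul_const _) (.of_forall fun y => ?_)
        rw [norm_smul, Real.norm_of_nonneg ((bp (N := N) n).nonneg_normed y)]
        exact mul_le_mul_of_nonneg_left (fderiv_le hψ _) ((bp (N := N) n).nonneg_normed y)
    _ = K := by rw [integral_mul_const, mol_bump_int, one_mul]

/-- weak formulation data -/
structure Wk (R : ℝ) (A : 𝔼 → 𝔼) (h : 𝔼 → ℝ) (M : ℝ) : Prop where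
  Am : AEStronglyMeasurable A (volume.restrict (ball (0:𝔼) R))
  hm : AEStronglyMeasurable h (volume.restrict (ball (0:𝔼) R))
  Ab : ∀ x ∈ ball (0:𝔼) R, ‖A x‖ ≤ M
  hb : ∀ x ∈ ball (0:𝔼) R, |h x| ≤ M
  wk : ∀ φ : 𝔼 → ℝ, IsTestFun (ball 0 R) φ → (∫ x in ball (0:𝔼) R, fderiv ℝ φ x (A x)) = ∫ x in ball (0:𝔼) R, h x * φ x

variable {A : EuclideanSpace ℝ (Fin N) → EuclideanSpace ℝ (Fin N)} {h : EuclideanSpace ℝ (Fin N) → ℝ} {M : ℝ}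

instance : IsFiniteMeasure (volume.restrict (ball (0:𝔼) R)) :=
  ⟨by rw [Measure.restrict_apply_univ]; exact measure_ball_lt_top⟩

lemma Wk.limit (hW : Wk R A h M) {ψn : ℕ → 𝔼 → ℝ} {ψ : 𝔼 → ℝ} {C : ℝ}
    (hd : ∀ n x, ‖fderiv ℝ (ψn n) x‖ ≤ C) (hc : ∀ n, Continuous (ψn n))
    (hb : ∀ n, ∀ x, |ψn n x| ≤ C)
    (hl1 : ∀ᵐ x : 𝔼, Tendsto (fun n => fderiv ℝ (ψn n) x) atTop (𝓝 (fderiv ℝ ψ x)))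
    (hl0 : ∀ x, Tendsto (fun n => ψn n x) atTop (𝓝 (ψ x)))
    (hwk : ∀ᶠ n in atTop, (∫ x in ball (0:𝔼) R, fderiv ℝ (ψn n) x (A x)) = ∫ x in ball (0:𝔼) R, h x * ψn n x) :
    (∫ x in ball (0:𝔼) R, fderiv ℝ ψ x (A x)) = ∫ x in ball (0:𝔼) R, h x * ψ x := by
  have e1 : Tendsto (fun n => ∫ x in ball (0:𝔼) R, fderiv ℝ (ψn n) x (A x)) atTop
      (𝓝 (∫ x in ball (0:𝔼) R, fderiv ℝ ψ x (A x))) := by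
    refine tendsto_integral_of_dominated_convergence (fun _ => C * M) ?_ (integrable_const _) ?_ ?_
    · intro n
      exact (ContinuousLinearMap.apply ℝ ℝ).aestronglyMeasurable_comp₂ hW.Am (fderiv_meas' _).aestronglyMeasurable
    · intro n
      filter_upwards [ae_restrict_mem measurableSet_ball] with x hx
      refine (ContinuousLinearMap.le_opNorm _ _).trans ?_
      exact mul_le_mul (hd n x) (hW.Ab x hx) (norm_nonneg _) ((norm_nonneg _).trans (hd n x))
    · filter_upwards [ae_restrict_of_ae hl1] with x hx
      exact ((ContinuousLinearMap.apply ℝ ℝ (A x)).continuous.tendsto _).comp hx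
  have e2 : Tendsto (fun n => ∫ x in ball (0:𝔼) R, h x * ψn n x) atTop
      (𝓝 (∫ x in ball (0:𝔼) R, h x * ψ x)) := by
    refine tendsto_integral_of_dominated_convergence (fun _ => M * C) ?_ (integrable_const _) ?_ ?_
    · intro n
      exact hW.hm.mul (hc n).aestronglyMeasurable
    · intro n
      filter_upwards [ae_restrict_mem measurableSet_ball] with x hx
      rw [Real.norm_eq_abs, abs_mul]
      exact mul_le_mul (hW.hb x hx) (hb n x) (abs_nonneg _) ((abs_nonneg _).trans (hW.hb x hx))
    · exact .of_forall fun x => (hl0 x).const_mul _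
  exact tendsto_nhds_unique (e1.congr' hwk) e2

lemma Adm.bound {v : 𝔼 → ℝ} (hv : Adm K R v) : ∃ C, ∀ x, |v x| ≤ C := by
  obtain ⟨C, hC⟩ := hv.lip.continuous.bounded_above_of_compact_support hv.compact
  exact ⟨C, hC⟩

lemma Wk.adm1 (hW : Wk R A h M) {R' : ℝ} (hR' : R' < R) {ψ : 𝔼 → ℝ} (hψ : Adm K R' ψ) :
    (∫ x in ball (0:𝔼) R, fderiv ℝ ψ x (A x)) = ∫ x in ball (0:𝔼) R, h x * ψ x := by
  obtain ⟨C, hC⟩ := hψ.bound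
  have hlim : Tendsto (fun n : ℕ => 2 / ((n:ℝ) + 1)) atTop (𝓝 0) := by
    have := (tendsto_one_div_add_atTop_nhds_zero_nat (𝕜 := ℝ)).const_mul 2
    simpa [div_eq_mul_inv] using this
  refine hW.limit (ψn := fun n => mol n ψ) (C := max K (C + K * 2)) ?_ ?_ ?_ ?_ ?_ ?_
  · exact fun n x => (mol_lip hψ.lip n x).trans (le_max_left _ _)
  · exact fun n => (mol_smooth hψ.lip n).continuous
  · intro n x
    refine le_trans ?_ (le_max_right _ _)
    have h1 := mol_near hψ.lip n x
    have h2 : (K:ℝ) * (2 / ((n:ℝ) + 1)) ≤ K * 2 := by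
      refine mul_le_mul_of_nonneg_left ?_ K.coe_nonneg
      exact div_le_self (by norm_num) (by linarith [Nat.cast_nonneg (α := ℝ) n])
    have h3 := hC x
    have h4 := abs_sub_abs_le_abs_sub (mol n ψ x) (ψ x)
    linarith
  · exact mol_fderiv_tendsto hψ.lip
  · intro x
    rw [tendsto_iff_dist_tendsto_zero]
    refine squeeze_zero (fun _ => dist_nonneg) (fun n => ?_) (g := fun n : ℕ => (K:ℝ) * (2 / ((n:ℝ) + 1))) ?_
    · rw [Real.dist_eq]; exact mol_near hψ.lip n x
    · simpa using hlim.const_mul (K:ℝ)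
  · have : ∀ᶠ n : ℕ in atTop, 2 / ((n:ℝ) + 1) < (R - R') := hlim.eventually (gt_mem_nhds (by linarith))
    filter_upwards [this] with n hn
    refine hW.wk _ ⟨mol_smooth hψ.lip n, ?_, ?_⟩
    · refine HasCompactSupport.of_support_subset_isCompact (isCompact_closedBall (0:𝔼) R) ?_
      intro x hx
      by_contra hcon
      refine hx (mol_zero hψ.zero n x ?_)
      rw [mem_closedBall_zero_iff] at hcon
      linarith
    · have : tsupport (mol n ψ) ⊆ closedBall 0 (R' + 2 / ((n:ℝ) + 1)) := by
        refine closure_minimal ?_ isClosed_closedBall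
        intro x hx
        by_contra hcon
        refine hx (mol_zero hψ.zero n x ?_)
        rw [mem_closedBall_zero_iff] at hcon
        linarith
      exact this.trans (closedBall_subset_ball (by linarith))

lemma Wk.adm (hW : Wk R A h M) {ψ : 𝔼 → ℝ} (hψ : Adm K R ψ) :
    (∫ x in ball (0:𝔼) R, fderiv ℝ ψ x (A x)) = ∫ x in ball (0:𝔼) R, h x * ψ x := by
  obtain ⟨C, hC⟩ := hψ.bound
  have hpos : ∀ n : ℕ, (0:ℝ) < 1 / ((n:ℝ) + 1) := fun n => by positivity
  have hlim := tendsto_one_div_add_atTop_nhds_zero_nat (𝕜 := ℝ)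
  set ψn : ℕ → 𝔼 → ℝ := fun n x => max (ψ x - 1 / ((n:ℝ) + 1)) 0 with hψn
  have hlip : ∀ n, LipschitzWith K (ψn n) := fun n => by
    have : LipschitzWith K (fun x => ψ x - 1 / ((n:ℝ) + 1)) := by
      refine LipschitzWith.of_dist_le_mul fun x y => ?_
      rw [dist_sub_right]; exact hψ.lip.dist_le_mul x y
    exact this.max_const 0
  refine hW.limit (ψn := ψn) (C := max K C) ?_ ?_ ?_ ?_ ?_ ?_
  · exact fun n x => (fderiv_le (hlip n) x).trans (le_max_left _ _)
  · exact fun n => (hlip n).continuous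
  · intro n x
    refine le_trans ?_ (le_max_right _ _)
    have h1 := hψ.nn x
    have h2 := hC x
    rw [abs_of_nonneg h1] at h2
    rw [abs_of_nonneg (le_max_right _ _)]
    exact max_le (by linarith [hpos n]) (h1.trans h2)
  · refine .of_forall fun x => ?_
    rcases (hψ.nn x).eq_or_lt with h0 | h0
    · have e1 : fderiv ℝ ψ x = 0 := by
        refine IsLocalMin.fderiv_eq_zero (.of_forall fun y => ?_)
        rw [← h0]; exact hψ.nn y
      have e2 : ∀ n, fderiv ℝ (ψn n) x = 0 := fun n => by
        have : ψn n =ᶠ[𝓝 x] fun _ => 0 := by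
          have : ∀ᶠ y in 𝓝 x, ψ y < 1 / ((n:ℝ) + 1) :=
            hψ.lip.continuous.continuousAt.eventually (gt_mem_nhds (by rw [← h0]; exact hpos n))
          filter_upwards [this] with y hy
          exact max_eq_right (by linarith)
        rw [this.fderiv_eq]; simp
      simp [e1, e2]
    · refine tendsto_const_nhds.congr' ?_
      filter_upwards [hlim.eventually (gt_mem_nhds h0)] with n hn
      have : ψn n =ᶠ[𝓝 x] fun y => ψ y - 1 / ((n:ℝ) + 1) := by
        have : ∀ᶠ y in 𝓝 x, 1 / ((n:ℝ) + 1) < ψ y :=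
          hψ.lip.continuous.continuousAt.eventually (lt_mem_nhds hn)
        filter_upwards [this] with y hy
        exact max_eq_left (by linarith)
      rw [this.fderiv_eq, fderiv_sub_const]
  · intro x
    have h1 : Tendsto (fun n : ℕ => max (ψ x - 1 / ((n:ℝ) + 1)) 0) atTop (𝓝 (max (ψ x - 0) 0)) :=
      (tendsto_const_nhds.sub hlim).max tendsto_const_nhds
    rw [sub_zero, max_eq_left (hψ.nn x)] at h1
    exact h1
  · refine .of_forall fun n => ?_
    obtain ⟨R', hR', hsub⟩ : ∃ R' < R, {x : 𝔼 | 1 / ((n:ℝ) + 1) ≤ ψ x} ⊆ ball 0 R' := by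
      refine exists_lt_subset_ball (isClosed_le continuous_const hψ.lip.continuous) fun x hx => ?_
      have hx' : 1 / ((n:ℝ) + 1) ≤ ψ x := hx
      by_contra hcon
      rw [hψ.zero x hcon] at hx'
      linarith [hpos n]
    refine hW.adm1 (K := K) hR' ⟨hlip n, fun x => le_max_right _ _, fun x hx => ?_⟩
    have : ¬ 1 / ((n:ℝ) + 1) ≤ ψ x := fun h => hx (hsub h)
    exact max_eq_right (by linarith)

end
end CS
end

section
open Set Metric MeasureTheory Bornology Filter Topology
open scoped RealInnerProductSpace Classical NNReal

namespace CS
set_option linter.unusedSectionVars false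
set_option linter.unusedVariables false

section
variable {N : ℕ} {g : ℝ → ℝ} {f : ℝ → ℝ → ℝ} {K : ℝ≥0} {R M : ℝ}
local notation "𝔼" => EuclideanSpace ℝ (Fin N)

lemma fderiv_eq_inner (v : 𝔼 → ℝ) (x y : 𝔼) : fderiv ℝ v x y = ⟪gradient v x, y⟫ := by
  unfold gradient
  rw [InnerProductSpace.toDual_symm_apply]

/-- everything known about the solution extended by zero -/
structure Sol (R : ℝ) (K : ℝ≥0) (M : ℝ) (g : ℝ → ℝ) (f : ℝ → ℝ → ℝ)
    (v : EuclideanSpace ℝ (Fin N) → ℝ) : Prop where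
  hR : 0 < R
  hg : GCond g
  hf : FCond R f
  adm : Adm K R v
  c1 : ContDiffOn ℝ 1 v (ball 0 R)
  wk : Wk R (fun x => gvec g (gradient v x)) (fun x => f ‖x‖ (v x)) M

noncomputable def ut (R : ℝ) (u : 𝔼 → ℝ) (x : 𝔼) : ℝ := if ‖x‖ < R then u x else 0

lemma ut_eq {u : 𝔼 → ℝ} {x : 𝔼} (hx : x ∈ ball (0:𝔼) R) : ut R u x = u x := by
  rw [mem_ball_zero_iff] at hx
  simp [ut, hx]

lemma ut_ev {u : 𝔼 → ℝ} {x : 𝔼} (hx : x ∈ ball (0:𝔼) R) : ut R u =ᶠ[𝓝 x] u := by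
  filter_upwards [isOpen_ball.mem_nhds hx] with y hy
  exact ut_eq hy

lemma ut_adm (hR : 0 < R) {u : 𝔼 → ℝ} (h1 : ContDiffOn ℝ 1 u (closedBall 0 R))
    (h2 : ∀ x ∈ closedBall (0:𝔼) R, 0 ≤ u x) (h3 : ∀ x ∈ sphere (0:𝔼) R, u x = 0) :
    ∃ K : ℝ≥0, Adm K R (ut R u) := by
  have hconv : Convex ℝ (closedBall (0:𝔼) R) := convex_closedBall _ _
  have hud : UniqueDiffOn ℝ (closedBall (0:𝔼) R) := by
    refine uniqueDiffOn_convex hconv ⟨0, ?_⟩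
    exact ball_subset_interior_closedBall (mem_ball_self hR)
  have hcd := h1.continuousOn_fderivWithin hud le_rfl
  obtain ⟨C, hC⟩ := (isCompact_closedBall (0:𝔼) R).exists_bound_of_continuousOn hcd
  have hlip : LipschitzOnWith (Real.toNNReal C) u (closedBall 0 R) := by
    refine hconv.lipschitzOnWith_of_nnnorm_fderivWithin_le (h1.differentiableOn one_ne_zero) fun x hx => ?_
    rw [← NNReal.coe_le_coe, coe_nnnorm]
    exact (hC x hx).trans (Real.le_coe_toNNReal C)
  set K := Real.toNNReal C
  have hd : ∀ x ∈ ball (0:𝔼) R, ∀ y, y ∉ ball (0:𝔼) R → u x ≤ K * dist x y := by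
    intro x hx y hy
    rw [mem_ball_zero_iff] at hx hy
    have hyR : R ≤ ‖y‖ := not_lt.1 hy
    have key : ∃ z ∈ sphere (0:𝔼) R, dist x z ≤ dist x y := by
      by_cases hx0 : x = 0
      · refine ⟨(R / ‖y‖) • y, ?_, ?_⟩
        · rw [mem_sphere_zero_iff_norm, norm_smul, Real.norm_of_nonneg (by positivity)]
          have : ‖y‖ ≠ 0 := by linarith
          field_simp
        · subst hx0
          rw [dist_zero_left, dist_zero_left, norm_smul, Real.norm_of_nonneg (by positivity)]
          have : ‖y‖ ≠ 0 := by linarith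
          field_simp
          exact hyR
      · have hn : 0 < ‖x‖ := norm_pos_iff.2 hx0
        refine ⟨(R / ‖x‖) • x, ?_, ?_⟩
        · rw [mem_sphere_zero_iff_norm, norm_smul, Real.norm_of_nonneg (by positivity)]
          field_simp
        · have e : x - (R / ‖x‖) • x = (1 - R / ‖x‖) • x := by rw [sub_smul, one_smul]
          have h4 : 1 ≤ R / ‖x‖ := by rw [le_div_iff₀ hn]; linarith
          rw [dist_eq_norm, e, norm_smul, Real.norm_of_nonpos (by linarith)]
          have h5 : -(1 - R / ‖x‖) * ‖x‖ = R - ‖x‖ := by field_simp; ring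
          rw [h5, dist_comm, dist_eq_norm]
          have := norm_sub_norm_le y x
          linarith
    obtain ⟨z, hz, hz2⟩ := key
    have h6 := hlip.dist_le_mul x (mem_closedBall_zero_iff.2 hx.le) z (sphere_subset_closedBall hz)
    rw [h3 z hz, Real.dist_eq, sub_zero] at h6
    calc u x ≤ |u x| := le_abs_self _
      _ ≤ _ := h6
      _ ≤ _ := by gcongr
  refine ⟨K, LipschitzWith.of_le_add_mul K fun x y => ?_, fun x => ?_, fun x hx => ?_⟩
  · by_cases hx : x ∈ ball (0:𝔼) R
    · by_cases hy : y ∈ ball (0:𝔼) R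
      · rw [ut_eq hx, ut_eq hy]
        have := hlip.dist_le_mul x (ball_subset_closedBall hx) y (ball_subset_closedBall hy)
        rw [Real.dist_eq] at this
        linarith [le_abs_self (u x - u y)]
      · rw [ut_eq hx]
        have : ut R u y = 0 := by rw [mem_ball_zero_iff] at hy; simp [ut, hy]
        rw [this, zero_add]
        exact hd x hx y hy
    · have : ut R u x = 0 := by rw [mem_ball_zero_iff] at hx; simp [ut, hx]
      rw [this]
      have h0 : 0 ≤ ut R u y := by
        unfold ut; split_ifs with h
        · exact h2 y (mem_closedBall_zero_iff.2 h.le)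
        · exact le_rfl
      positivity
  · unfold ut; split_ifs with h
    · exact h2 x (mem_closedBall_zero_iff.2 h.le)
    · exact le_rfl
  · rw [mem_ball_zero_iff] at hx; simp [ut, hx]

lemma grad_congr {u v : 𝔼 → ℝ} {x : 𝔼} (h : u =ᶠ[𝓝 x] v) : gradient u x = gradient v x := by
  unfold gradient; rw [h.fderiv_eq]

lemma grad_contOn {v : 𝔼 → ℝ} {Ω : Set 𝔼} (hΩ : IsOpen Ω) (h : ContDiffOn ℝ 1 v Ω) :
    ContinuousOn (gradient v) Ω := by
  have := h.continuousOn_fderiv_of_isOpen hΩ le_rfl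
  exact (InnerProductSpace.toDual ℝ 𝔼).symm.continuous.comp_continuousOn this

lemma f_bdd (hf : FCond R f) (L : ℝ) : ∃ C, ∀ r ∈ Icc (0:ℝ) R, ∀ l ∈ Icc (0:ℝ) L, |f r l| ≤ C := by
  have hc : ContinuousOn (fun q : ℝ × ℝ => f q.1 q.2) (Icc 0 R ×ˢ Icc 0 L) :=
    hf.1.mono (prod_mono le_rfl fun x hx => hx.1)
  obtain ⟨C, hC⟩ := (isCompact_Icc.prod isCompact_Icc).exists_bound_of_continuousOn hc
  exact ⟨C, fun r hr l hl => hC (r, l) ⟨hr, hl⟩⟩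

lemma sol_of_weak (hR : 0 < R) (hg : GCond g) (hf : FCond R f) {u : 𝔼 → ℝ} (hu : IsWeakSolP R g f u) :
    ∃ K M, Sol R K M g f (ut R u) := by
  obtain ⟨h1, h2, -, h3, h4⟩ := hu
  obtain ⟨K, hK⟩ := ut_adm hR h1 h2 h3
  obtain ⟨L, hL⟩ := hK.bound
  obtain ⟨C, hC⟩ := f_bdd hf L
  have hc1 : ContDiffOn ℝ 1 (ut R u) (ball 0 R) :=
    (h1.mono ball_subset_closedBall).congr fun x hx => ut_eq hx
  have hgr : ∀ x ∈ ball (0:𝔼) R, gradient (ut R u) x = gradient u x := fun x hx => grad_congr (ut_ev hx)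
  refine ⟨K, max (g K) C, hR, hg, hf, hK, hc1, ?_, ?_, ?_, ?_, ?_⟩
  · exact ((gvec_cont hg).comp_continuousOn (grad_contOn isOpen_ball hc1)).aestronglyMeasurable measurableSet_ball
  · refine ContinuousOn.aestronglyMeasurable ?_ measurableSet_ball
    refine hf.1.comp (f := fun x : 𝔼 => (‖x‖, ut R u x))
      (continuous_norm.continuousOn.prodMk hK.lip.continuous.continuousOn) ?_
    intro x hx
    exact ⟨⟨norm_nonneg _, (mem_ball_zero_iff.1 hx).le⟩, hK.nn x⟩
  · intro x hx
    refine le_trans ?_ (le_max_left _ _)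
    rw [norm_gvec hg]
    exact (g_smono hg).monotoneOn (mem_Ici.2 (norm_nonneg _)) (mem_Ici.2 K.coe_nonneg) (grad_le hK x)
  · intro x hx
    refine le_trans ?_ (le_max_right _ _)
    refine hC _ ⟨norm_nonneg _, (mem_ball_zero_iff.1 hx).le⟩ _ ⟨hK.nn x, ?_⟩
    exact (le_abs_self _).trans (hL x)
  · intro φ hφ
    have h5 := h4 φ hφ
    calc _ = ∫ x in ball (0:𝔼) R, (⟪gvec g (gradient u x), gradient φ x⟫ : ℝ) := by
          refine setIntegral_congr_fun measurableSet_ball fun x hx => ?_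
          show fderiv ℝ φ x _ = _
          rw [fderiv_eq_inner, real_inner_comm, hgr x hx]
      _ = _ := h5
      _ = _ := by
          refine setIntegral_congr_fun measurableSet_ball fun x hx => ?_
          show f ‖x‖ (u x) * φ x = f ‖x‖ (ut R u x) * φ x
          rw [ut_eq hx]

end
end CS
end

section
open Set Metric MeasureTheory Bornology Filter Topology
open scoped RealInnerProductSpace Classical NNReal

namespace CS
set_option linter.unusedSectionVars false
set_option linter.unusedVariables false

section
variable {N : ℕ} {g : ℝ → ℝ} {f : ℝ → ℝ → ℝ} {K : ℝ≥0} {R M : ℝ}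
local notation "𝔼" => EuclideanSpace ℝ (Fin N)

/-- clipped `f` -/
noncomputable def fc (R L : ℝ) (f : ℝ → ℝ → ℝ) (r l : ℝ) : ℝ :=
  f (max 0 (min r R)) (max 0 (min l L))

lemma clip_mem {R : ℝ} (hR : 0 ≤ R) (r : ℝ) : max 0 (min r R) ∈ Icc (0:ℝ) R :=
  ⟨le_max_left _ _, max_le hR (min_le_right _ _)⟩

lemma clip_eq {R r : ℝ} (hr : r ∈ Icc (0:ℝ) R) : max 0 (min r R) = r := by
  rw [min_eq_left hr.2, max_eq_right hr.1]

lemma clip_dist (R a b : ℝ) : |max 0 (min a R) - max 0 (min b R)| ≤ |a - b| := by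
  have h1 := abs_max_sub_max_le_abs (min a R) (min b R) 0
  have h2 := abs_min_sub_min_le_max a R b R
  rw [sub_self, abs_zero, max_eq_left (abs_nonneg _)] at h2
  rw [max_comm 0, max_comm 0]
  exact h1.trans h2

lemma fc_cont (hR : 0 ≤ R) {L : ℝ} (hL : 0 ≤ L) (hf : FCond R f) :
    Continuous (fun q : ℝ × ℝ => fc R L f q.1 q.2) := by
  unfold fc
  refine hf.1.comp_continuous (f := fun q : ℝ × ℝ => (max 0 (min q.1 R), max 0 (min q.2 L))) (by fun_prop) ?_
  intro q
  exact ⟨clip_mem hR _, mem_Ici.2 (le_max_left _ _)⟩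

lemma fc_unif (hR : 0 ≤ R) {L : ℝ} (hL : 0 ≤ L) (hf : FCond R f) {ε : ℝ} (hε : 0 < ε) :
    ∃ δ > 0, ∀ r l l' : ℝ, |l - l'| < δ → |fc R L f r l - fc R L f r l'| < ε := by
  have hc : ContinuousOn (fun q : ℝ × ℝ => f q.1 q.2) (Icc 0 R ×ˢ Icc 0 L) :=
    hf.1.mono (prod_mono le_rfl fun x hx => hx.1)
  have hu := (isCompact_Icc.prod isCompact_Icc).uniformContinuousOn_of_continuous hc
  rw [Metric.uniformContinuousOn_iff] at hu
  obtain ⟨δ, hδ, h⟩ := hu ε hε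
  refine ⟨δ, hδ, fun r l l' hl => ?_⟩
  have := h (max 0 (min r R), max 0 (min l L)) ⟨clip_mem hR _, clip_mem hL _⟩
    (max 0 (min r R), max 0 (min l' L)) ⟨clip_mem hR _, clip_mem hL _⟩ (by
      rw [Prod.dist_eq, dist_self, Real.dist_eq]
      exact max_lt hδ ((clip_dist L l l').trans_lt hl))
  rwa [Real.dist_eq] at this

lemma Adm.fderiv_out {v : 𝔼 → ℝ} (hv : Adm K R v) {x : 𝔼} (hx : x ∉ ball (0:𝔼) R) : gradient v x = 0 := by
  have : fderiv ℝ v x = 0 := by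
    refine IsLocalMin.fderiv_eq_zero (.of_forall fun y => ?_)
    rw [hv.zero x hx]; exact hv.nn y
  simp [gradient, this]

lemma En_ball (hg : GCond g) {v : 𝔼 → ℝ} (hv : Adm K R v) :
    En g v = ∫ x in ball (0:𝔼) R, Gfun g ‖gradient v x‖ := by
  unfold En
  rw [setIntegral_eq_integral_of_forall_compl_eq_zero]
  intro x hx
  rw [hv.fderiv_out hx, norm_zero, G_zero]

lemma grad_meas (v : 𝔼 → ℝ) : StronglyMeasurable (gradient v) :=
  (InnerProductSpace.toDual ℝ 𝔼).symm.continuous.comp_stronglyMeasurable (fderiv_meas' v)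

lemma G_grad_int (hg : GCond g) {v : 𝔼 → ℝ} (hv : Adm K R v) :
    IntegrableOn (fun x => Gfun g ‖gradient v x‖) (ball (0:𝔼) R) := by
  refine Integrable.mono' (g := fun _ => Gfun g K) (integrable_const _) ?_ (.of_forall fun x => ?_)
  · exact ((G_cont_norm hg).comp_stronglyMeasurable (grad_meas v)).aestronglyMeasurable
  · rw [Real.norm_of_nonneg (G_nonneg hg (norm_nonneg _))]
    exact G_mono hg (norm_nonneg _) (grad_le hv x)

lemma Wk.int_A {A : 𝔼 → 𝔼} {h : 𝔼 → ℝ} (hW : Wk R A h M) {v : 𝔼 → ℝ} (hv : Adm K R v) :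
    IntegrableOn (fun x => fderiv ℝ v x (A x)) (ball (0:𝔼) R) := by
  refine Integrable.mono' (g := fun _ => K * M) (integrable_const _) ?_ ?_
  · exact (ContinuousLinearMap.apply ℝ ℝ).aestronglyMeasurable_comp₂ hW.Am (fderiv_meas' _).aestronglyMeasurable
  · filter_upwards [ae_restrict_mem measurableSet_ball] with x hx
    refine (ContinuousLinearMap.le_opNorm _ _).trans ?_
    exact mul_le_mul (fderiv_le hv.lip x) (hW.Ab x hx) (norm_nonneg _) K.coe_nonneg

lemma Wk.int_h {A : 𝔼 → 𝔼} {h : 𝔼 → ℝ} (hW : Wk R A h M) {v : 𝔼 → ℝ} (hv : Adm K R v) :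
    IntegrableOn (fun x => h x * v x) (ball (0:𝔼) R) := by
  obtain ⟨C, hC⟩ := hv.bound
  refine Integrable.mono' (g := fun _ => M * C) (integrable_const _) ?_ ?_
  · exact hW.hm.mul hv.lip.continuous.aestronglyMeasurable
  · filter_upwards [ae_restrict_mem measurableSet_ball] with x hx
    rw [Real.norm_eq_abs, abs_mul]
    exact mul_le_mul (hW.hb x hx) (hC x) (abs_nonneg _) ((abs_nonneg _).trans (hW.hb x hx))

lemma Sol.breg {v : 𝔼 → ℝ} (hS : Sol R K M g f v) {w : 𝔼 → ℝ} (hw : Adm K R w) :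
    IntegrableOn (fun x => Br g (gradient w x) (gradient v x)) (ball (0:𝔼) R) ∧
    (∫ x in ball (0:𝔼) R, Br g (gradient w x) (gradient v x)) =
      En g w - En g v - ∫ x in ball (0:𝔼) R, f ‖x‖ (v x) * (w x - v x) := by
  have hv := hS.adm
  have e1 := hS.wk.adm hw
  have e2 := hS.wk.adm hv
  have i1 := hS.wk.int_A hw
  have i2 := hS.wk.int_A hv
  have j1 := G_grad_int hS.hg hw
  have j2 := G_grad_int hS.hg hv
  have k1 := hS.wk.int_h hw
  have k2 := hS.wk.int_h hv
  have hB : ∀ x, Br g (gradient w x) (gradient v x) = (Gfun g ‖gradient w x‖ - Gfun g ‖gradient v x‖) -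
      (fderiv ℝ w x (gvec g (gradient v x)) - fderiv ℝ v x (gvec g (gradient v x))) := by
    intro x
    unfold Br
    rw [inner_sub_right, fderiv_eq_inner, fderiv_eq_inner, real_inner_comm, real_inner_comm (gradient v x)]
  simp_rw [hB]
  refine ⟨(j1.sub j2).sub (i1.sub i2), ?_⟩
  have a1 : (∫ x in ball (0:𝔼) R, ((Gfun g ‖gradient w x‖ - Gfun g ‖gradient v x‖) -
      (fderiv ℝ w x (gvec g (gradient v x)) - fderiv ℝ v x (gvec g (gradient v x))))) = _ :=
    integral_sub (j1.sub j2) (i1.sub i2)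
  have a2 : (∫ x in ball (0:𝔼) R, (Gfun g ‖gradient w x‖ - Gfun g ‖gradient v x‖)) = _ :=
    integral_sub j1 j2
  have a3 : (∫ x in ball (0:𝔼) R, (fderiv ℝ w x (gvec g (gradient v x)) - fderiv ℝ v x (gvec g (gradient v x)))) = _ :=
    integral_sub i1 i2
  have a4 : (∫ x in ball (0:𝔼) R, f ‖x‖ (v x) * (w x - v x)) =
      (∫ x in ball (0:𝔼) R, f ‖x‖ (v x) * w x) - ∫ x in ball (0:𝔼) R, f ‖x‖ (v x) * v x := by
    rw [← integral_sub k1 k2]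
    congr 1; ext x; ring
  rw [En_ball hS.hg hw, En_ball hS.hg hv, a4, ← e1, ← e2]
  rw [a2, a3] at a1
  exact a1

lemma fc_ii (hR : 0 ≤ R) {L : ℝ} (hL : 0 ≤ L) (hf : FCond R f) (r a b : ℝ) :
    IntervalIntegrable (fun l => fc R L f r l) volume a b := by
  have : Continuous (fun l => fc R L f r l) := (fc_cont hR hL hf).comp (by fun_prop : Continuous fun l : ℝ => (r, l))
  exact this.intervalIntegrable _ _

/-- primitive is continuous -/
lemma fc_prim_cont (hR : 0 ≤ R) {L : ℝ} (hL : 0 ≤ L) (hf : FCond R f) {w : 𝔼 → ℝ} (hw : Continuous w) :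
    Continuous (fun x : 𝔼 => ∫ l in (0:ℝ)..(w x), fc R L f ‖x‖ l) := by
  have h1 : Continuous (Function.uncurry fun (x : 𝔼) (l : ℝ) => fc R L f ‖x‖ l) :=
    (fc_cont hR hL hf).comp (by fun_prop : Continuous fun q : 𝔼 × ℝ => (‖q.1‖, q.2))
  have h2 := intervalIntegral.continuous_parametric_primitive_of_continuous (μ := volume) (a₀ := 0) h1
  exact h2.comp (continuous_id.prodMk hw)

lemma cont_intOn {w : 𝔼 → ℝ} (hw : Continuous w) : IntegrableOn w (ball (0:𝔼) R) :=
  (hw.continuousOn.integrableOn_compact (isCompact_closedBall (0:𝔼) R)).mono_set ball_subset_closedBall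

lemma adm_int_ball {w : 𝔼 → ℝ} (hw : Adm K R w) : ∫ x in ball (0:𝔼) R, w x = ∫ x, w x :=
  setIntegral_eq_integral_of_forall_compl_eq_zero fun x hx => hw.zero x hx

lemma vt_f (hR : 0 ≤ R) {L : ℝ} (hL : 0 ≤ L) (hf : FCond R f) {v : 𝔼 → ℝ} (hv : Adm K R v)
    {s t : ℝ} {e : 𝔼} (hs : 0 ≤ s) (ht : 0 ≤ t) (he : ‖e‖ = 1) :
    (∫ x in ball (0:𝔼) R, ∫ l in (0:ℝ)..(v x), fc R L f ‖x‖ l) ≤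
      ∫ x in ball (0:𝔼) R, ∫ l in (0:ℝ)..(vt s t e v x), fc R L f ‖x‖ l := by
  obtain ⟨C, hC⟩ := f_bdd hf L
  have hw := vt_adm (s := s) (t := t) hv hs ht he
  have h := vt_layer (s := s) (t := t) hv hs ht he (k := fun r l => C - fc R L f r l)
    (continuous_const.sub (fc_cont hR hL hf)) ?_ ?_
  · have key : ∀ {w : 𝔼 → ℝ}, Adm K R w → (∫ x in ball (0:𝔼) R, ∫ l in (0:ℝ)..(w x), (C - fc R L f ‖x‖ l)) =
        C * (∫ x, w x) - ∫ x in ball (0:𝔼) R, ∫ l in (0:ℝ)..(w x), fc R L f ‖x‖ l := by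
      intro w hw
      rw [← adm_int_ball hw, ← integral_const_mul,
        ← integral_sub ((cont_intOn hw.lip.continuous).const_mul C)
          (cont_intOn (fc_prim_cont hR hL hf hw.lip.continuous))]
      congr 1; ext x
      rw [intervalIntegral.integral_sub (by simp) (fc_ii hR hL hf _ _ _)]
      simp [mul_comm]
    rw [key hw, key hv, vt_int hv hs ht he] at h
    linarith
  · intro r l
    have := (abs_le.1 (hC _ (clip_mem hR r) _ (clip_mem hL l))).2
    exact sub_nonneg.2 this
  · intro l r r' hrr
    refine sub_le_sub_left ?_ _
    exact hf.2 _ (le_max_left _ _) _ (clip_mem hR r) _ (clip_mem hR r') (max_le_max le_rfl (min_le_min hrr le_rfl))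

theorem Sol.gain {v : 𝔼 → ℝ} (hS : Sol R K M g f v) {κ η : ℝ} (hκ : 0 < κ) (hη : 0 < η) :
    ∃ t0 > 0, ∀ t ∈ Ioo 0 t0, ∀ s, 0 ≤ s → ∀ e : 𝔼, ‖e‖ = 1 →
      volume {x ∈ ball (0:𝔼) R | κ ≤ ‖gradient (vt s t e v) x - gradient v x‖} ≤ ENNReal.ofReal (η * t) := by
  have hR := hS.hR.le
  have hv := hS.adm
  obtain ⟨c, hc, hBr⟩ := Br_unif (N := N) hS.hg (K:ℝ) hκ
  obtain ⟨L0, hL0⟩ := hv.bound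
  have hL0' : 0 ≤ L0 := (abs_nonneg _).trans (hL0 0)
  set L := L0 + K with hLdef
  have hL : 0 ≤ L := by positivity
  set V := (volume.restrict (ball (0:𝔼) R)).real univ with hV
  set ε := η * c / ((K + 1) * (V + 1)) with hε
  have hV0 : 0 ≤ V := measureReal_nonneg
  have hεpos : 0 < ε := by positivity
  obtain ⟨δ, hδ, hun⟩ := fc_unif hR hL hS.hf hεpos
  refine ⟨min 1 (δ / (K + 1)), by positivity, fun t ht s hs e he => ?_⟩
  have ht0 : 0 < t := ht.1
  have ht1 : t < 1 := ht.2.trans_le (min_le_left _ _)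
  have htδ : K * t < δ := by
    have := ht.2.trans_le (min_le_right _ _)
    rw [lt_div_iff₀ (by positivity)] at this
    nlinarith [K.coe_nonneg]
  set w := vt s t e v with hw_def
  have hw : Adm K R w := vt_adm (s := s) (t := t) hv hs ht0.le he
  have hnear : ∀ x, |w x - v x| ≤ K * t := vt_near hv ht0.le he
  have hvL : ∀ x, v x ∈ Icc 0 L := fun x => ⟨hv.nn x, by
    have := (le_abs_self _).trans (hL0 x)
    rw [hLdef]; linarith [K.coe_nonneg]⟩
  obtain ⟨hintg, hBreq⟩ := hS.breg hw
  have hE : En g w ≤ En g v := En_vt hS.hg hv hs ht0.le he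
  have hF := vt_f hR hL hS.hf hv hs ht0.le he
  -- error bound
  have herr : (∫ x in ball (0:𝔼) R, ∫ l in (0:ℝ)..(w x), fc R L f ‖x‖ l)
      - (∫ x in ball (0:𝔼) R, ∫ l in (0:ℝ)..(v x), fc R L f ‖x‖ l)
      - (∫ x in ball (0:𝔼) R, f ‖x‖ (v x) * (w x - v x)) ≤ ε * (K * t) * V := by
    have i1 : IntegrableOn _ (ball (0:𝔼) R) := cont_intOn (fc_prim_cont hR hL hS.hf hw.lip.continuous)
    have i2 : IntegrableOn _ (ball (0:𝔼) R) := cont_intOn (fc_prim_cont hR hL hS.hf hv.lip.continuous)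
    have i3 : IntegrableOn (fun x => f ‖x‖ (v x) * (w x - v x)) (ball (0:𝔼) R) := by
      have := (hS.wk.int_h hw).sub (hS.wk.int_h hv)
      refine this.congr (.of_forall fun x => ?_)
      simp only [Pi.sub_apply]; ring
    have i4 : IntegrableOn (fun x => (∫ l in (0:ℝ)..(w x), fc R L f ‖x‖ l) - ∫ l in (0:ℝ)..(v x), fc R L f ‖x‖ l) (ball (0:𝔼) R) := i1.sub i2
    rw [← integral_sub i1 i2, ← integral_sub i4 i3]
    have : ε * (K * t) * V = ∫ x in ball (0:𝔼) R, ε * (K * t) := by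
      rw [integral_const, smul_eq_mul, mul_comm]
    rw [this]
    refine setIntegral_mono_on (i4.sub i3) (integrable_const _) measurableSet_ball fun x hx => ?_
    have hx' : ‖x‖ ∈ Icc 0 R := ⟨norm_nonneg _, (mem_ball_zero_iff.1 hx).le⟩
    have e1 : f ‖x‖ (v x) = fc R L f ‖x‖ (v x) := by unfold fc; rw [clip_eq hx', clip_eq (hvL x)]
    have e2 : (∫ l in (0:ℝ)..(w x), fc R L f ‖x‖ l) - (∫ l in (0:ℝ)..(v x), fc R L f ‖x‖ l)
        - fc R L f ‖x‖ (v x) * (w x - v x) = ∫ l in (v x)..(w x), (fc R L f ‖x‖ l - fc R L f ‖x‖ (v x)) := by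
      rw [intervalIntegral.integral_interval_sub_left (fc_ii hR hL hS.hf _ _ _) (fc_ii hR hL hS.hf _ _ _),
        intervalIntegral.integral_sub (fc_ii hR hL hS.hf _ _ _) (by simp)]
      simp [mul_comm]
    rw [e1, e2]
    have e3 : ‖∫ l in (v x)..(w x), (fc R L f ‖x‖ l - fc R L f ‖x‖ (v x))‖ ≤ ε * |w x - v x| := by
      refine intervalIntegral.norm_integral_le_of_norm_le_const fun l hl => ?_
      refine (hun _ _ _ ?_).le
      have h5 : |l - v x| ≤ |w x - v x| := by
        rw [uIoc] at hl
        have := abs_sub_left_of_mem_uIcc (Ioc_subset_Icc_self hl : l ∈ uIcc (v x) (w x))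
        exact this
      exact (h5.trans (hnear x)).trans_lt htδ
    calc _ ≤ _ := le_abs_self _
      _ ≤ ε * |w x - v x| := e3
      _ ≤ _ := by gcongr; exact hnear x
  have hBle : (∫ x in ball (0:𝔼) R, Br g (gradient w x) (gradient v x)) ≤ ε * (K * t) * V := by
    rw [hBreq]; linarith
  -- Markov
  have hm := mul_meas_ge_le_integral_of_nonneg (μ := volume.restrict (ball (0:𝔼) R)) (.of_forall fun x => Br_nonneg hS.hg (gradient w x) (gradient v x)) hintg c
  have hmm : MeasurableSet {x : 𝔼 | κ ≤ ‖gradient w x - gradient v x‖} :=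
    measurableSet_le measurable_const ((grad_meas w).sub (grad_meas v)).norm.measurable
  have hsub : volume {x ∈ ball (0:𝔼) R | κ ≤ ‖gradient w x - gradient v x‖} ≤
      volume.restrict (ball (0:𝔼) R) {x | c ≤ Br g (gradient w x) (gradient v x)} := by
    have : {x ∈ ball (0:𝔼) R | κ ≤ ‖gradient w x - gradient v x‖} = {x : 𝔼 | κ ≤ ‖gradient w x - gradient v x‖} ∩ ball 0 R := by
      ext x; exact and_comm
    rw [this, ← Measure.restrict_apply hmm]
    refine measure_mono fun x hx => ?_
    exact hBr _ _ (grad_le hw x) (grad_le hv x) hx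
  refine hsub.trans ?_
  have h7 : (volume.restrict (ball (0:𝔼) R)).real {x | c ≤ Br g (gradient w x) (gradient v x)} ≤ η * t := by
    have h8 := hm.trans hBle
    have h9 : ε * (K * t) * V ≤ c * (η * t) := by
      have : ε * ((K + 1) * (V + 1)) = η * c := by rw [hε]; field_simp
      have h10 : (K:ℝ) * V ≤ (K + 1) * (V + 1) := by nlinarith [K.coe_nonneg]
      calc ε * (K * t) * V = ε * (K * V) * t := by ring
        _ ≤ ε * ((K + 1) * (V + 1)) * t := by gcongr
        _ = c * (η * t) := by rw [this]; ring
    exact le_of_mul_le_mul_left (h8.trans h9) hc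
  rw [← ENNReal.ofReal_toReal (measure_ne_top (volume.restrict (ball (0:𝔼) R)) _)]
  exact ENNReal.ofReal_le_ofReal h7

end
end CS
end

section
open Set Metric MeasureTheory Bornology Filter Topology
open scoped RealInnerProductSpace Classical NNReal

namespace CS
set_option linter.unusedSectionVars false
set_option linter.unusedVariables false

section
variable {N : ℕ} {g : ℝ → ℝ} {f : ℝ → ℝ → ℝ} {K : ℝ≥0} {R M : ℝ} {v : EuclideanSpace ℝ (Fin N) → ℝ}
local notation "𝔼" => EuclideanSpace ℝ (Fin N)

lemma Sol.cont (hS : Sol R K M g f v) : Continuous v := hS.adm.lip.continuous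

lemma Sol.cd (hS : Sol R K M g f v) {x : 𝔼} (hx : x ∈ ball (0:𝔼) R) : ContDiffAt ℝ 1 v x :=
  hS.c1.contDiffAt (isOpen_ball.mem_nhds hx)

lemma Sol.strict (hS : Sol R K M g f v) {x : 𝔼} (hx : x ∈ ball (0:𝔼) R) :
    HasStrictFDerivAt v (fderiv ℝ v x) x := (hS.cd hx).hasStrictFDerivAt (by norm_num)

lemma Sol.contDv (hS : Sol R K M g f v) {x : 𝔼} (hx : x ∈ ball (0:𝔼) R) :
    ContinuousAt (fderiv ℝ v) x := (hS.cd hx).continuousAt_fderiv (by norm_num)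

lemma Sol.mem_of_pos (hS : Sol R K M g f v) {x : 𝔼} (hx : 0 < v x) : x ∈ ball (0:𝔼) R := by
  by_contra h; rw [hS.adm.zero x h] at hx; exact lt_irrefl _ hx

lemma Sol.mem_of_fd (hS : Sol R K M g f v) {x w : 𝔼} (hx : fderiv ℝ v x w ≠ 0) : x ∈ ball (0:𝔼) R := by
  by_contra h; apply hx; rw [fderiv_eq_inner, hS.adm.fderiv_out h, inner_zero_left]

lemma Sol.pos_of_fd (hS : Sol R K M g f v) {x w : 𝔼} (hx : fderiv ℝ v x w ≠ 0) : 0 < v x := by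
  rcases (hS.adm.nn x).lt_or_eq with h | h
  · exact h
  exfalso; apply hx
  have : fderiv ℝ v x = 0 := IsLocalMin.fderiv_eq_zero (.of_forall fun y => by rw [← h]; exact hS.adm.nn y)
  rw [this]; rfl

lemma Sol.line (hS : Sol R K M g f v) {x w : 𝔼} {τ : ℝ} (hx : x + τ • w ∈ ball (0:𝔼) R) :
    HasDerivAt (fun τ : ℝ => v (x + τ • w)) (fderiv ℝ v (x + τ • w) w) τ := by
  have h1 : HasDerivAt (fun τ : ℝ => x + τ • w) w τ := by
    simpa using ((hasDerivAt_id τ).smul_const w).const_add x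
  exact (hS.strict hx).hasFDerivAt.comp_hasDerivAt τ h1

/-- First-return chord. -/
structure Arc (v : EuclideanSpace ℝ (Fin N) → ℝ) (w x : EuclideanSpace ℝ (Fin N)) (d : ℝ) : Prop where
  dpos : 0 < d
  ret : v (x + d • w) = v x
  btw : ∀ τ ∈ Ioo 0 d, v x < v (x + τ • w)
  up : 0 < fderiv ℝ v x w
  dn : fderiv ℝ v (x + d • w) w < 0

lemma Arc.unique {w x : 𝔼} {d d' : ℝ} (h : Arc v w x d) (h' : Arc v w x d') : d = d' := by
  rcases lt_trichotomy d d' with hl | hl | hl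
  · have := h'.btw d ⟨h.dpos, hl⟩; rw [h.ret] at this; exact absurd this (lt_irrefl _)
  · exact hl
  · have := h.btw d' ⟨h'.dpos, hl⟩; rw [h'.ret] at this; exact absurd this (lt_irrefl _)

/-- first-return time -/
noncomputable def DD (v : EuclideanSpace ℝ (Fin N) → ℝ) (q : EuclideanSpace ℝ (Fin N) × EuclideanSpace ℝ (Fin N)) : ℝ :=
  if h : ∃ d, Arc v q.2 q.1 d then h.choose else 0

lemma Arc.DD_eq {w x : 𝔼} {d : ℝ} (h : Arc v w x d) : DD v (x, w) = d := by
  have h' : ∃ d, Arc v (x, w).2 (x, w).1 d := ⟨d, h⟩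
  unfold DD
  rw [dif_pos h']
  exact h'.choose_spec.unique h

lemma Arc.flip {w x : 𝔼} {d : ℝ} (h : Arc v w x d) : Arc v (-w) (x + d • w) d := by
  have e : x + d • w + d • (-w) = x := by simp
  refine ⟨h.dpos, by rw [e, h.ret], fun τ hτ => ?_, ?_, ?_⟩
  · rw [h.ret]
    have := h.btw (d - τ) ⟨by linarith [hτ.2], by linarith [hτ.1]⟩
    rwa [show x + d • w + τ • (-w) = x + (d - τ) • w by rw [sub_smul, smul_neg]; abel]
  · rw [map_neg]; linarith [h.dn]
  · rw [e, map_neg]; linarith [h.up]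

lemma Arc.smul {w x : 𝔼} {d c : ℝ} (h : Arc v w x d) (hc : 0 < c) : Arc v (c • w) x (d / c) := by
  have e : (d / c) • c • w = d • w := by rw [smul_smul]; congr 1; field_simp
  refine ⟨div_pos h.dpos hc, by rw [e, h.ret], fun τ hτ => ?_, ?_, ?_⟩
  · rw [smul_smul]
    exact h.btw _ ⟨mul_pos hτ.1 hc, (lt_div_iff₀ hc).1 hτ.2⟩
  · rw [map_smul]; exact mul_pos hc h.up
  · rw [e, map_smul]; exact mul_neg_of_pos_of_neg hc h.dn

lemma strictMono_seg {φ φ' : ℝ → ℝ} {a b : ℝ} (h : ∀ τ ∈ Icc a b, HasDerivAt φ (φ' τ) τ)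
    (hp : ∀ τ ∈ Icc a b, 0 < φ' τ) : StrictMonoOn φ (Icc a b) := by
  refine strictMonoOn_of_deriv_pos (convex_Icc _ _) (fun τ hτ => (h τ hτ).continuousAt.continuousWithinAt) ?_
  intro τ hτ
  rw [interior_Icc] at hτ
  rw [(h τ (Ioo_subset_Icc_self hτ)).deriv]; exact hp τ (Ioo_subset_Icc_self hτ)

lemma strictAnti_seg {φ φ' : ℝ → ℝ} {a b : ℝ} (h : ∀ τ ∈ Icc a b, HasDerivAt φ (φ' τ) τ)
    (hp : ∀ τ ∈ Icc a b, φ' τ < 0) : StrictAntiOn φ (Icc a b) := by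
  refine strictAntiOn_of_deriv_neg (convex_Icc _ _) (fun τ hτ => (h τ hτ).continuousAt.continuousWithinAt) ?_
  intro τ hτ
  rw [interior_Icc] at hτ
  rw [(h τ (Ioo_subset_Icc_self hτ)).deriv]; exact hp τ (Ioo_subset_Icc_self hτ)

lemma joint_cont : Continuous (fun p : (𝔼 × 𝔼) × ℝ => p.1.1 + p.2 • p.1.2) := by fun_prop

lemma Sol.fd_joint (hS : Sol R K M g f v) {x w : 𝔼} {τ : ℝ} (hx : x + τ • w ∈ ball (0:𝔼) R) :
    ContinuousAt (fun p : (𝔼 × 𝔼) × ℝ => fderiv ℝ v (p.1.1 + p.2 • p.1.2) p.1.2) ((x, w), τ) := by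
  have h1 : ContinuousAt (fun p : (𝔼 × 𝔼) × ℝ => p.1.1 + p.2 • p.1.2) ((x, w), τ) := joint_cont.continuousAt
  have h2 : ContinuousAt (fun p : (𝔼 × 𝔼) × ℝ => fderiv ℝ v (p.1.1 + p.2 • p.1.2)) ((x, w), τ) :=
    ContinuousAt.comp (g := fderiv ℝ v) (hS.contDv hx) h1
  exact h2.clm_apply (by fun_prop)

/-- local strict monotonicity with a uniform radius -/
lemma Sol.seg_up (hS : Sol R K M g f v) {x w : 𝔼} {a : ℝ} (hp : 0 < fderiv ℝ v (x + a • w) w) :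
    ∃ ρ > 0, ∀ᶠ q : 𝔼 × 𝔼 in 𝓝 (x, w), ∀ τ ∈ Icc (a - ρ) (a + ρ),
      q.1 + τ • q.2 ∈ ball (0:𝔼) R ∧ 0 < fderiv ℝ v (q.1 + τ • q.2) q.2 := by
  have hb := hS.mem_of_fd hp.ne'
  have h1 := (hS.fd_joint hb).eventually (lt_mem_nhds hp)
  rw [nhds_prod_eq] at h1
  obtain ⟨p, hp1, s, hs, h2⟩ := Filter.eventually_prod_iff.1 h1
  obtain ⟨ρ, hρ, h3⟩ := Metric.nhds_basis_closedBall.mem_iff.1 hs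
  refine ⟨ρ, hρ, hp1.mono fun q hq τ hτ => ?_⟩
  have h4 := h2 hq (h3 (show τ ∈ closedBall a ρ by rw [Real.closedBall_eq_Icc]; exact hτ))
  exact ⟨hS.mem_of_fd h4.ne', h4⟩

lemma Sol.seg_dn (hS : Sol R K M g f v) {x w : 𝔼} {a : ℝ} (hp : fderiv ℝ v (x + a • w) w < 0) :
    ∃ ρ > 0, ∀ᶠ q : 𝔼 × 𝔼 in 𝓝 (x, w), ∀ τ ∈ Icc (a - ρ) (a + ρ),
      q.1 + τ • q.2 ∈ ball (0:𝔼) R ∧ fderiv ℝ v (q.1 + τ • q.2) q.2 < 0 := by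
  have hb := hS.mem_of_fd hp.ne
  have h1 := (hS.fd_joint hb).eventually (gt_mem_nhds hp)
  rw [nhds_prod_eq] at h1
  obtain ⟨p, hp1, s, hs, h2⟩ := Filter.eventually_prod_iff.1 h1
  obtain ⟨ρ, hρ, h3⟩ := Metric.nhds_basis_closedBall.mem_iff.1 hs
  refine ⟨ρ, hρ, hp1.mono fun q hq τ hτ => ?_⟩
  have h4 := h2 hq (h3 (show τ ∈ closedBall a ρ by rw [Real.closedBall_eq_Icc]; exact hτ))
  exact ⟨hS.mem_of_fd h4.ne, h4⟩

lemma Sol.ift (hS : Sol R K M g f v) {x w : 𝔼} {d : ℝ} (h : Arc v w x d) :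
    ∃ (ψ : 𝔼 × 𝔼 → ℝ) (L : 𝔼 × 𝔼 →L[ℝ] ℝ), HasStrictFDerivAt ψ L (x, w) ∧ Tendsto ψ (𝓝 (x, w)) (𝓝 d) ∧
      ∀ᶠ q : 𝔼 × 𝔼 in 𝓝 (x, w), v (q.1 + ψ q • q.2) = v q.1 := by
  have hb0 := hS.mem_of_fd h.up.ne'
  have hb1 := hS.mem_of_fd h.dn.ne
  set F : (𝔼 × 𝔼) × ℝ → ℝ := fun p => v (p.1.1 + p.2 • p.1.2) - v p.1.1 with hF
  set u : (𝔼 × 𝔼) × ℝ := ((x, w), d) with hu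
  have c1 : ContDiffAt ℝ 1 F u := by
    have a1 : ContDiffAt ℝ 1 (fun p : (𝔼 × 𝔼) × ℝ => p.1.1 + p.2 • p.1.2) u := by fun_prop
    have a2 : ContDiffAt ℝ 1 (fun p : (𝔼 × 𝔼) × ℝ => p.1.1) u := by fun_prop
    have b1 : ContDiffAt ℝ 1 (fun p : (𝔼 × 𝔼) × ℝ => v (p.1.1 + p.2 • p.1.2)) u :=
      ContDiffAt.comp (g := v) u (hS.cd hb1) a1
    have b2 : ContDiffAt ℝ 1 (fun p : (𝔼 × 𝔼) × ℝ => v (p.1.1)) u :=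
      ContDiffAt.comp (g := v) u (hS.cd hb0) a2
    exact b1.sub b2
  have dfu : HasStrictFDerivAt F (fderiv ℝ F u) u := c1.hasStrictFDerivAt (by norm_num)
  have key : fderiv ℝ F u ((0 : 𝔼 × 𝔼), (1:ℝ)) = fderiv ℝ v (x + d • w) w := by
    have l1 : HasDerivAt (fun τ : ℝ => (((x, w), τ) : (𝔼 × 𝔼) × ℝ)) (((0 : 𝔼 × 𝔼), (1:ℝ))) d :=
      (hasDerivAt_const d (x, w)).prodMk (hasDerivAt_id d)
    have l2 : HasDerivAt (fun τ : ℝ => F ((x, w), τ)) (fderiv ℝ F u ((0 : 𝔼 × 𝔼), (1:ℝ))) d :=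
      HasFDerivAt.comp_hasDerivAt (l := F) d dfu.hasFDerivAt l1
    have l3 : HasDerivAt (fun τ : ℝ => F ((x, w), τ)) (fderiv ℝ v (x + d • w) w) d :=
      (hS.line hb1).sub_const (v x)
    exact l2.unique l3
  have hinv : (fderiv ℝ F u ∘L .inr ℝ (𝔼 × 𝔼) ℝ).IsInvertible := by
    refine ⟨ContinuousLinearEquiv.unitsEquivAut ℝ (Units.mk0 _ h.dn.ne), ?_⟩
    ext
    simp [key]
  refine ⟨_, _, dfu.hasStrictFDerivAt_implicitFunctionOfProdDomain hinv,
    dfu.tendsto_implicitFunctionOfProdDomain hinv, ?_⟩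
  refine (dfu.eventually_apply_implicitFunctionOfProdDomain hinv).mono fun q hq => ?_
  have e1 : F u = 0 := by simp only [hF, hu]; rw [h.ret, sub_self]
  rw [e1] at hq
  exact sub_eq_zero.1 hq

/-- nearby chords, with gaps -/
theorem Sol.arc_near (hS : Sol R K M g f v) {x w : 𝔼} {d : ℝ} (h : Arc v w x d) :
    (∀ᶠ q : 𝔼 × 𝔼 in 𝓝 (x, w), Arc v q.2 q.1 (DD v q)) ∧
    (∃ ρ > 0, ∀ᶠ q : 𝔼 × 𝔼 in 𝓝 (x, w), ∀ τ ∈ Ioc 0 ρ, v (q.1 - τ • q.2) < v q.1 ∧ v q.1 < v (q.1 + τ • q.2) ∧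
        v (q.1 + (DD v q + τ) • q.2) < v q.1) ∧
    ∃ L : 𝔼 × 𝔼 →L[ℝ] ℝ, HasStrictFDerivAt (DD v) L (x, w) ∧
      ∀ a b, fderiv ℝ v (x + d • w) (a + d • b + L (a, b) • w) = fderiv ℝ v x a := by
  obtain ⟨ψ, L, hL, hψ, hev⟩ := hS.ift h
  have hb0 := hS.mem_of_fd h.up.ne'
  have hb1 := hS.mem_of_fd h.dn.ne
  have hd := h.dpos
  have hup := h.up
  rw [show x = x + (0:ℝ) • w by simp] at hup
  obtain ⟨ρ1, hρ1, E1⟩ := hS.seg_up hup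
  obtain ⟨ρ2, hρ2, E2⟩ := hS.seg_dn h.dn
  set ρ := min (min ρ1 ρ2) (d / 4) with hρ
  have q1 : ρ ≤ ρ1 := (min_le_left _ _).trans (min_le_left _ _)
  have q2 : ρ ≤ ρ2 := (min_le_left _ _).trans (min_le_right _ _)
  have q3 : ρ ≤ d / 4 := min_le_right _ _
  have q0 : 0 < ρ := lt_min (lt_min hρ1 hρ2) (by linarith)
  have E3 : ∀ᶠ q : 𝔼 × 𝔼 in 𝓝 (x, w), ∀ τ ∈ Icc ρ (d - ρ), v q.1 < v (q.1 + τ • q.2) := by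
    refine isCompact_Icc.eventually_forall_of_forall_eventually fun τ hτ => ?_
    have c1 : Continuous (fun p : (𝔼 × 𝔼) × ℝ => v (p.1.1 + p.2 • p.1.2)) := hS.cont.comp joint_cont
    have c2 : Continuous (fun p : (𝔼 × 𝔼) × ℝ => v p.1.1) := hS.cont.comp (by fun_prop)
    exact (isOpen_lt c2 c1).mem_nhds (h.btw τ ⟨by linarith [hτ.1], by linarith [hτ.2]⟩)
  have E4 : ∀ᶠ q : 𝔼 × 𝔼 in 𝓝 (x, w), |ψ q - d| < ρ / 2 := by
    have := Metric.tendsto_nhds.1 hψ (ρ / 2) (by linarith)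
    simpa [Real.dist_eq] using this
  have main : ∀ᶠ q : 𝔼 × 𝔼 in 𝓝 (x, w), Arc v q.2 q.1 (ψ q) ∧ ∀ τ ∈ Ioc 0 (ρ/2), v (q.1 - τ • q.2) < v q.1 ∧ v q.1 < v (q.1 + τ • q.2) ∧
        v (q.1 + (ψ q + τ) • q.2) < v q.1 := by
    filter_upwards [hev, E1, E2, E3, E4] with q r1 r2 r3 r4 r5
    rw [abs_lt] at r5
    have m1 : StrictMonoOn (fun τ : ℝ => v (q.1 + τ • q.2)) (Icc (0 - ρ1) (0 + ρ1)) :=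
      strictMono_seg (fun τ hτ => hS.line (r2 τ hτ).1) fun τ hτ => (r2 τ hτ).2
    have m2 : StrictAntiOn (fun τ : ℝ => v (q.1 + τ • q.2)) (Icc (d - ρ2) (d + ρ2)) :=
      strictAnti_seg (fun τ hτ => hS.line (r3 τ hτ).1) fun τ hτ => (r3 τ hτ).2
    refine ⟨⟨by linarith, r1, fun τ hτ => ?_, ?_, ?_⟩, fun τ hτ => ⟨?_, ?_, ?_⟩⟩
    · rcases le_total τ ρ with hl | hl
      · have := m1 (a := 0) (b := τ) ⟨by linarith, by linarith⟩ ⟨by linarith [hτ.1], by linarith⟩ hτ.1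
        simpa using this
      rcases le_total τ (d - ρ) with hl' | hl'
      · exact r4 τ ⟨hl, hl'⟩
      · have := m2 (a := τ) (b := ψ q) ⟨by linarith, by linarith [hτ.2]⟩ ⟨by linarith, by linarith⟩ hτ.2
        simp only [] at this
        rwa [r1] at this
    · have := (r2 0 ⟨by linarith, by linarith⟩).2
      simpa using this
    · exact (r3 (ψ q) ⟨by linarith, by linarith⟩).2
    · have := m1 (a := -τ) (b := 0) ⟨by linarith [hτ.2], by linarith [hτ.1]⟩ ⟨by linarith, by linarith⟩ (by linarith [hτ.1])
      simpa [sub_eq_add_neg] using this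
    · have := m1 (a := 0) (b := τ) ⟨by linarith, by linarith⟩ ⟨by linarith [hτ.1], by linarith [hτ.2]⟩ (by linarith [hτ.1])
      simpa using this
    · have := m2 (a := ψ q) (b := ψ q + τ) ⟨by linarith, by linarith⟩ ⟨by linarith [hτ.1], by linarith [hτ.2]⟩ (by linarith [hτ.1])
      simp only [] at this
      rwa [r1] at this
  have hDψ : ∀ᶠ q : 𝔼 × 𝔼 in 𝓝 (x, w), ψ q = DD v q := main.mono fun q hq => hq.1.DD_eq.symm
  refine ⟨?_, ⟨ρ / 2, by linarith, ?_⟩, L, ?_, ?_⟩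
  · filter_upwards [main, hDψ] with q a b
    rw [← b]; exact a.1
  · filter_upwards [main, hDψ] with q a b
    rw [← b]; exact a.2
  · exact hL.congr_of_eventuallyEq hDψ
  · intro a b
    have hψ0 : ψ (x, w) = d := by rw [hDψ.self_of_nhds, h.DD_eq]
    have i1 : HasFDerivAt (fun q : 𝔼 × 𝔼 => q.1 + ψ q • q.2)
        (ContinuousLinearMap.fst ℝ 𝔼 𝔼 + (ψ (x, w) • ContinuousLinearMap.snd ℝ 𝔼 𝔼 + L.smulRight w)) (x, w) :=
      hasFDerivAt_fst.add (hL.hasFDerivAt.smul hasFDerivAt_snd)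
    rw [hψ0] at i1
    have hb1' : (fun q : 𝔼 × 𝔼 => q.1 + ψ q • q.2) (x, w) ∈ ball (0:𝔼) R := by
      simp only []; rw [hψ0]; exact hb1
    have i2 := (hS.strict hb1').hasFDerivAt.comp (x, w) i1
    have i3 : HasFDerivAt (fun q : 𝔼 × 𝔼 => v q.1) (fderiv ℝ v x ∘L ContinuousLinearMap.fst ℝ 𝔼 𝔼) (x, w) :=
      HasFDerivAt.comp (g := v) (x, w) (hS.strict hb0).hasFDerivAt hasFDerivAt_fst
    have i4 := i3.congr_of_eventuallyEq hev
    have := congrArg (fun T => T (a, b)) (i2.unique i4)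
    simp only [ContinuousLinearMap.comp_apply, ContinuousLinearMap.add_apply, ContinuousLinearMap.smul_apply,
      ContinuousLinearMap.smulRight_apply, ContinuousLinearMap.coe_fst', ContinuousLinearMap.coe_snd', hψ0] at this
    rw [← this, add_assoc]
end
end CS
end

section
open Set Metric MeasureTheory Bornology Filter Topology
open scoped RealInnerProductSpace Classical NNReal

namespace CS
set_option linter.unusedSectionVars false
set_option linter.unusedVariables false

section
variable {N : ℕ} {g : ℝ → ℝ} {f : ℝ → ℝ → ℝ} {K : ℝ≥0} {R M : ℝ} {v : EuclideanSpace ℝ (Fin N) → ℝ}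
local notation "𝔼" => EuclideanSpace ℝ (Fin N)

lemma vt_val (hS : Sol R K M g f v) {e x : 𝔼} (he : ‖e‖ = 1) {d r0 s t m : ℝ} (hA : Arc v e x d)
    (hgap : ∀ τ ∈ Ioc 0 r0, v (x - τ • e) < v x ∧ v x < v (x + τ • e) ∧ v (x + (d + τ) • e) < v x)
    (hm : m = ⟪x, e⟫ + d / 2) (ht : 0 ≤ t) (htr : t < r0) (h1 : s ≤ m) (h2 : m ≤ s + t) :
    vt s t e v (x + (s - m) • e) = v x := by
  have hd := hA.dpos
  set a := ⟪x, e⟫ with ha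
  have hphi : phi s t m = s := by
    unfold phi; rw [max_eq_right (by linarith), min_eq_right h1]
  have hx : ∀ ρ : ℝ, pr e x + ρ • e = x + (ρ - a) • e := by
    intro ρ; unfold pr; rw [sub_smul]; abel
  have hX : x + (s - m) • e = pr e x + (a + s - m) • e := by rw [hx]; congr 2; ring
  have hin : ⟪x + (s - m) • e, e⟫ = a + s - m := by
    rw [hX, inner_pr_add he]
  have hpr : pr e (x + (s - m) • e) = pr e x := by rw [hX, pr_pr_add he]
  have hmem : ∀ A : Set 𝔼, x + (s - m) • e ∈ SS s t e A ↔ a + s - m ∈ S s t {ρ | x + (ρ - a) • e ∈ A} := by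
    intro A
    show ⟪x + (s - m) • e, e⟫ ∈ S s t (sl e A (x + (s - m) • e)) ↔ _
    rw [hin]
    unfold sl
    rw [hpr]
    simp only [hx]
  have c1 : Continuous fun ρ : ℝ => v (x + (ρ - a) • e) := hS.cont.comp (by fun_prop)
  apply le_antisymm
  · by_contra hlt
    push Not at hlt
    rw [lt_vt hS.adm ht he (hS.adm.nn x), hmem] at hlt
    have hl : 0 < d / 2 := by linarith
    have := S_isol (s := s) (q := a - r0) (m := m) (l := d / 2) (p := a + d + r0) ht hl
      (A := {ρ | x + (ρ - a) • e ∈ {y | v x < v y}}) ?_ (by linarith) (by linarith) _ hlt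
    · rw [hphi] at this
      rcases this with h | h | h
      · linarith
      · rw [show a + s - m - s = -(d/2) by rw [hm]; ring, abs_neg, abs_of_pos hl] at h; exact lt_irrefl _ h
      · linarith
    · intro ρ hρ
      have hρ' : v x < v (x + (ρ - a) • e) := hρ
      by_contra hcon
      push Not at hcon
      obtain ⟨k1, k2, k3⟩ := hcon
      rcases le_or_gt ρ a with h | h
      · rcases h.lt_or_eq with h | h
        · have := (hgap (a - ρ) ⟨by linarith, by linarith⟩).1
          rw [show x - (a - ρ) • e = x + (ρ - a) • e by rw [sub_smul, sub_smul]; abel] at this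
          linarith
        · rw [h] at hρ'; simp at hρ'
      rcases lt_or_ge ρ (a + d) with h' | h'
      · have : |ρ - m| < d / 2 := by rw [abs_lt]; constructor <;> linarith
        linarith
      · rcases h'.lt_or_eq with h' | h'
        · have := (hgap (ρ - (a + d)) ⟨by linarith, by linarith⟩).2.2
          rw [show d + (ρ - (a + d)) = ρ - a by ring] at this
          linarith
        · rw [← h', show a + d - a = d by ring, hA.ret] at hρ'; exact lt_irrefl _ hρ'
  · by_contra hlt
    push Not at hlt
    set l := vt s t e v (x + (s - m) • e) with hl
    have hl0 : 0 ≤ l := vt_nonneg _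
    have hno : ¬ (l < vt s t e v (x + (s - m) • e)) := by rw [← hl]; exact lt_irrefl _
    apply hno
    rw [lt_vt hS.adm ht he hl0, hmem]
    have o1 : IsOpen {ρ : ℝ | l < v (x + (ρ - a) • e)} := isOpen_lt continuous_const c1
    have ma : a ∈ {ρ : ℝ | l < v (x + (ρ - a) • e)} := by
      show l < v (x + (a - a) • e); rw [sub_self, zero_smul, add_zero]; exact hlt
    have mb : a + d ∈ {ρ : ℝ | l < v (x + (ρ - a) • e)} := by
      show l < v (x + (a + d - a) • e); rw [add_sub_cancel_left, hA.ret]; exact hlt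
    obtain ⟨ε1, hε1, b1⟩ := Metric.isOpen_iff.1 o1 _ ma
    obtain ⟨ε2, hε2, b2⟩ := Metric.isOpen_iff.1 o1 _ mb
    set ε := min ε1 ε2
    have hε : 0 < ε := lt_min hε1 hε2
    refine S_interval (m := m) (l := d / 2 + ε) (fun y hy => ?_) ?_
    · show l < v (x + (y - a) • e)
      rw [abs_lt] at hy
      rcases le_or_gt y a with h | h
      · exact b1 (by rw [mem_ball, Real.dist_eq, abs_lt]; constructor <;> linarith [min_le_left ε1 ε2])
      rcases lt_or_ge y (a + d) with h' | h'
      · exact hlt.trans (hA.btw _ ⟨by linarith, by linarith⟩)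
      · exact b2 (by rw [mem_ball, Real.dist_eq, abs_lt]; constructor <;> linarith [min_le_right ε1 ε2])
    · rw [hphi, show a + s - m - s = -(d/2) by rw [hm]; ring, abs_neg, abs_of_pos (by linarith)]; linarith

/-- midpoint function -/
noncomputable def mm (v : EuclideanSpace ℝ (Fin N) → ℝ) (e x : EuclideanSpace ℝ (Fin N)) : ℝ :=
  ⟪x, e⟫ + DD v (x, e) / 2

/-- derivative of the midpoint function -/
noncomputable def mD (v : EuclideanSpace ℝ (Fin N) → ℝ) (e x h : EuclideanSpace ℝ (Fin N)) : ℝ :=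
  ⟪h, e⟫ + (fderiv ℝ v x h - fderiv ℝ v (x + DD v (x, e) • e) h) / fderiv ℝ v (x + DD v (x, e) • e) e / 2

lemma mm_deriv (hS : Sol R K M g f v) {e x : 𝔼} {d : ℝ} (hA : Arc v e x d) :
    ∃ L : 𝔼 →L[ℝ] ℝ, HasFDerivAt (mm v e) L x ∧ ∀ h, L h = mD v e x h := by
  obtain ⟨L, hL, hL2⟩ := (hS.arc_near hA).2.2
  have i1 : HasFDerivAt (fun x : 𝔼 => (x, e)) (ContinuousLinearMap.inl ℝ 𝔼 𝔼) x := hasFDerivAt_prodMk_left x e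
  have i2 : HasFDerivAt (fun x : 𝔼 => DD v (x, e)) (L ∘L ContinuousLinearMap.inl ℝ 𝔼 𝔼) x :=
    HasFDerivAt.comp (g := DD v) x hL.hasFDerivAt i1
  have i3 : HasFDerivAt (fun x : 𝔼 => ⟪x, e⟫) (innerSL ℝ e) x := by
    refine (innerSL ℝ e).hasFDerivAt.congr_of_eventuallyEq (.of_forall fun y => ?_)
    simp [real_inner_comm]
  have i4 : HasFDerivAt (mm v e) (innerSL ℝ e + (2:ℝ)⁻¹ • (L ∘L ContinuousLinearMap.inl ℝ 𝔼 𝔼)) x := by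
    refine (i3.add (i2.const_smul (2:ℝ)⁻¹)).congr_of_eventuallyEq (.of_forall fun y => ?_)
    simp only [mm, Pi.add_apply, Pi.smul_apply, smul_eq_mul]; ring
  refine ⟨_, i4, fun h => ?_⟩
  have := hL2 h 0
  rw [smul_zero, add_zero, map_add, map_smul, smul_eq_mul] at this
  have hne := hA.dn.ne
  have e1 : (fderiv ℝ v x h - fderiv ℝ v (x + d • e) h) / fderiv ℝ v (x + d • e) e = L (h, 0) := by
    rw [← this]; field_simp; ring
  unfold mD
  rw [hA.DD_eq, e1]
  simp [div_eq_mul_inv, mul_comm, real_inner_comm]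

lemma DD_cont (hS : Sol R K M g f v) {e x : 𝔼} {d : ℝ} (hA : Arc v e x d) :
    ContinuousAt (fun x => DD v (x, e)) x := by
  obtain ⟨L, hL, hL2⟩ := (hS.arc_near hA).2.2
  have h1 : ContinuousAt (fun x : 𝔼 => (x, e)) x := by fun_prop
  exact ContinuousAt.comp (g := DD v) (f := fun x : 𝔼 => (x, e)) hL.hasFDerivAt.continuousAt h1

lemma fdbar_cont (hS : Sol R K M g f v) {e x : 𝔼} {d : ℝ} (hA : Arc v e x d) (h : 𝔼) :
    ContinuousAt (fun x => fderiv ℝ v (x + DD v (x, e) • e) h) x := by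
  have h1 := DD_cont hS hA
  have h2 : ContinuousAt (fun x => x + DD v (x, e) • e) x := by fun_prop
  have hb : (fun x => x + DD v (x, e) • e) x ∈ ball (0:𝔼) R := by
    simp only []; rw [hA.DD_eq]; exact hS.mem_of_fd hA.dn.ne
  have h3 : ContinuousAt (fun x => fderiv ℝ v (x + DD v (x, e) • e)) x :=
    ContinuousAt.comp (g := fderiv ℝ v) (f := fun x => x + DD v (x, e) • e) (hS.contDv hb) h2
  exact h3.clm_apply continuousAt_const

lemma mD_cont (hS : Sol R K M g f v) {e x : 𝔼} {d : ℝ} (hA : Arc v e x d) (h : 𝔼) :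
    ContinuousAt (fun x => mD v e x h) x := by
  unfold mD
  have h0 : ContinuousAt (fun x => fderiv ℝ v x h) x :=
    (hS.contDv (hS.mem_of_fd hA.up.ne')).clm_apply continuousAt_const
  have hne : fderiv ℝ v (x + DD v (x, e) • e) e ≠ 0 := by rw [hA.DD_eq]; exact hA.dn.ne
  exact continuousAt_const.add (((h0.sub (fdbar_cont hS hA h)).div (fdbar_cont hS hA e) hne).div_const 2)
end
end CS
end

section
open Set Metric MeasureTheory Bornology Filter Topology
open scoped RealInnerProductSpace Classical NNReal

namespace CS
set_option linter.unusedSectionVars false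
set_option linter.unusedVariables false

section
variable {N : ℕ} {g : ℝ → ℝ} {f : ℝ → ℝ → ℝ} {K : ℝ≥0} {R M : ℝ} {v : EuclideanSpace ℝ (Fin N) → ℝ}
local notation "𝔼" => EuclideanSpace ℝ (Fin N)

/-- pointwise hypotheses used near the base point -/
structure Nice (v : EuclideanSpace ℝ (Fin N) → ℝ) (R : ℝ) (e x0 h0 : EuclideanSpace ℝ (Fin N)) (ρ c C μ κ m0 : ℝ)
    (x : EuclideanSpace ℝ (Fin N)) : Prop where
  arc : Arc v e x (DD v (x, e))
  gap : ∀ τ ∈ Ioc 0 ρ, v (x - τ • e) < v x ∧ v x < v (x + τ • e) ∧ v (x + (DD v (x, e) + τ) • e) < v x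
  fe : c < fderiv ℝ v x e
  me : |1 - mD v e x e| < C
  mh : μ < |mD v e x h0|
  osc : |fderiv ℝ v x h0 - fderiv ℝ v x0 h0| < κ * ‖h0‖ / 2
  ml : m0 / 2 < mm v e x
  mu : mm v e x < m0 + 1

lemma good_point (hS : Sol R K M g f v) {e x0 h0 : 𝔼} (he : ‖e‖ = 1) {ρ c C μ κ m0 r : ℝ}
    (hc : 0 < c) (hC : 0 < C) (hμ : 0 < μ) (hκ : 2 * κ * ‖h0‖ = μ * c / C) (hh0 : 0 < ‖h0‖)
    (hP : ∀ x ∈ ball x0 (2 * r), Nice v R e x0 h0 ρ c C μ κ m0 x) {t : ℝ} (ht : 0 < t) (htr : t < r) (htρ : t < ρ)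
    {X : 𝔼} (hX : X ∈ ball x0 r) {s : ℝ} (h1 : mm v e (X + t • e) - t < s) (h2 : s < mm v e X)
    (hd : DifferentiableAt ℝ (vt s t e v) X) : κ ≤ ‖gradient (vt s t e v) X - gradient v X‖ := by
  have hmem : ∀ τ ∈ Icc 0 t, X + τ • e ∈ ball x0 (2 * r) := by
    intro τ hτ
    rw [mem_ball, dist_eq_norm] at hX ⊢
    calc ‖X + τ • e - x0‖ = ‖(X - x0) + τ • e‖ := by congr 1; abel
      _ ≤ ‖X - x0‖ + ‖τ • e‖ := norm_add_le _ _
      _ < r + r := by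
        rw [norm_smul, he, mul_one, Real.norm_eq_abs, abs_of_nonneg hτ.1]; linarith [hτ.2]
      _ = 2 * r := by ring
  have hmc : ContinuousOn (mm v e) (ball x0 (2 * r)) := fun x hx => by
    obtain ⟨L, hL, _⟩ := mm_deriv hS (hP x hx).arc
    exact hL.continuousAt.continuousWithinAt
  have hc1 : ContinuousOn (fun τ : ℝ => mm v e (X + τ • e) - τ) (Icc 0 t) := by
    have : ContinuousOn (fun τ : ℝ => X + τ • e) (Icc 0 t) := by fun_prop
    exact (hmc.comp this hmem).sub continuousOn_id
  obtain ⟨τ, hτ, hτs⟩ := intermediate_value_Ioo' ht.le hc1 (show s ∈ Ioo _ _ from ⟨h1, by simpa using h2⟩)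
  simp only [] at hτs
  set x := X + τ • e with hx
  have hxm : x ∈ ball x0 (2 * r) := hmem τ ⟨hτ.1.le, hτ.2.le⟩
  have hn := hP x hxm
  have e1 : x + (s - mm v e x) • e = X := by
    rw [show s - mm v e x = -τ by linarith, hx, neg_smul]; abel
  obtain ⟨L, hL, hLm⟩ := mm_deriv hS hn.arc
  have ev : ∀ᶠ y in 𝓝 x, vt s t e v (y + (s - mm v e y) • e) = v y := by
    have a1 : ∀ᶠ y in 𝓝 x, s < mm v e y := hL.continuousAt.eventually (lt_mem_nhds (by linarith [hτ.1]))
    have a2 : ∀ᶠ y in 𝓝 x, mm v e y < s + t := hL.continuousAt.eventually (gt_mem_nhds (by linarith [hτ.2]))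
    filter_upwards [a1, a2, isOpen_ball.mem_nhds hxm] with y b1 b2 b3
    exact vt_val hS he (hP y b3).arc (hP y b3).gap rfl ht.le htρ b1.le b2.le
  have i1 : HasFDerivAt (fun y => y + (s - mm v e y) • e) (ContinuousLinearMap.id ℝ 𝔼 + (-L).smulRight e) x :=
    (hasFDerivAt_id x).add ((hL.const_sub s).smul_const e)
  have hd' : HasFDerivAt (vt s t e v) (fderiv ℝ (vt s t e v) X) ((fun y => y + (s - mm v e y) • e) x) := by
    simp only []; rw [e1]; exact hd.hasFDerivAt
  have i2 := HasFDerivAt.comp (g := vt s t e v) x hd' i1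
  have i3 : HasFDerivAt v (fderiv ℝ v x) x := (hS.strict (hS.mem_of_fd hn.arc.up.ne')).hasFDerivAt
  have i4 := i2.unique (i3.congr_of_eventuallyEq ev)
  set W := fderiv ℝ (vt s t e v) X with hW
  have key : ∀ h, W h - mD v e x h * W e = fderiv ℝ v x h := by
    intro h
    rw [← i4]
    simp [hLm, sub_eq_add_neg]
  have k1 : c < |W e| * C := by
    have := key e
    calc c < fderiv ℝ v x e := hn.fe
      _ = W e * (1 - mD v e x e) := by rw [← this]; ring
      _ ≤ |W e * (1 - mD v e x e)| := le_abs_self _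
      _ = |W e| * |1 - mD v e x e| := abs_mul _ _
      _ ≤ |W e| * C := by gcongr; exact hn.me.le
  have k2 : c / C ≤ |W e| := by rw [div_le_iff₀ hC]; exact k1.le
  have k3 : 2 * κ * ‖h0‖ ≤ |W h0 - fderiv ℝ v x h0| := by
    rw [← key h0, hκ, show W h0 - (W h0 - mD v e x h0 * W e) = mD v e x h0 * W e by ring, abs_mul, mul_div_assoc]
    have := hn.mh.le
    gcongr
  have o1 := hn.osc
  have o2 := (hP X (by simpa using hmem 0 ⟨le_rfl, ht.le⟩)).osc
  have k4 : κ * ‖h0‖ ≤ |W h0 - fderiv ℝ v X h0| := by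
    have t1 := abs_sub_le (W h0) (fderiv ℝ v X h0) (fderiv ℝ v x h0)
    have t2 := abs_sub_le (fderiv ℝ v X h0) (fderiv ℝ v x0 h0) (fderiv ℝ v x h0)
    rw [abs_sub_comm (fderiv ℝ v x0 h0)] at t2
    linarith
  rw [hW, fderiv_eq_inner, fderiv_eq_inner, ← inner_sub_left] at k4
  have k5 := k4.trans (abs_real_inner_le_norm _ _)
  exact le_of_mul_le_mul_right k5 hh0

lemma DD_drop (hS : Sol R K M g f v) {e x : 𝔼} {d d' t ρ : ℝ} (hA : Arc v e x d) (ht : 0 < t) (htρ : t ≤ ρ)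
    (hg : ∀ τ ∈ Ioc 0 ρ, v x < v (x + τ • e)) (hA' : Arc v e (x + t • e) d') : d' + t ≤ d := by
  by_contra hcon
  push Not at hcon
  have h0 := hg t ⟨ht, htρ⟩
  rcases le_or_gt d t with h | h
  · have := hg d ⟨hA.dpos, h.trans htρ⟩
    rw [hA.ret] at this; exact lt_irrefl _ this
  · have := hA'.btw (d - t) ⟨by linarith, by linarith⟩
    rw [show x + t • e + (d - t) • e = x + d • e by rw [sub_smul]; abel, hA.ret] at this
    linarith

lemma nice_ev (hS : Sol R K M g f v) {e x0 h0 : 𝔼} (he : ‖e‖ = 1) {d0 : ℝ} (hA : Arc v e x0 d0) (hm : 0 < mm v e x0)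
    (hh : mD v e x0 h0 ≠ 0) : ∃ ρ c C μ κ m0 r : ℝ, 0 < ρ ∧ 0 < c ∧ 0 < C ∧ 0 < μ ∧ 0 < κ ∧ 0 < m0 ∧ 0 < r ∧
      2 * κ * ‖h0‖ = μ * c / C ∧ 0 < ‖h0‖ ∧ ∀ x ∈ ball x0 (2 * r), Nice v R e x0 h0 ρ c C μ κ m0 x := by
  obtain ⟨E1, ⟨ρ, hρ, E2⟩, -⟩ := hS.arc_near hA
  have tc : ContinuousAt (fun x : 𝔼 => (x, e)) x0 := by fun_prop
  have hh0 : 0 < ‖h0‖ := by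
    rw [norm_pos_iff]; rintro rfl; apply hh; simp [mD]
  have hx0 := hS.mem_of_fd hA.up.ne'
  set c := fderiv ℝ v x0 e / 2
  set C := |1 - mD v e x0 e| + 1
  set μ := |mD v e x0 h0| / 2
  have hup := hA.up
  have hc : 0 < c := by positivity
  have hC : 0 < C := by positivity
  have hμ : 0 < μ := by positivity
  set κ := μ * c / C / (2 * ‖h0‖) with hκ
  have hκ0 : 0 < κ := by positivity
  have cf : ∀ h, ContinuousAt (fun x => fderiv ℝ v x h) x0 := fun h =>
    (hS.contDv hx0).clm_apply continuousAt_const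
  obtain ⟨L, hL, _⟩ := mm_deriv hS hA
  have ev : ∀ᶠ x in 𝓝 x0, Nice v R e x0 h0 ρ c C μ κ (mm v e x0) x := by
    have a1 := tc.eventually E1
    have a2 := tc.eventually E2
    have a3 : ∀ᶠ x in 𝓝 x0, c < fderiv ℝ v x e := (cf e).eventually (lt_mem_nhds (half_lt_self hup))
    have a4 : ∀ᶠ x in 𝓝 x0, |1 - mD v e x e| < C :=
      ((continuousAt_const.sub (mD_cont hS hA e)).abs).eventually (gt_mem_nhds (lt_add_one _))
    have a5 : ∀ᶠ x in 𝓝 x0, μ < |mD v e x h0| :=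
      (mD_cont hS hA h0).abs.eventually (lt_mem_nhds (half_lt_self (abs_pos.2 hh)))
    have a6 : ∀ᶠ x in 𝓝 x0, |fderiv ℝ v x h0 - fderiv ℝ v x0 h0| < κ * ‖h0‖ / 2 :=
      ((cf h0).sub continuousAt_const).abs.eventually (gt_mem_nhds (by
        show |fderiv ℝ v x0 h0 - fderiv ℝ v x0 h0| < κ * ‖h0‖ / 2
        rw [sub_self, abs_zero]; positivity))
    have a7 : ∀ᶠ x in 𝓝 x0, mm v e x0 / 2 < mm v e x := hL.continuousAt.eventually (lt_mem_nhds (half_lt_self hm))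
    have a8 : ∀ᶠ x in 𝓝 x0, mm v e x < mm v e x0 + 1 := hL.continuousAt.eventually (gt_mem_nhds (lt_add_one _))
    filter_upwards [a1, a2, a3, a4, a5, a6, a7, a8] with x b1 b2 b3 b4 b5 b6 b7 b8
    exact ⟨b1, b2, b3, b4, b5, b6, b7, b8⟩
  obtain ⟨r, hr, hr2⟩ := Metric.eventually_nhds_iff_ball.1 ev
  refine ⟨ρ, c, C, μ, κ, mm v e x0, r / 2, hρ, hc, hC, hμ, hκ0, hm, by positivity, ?_, hh0, fun x hx => hr2 x ?_⟩
  · rw [hκ]; field_simp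
  · rwa [show 2 * (r / 2) = r by ring] at hx

theorem symA (hS : Sol R K M g f v) {e x0 : 𝔼} (he : ‖e‖ = 1) {d0 : ℝ} (hA : Arc v e x0 d0) (hm : 0 < mm v e x0)
    (h0 : 𝔼) : mD v e x0 h0 = 0 := by
  by_contra hh
  obtain ⟨ρ, c, C, μ, κ, m0, r, hρ, hc, hC, hμ, hκ0, hm0, hr, hκ, hh0, hP⟩ := nice_ev hS he hA hm hh
  set B := ball x0 r with hB
  have hBv : 0 < volume B := measure_ball_pos volume x0 hr
  have hBf : volume B ≠ ⊤ := measure_ball_lt_top.ne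
  set b := (volume B).toReal with hb
  have hb0 : 0 < b := ENNReal.toReal_pos hBv.ne' hBf
  have hBb : volume B = ENNReal.ofReal b := (ENNReal.ofReal_toReal hBf).symm
  set η := b / (4 * (m0 + 1)) with hη
  have hη0 : 0 < η := by positivity
  obtain ⟨t0, ht0, hgain⟩ := hS.gain hκ0 hη0
  set t := min (min t0 r) (min ρ (m0 / 2)) / 2 with ht
  have hmin : 0 < min (min t0 r) (min ρ (m0 / 2)) := lt_min (lt_min ht0 hr) (lt_min hρ (by linarith))
  have q1 : min (min t0 r) (min ρ (m0 / 2)) ≤ t0 := (min_le_left _ _).trans (min_le_left _ _)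
  have q2 : min (min t0 r) (min ρ (m0 / 2)) ≤ r := (min_le_left _ _).trans (min_le_right _ _)
  have q3 : min (min t0 r) (min ρ (m0 / 2)) ≤ ρ := (min_le_right _ _).trans (min_le_left _ _)
  have q4 : min (min t0 r) (min ρ (m0 / 2)) ≤ m0 / 2 := (min_le_right _ _).trans (min_le_right _ _)
  have tpos : 0 < t := by positivity
  have hmc : ContinuousOn (mm v e) (ball x0 (2 * r)) := fun x hx => by
    obtain ⟨L, hL, _⟩ := mm_deriv hS (hP x hx).arc
    exact hL.continuousAt.continuousWithinAt
  have hB2 : ∀ X ∈ B, X ∈ ball x0 (2 * r) := fun X hX => ball_subset_ball (by linarith) hX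
  have hB3 : ∀ X ∈ B, X + t • e ∈ ball x0 (2 * r) := by
    intro X hX
    rw [hB, mem_ball, dist_eq_norm] at hX
    rw [mem_ball, dist_eq_norm]
    calc ‖X + t • e - x0‖ = ‖(X - x0) + t • e‖ := by congr 1; abel
      _ ≤ ‖X - x0‖ + ‖t • e‖ := norm_add_le _ _
      _ < r + r := by
        rw [norm_smul, he, mul_one, Real.norm_eq_abs, abs_of_nonneg tpos.le]; linarith
      _ = 2 * r := by ring
  set E : Set (ℝ × 𝔼) := {q | q.2 ∈ B ∧ mm v e (q.2 + t • e) - t < q.1 ∧ q.1 < mm v e q.2} with hE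
  have hEo : IsOpen E := by
    have c1 : ContinuousOn (fun q : ℝ × 𝔼 => mm v e q.2 - q.1) (univ ×ˢ B) :=
      (hmc.comp continuous_snd.continuousOn fun q hq => hB2 _ hq.2).sub continuous_fst.continuousOn
    have c2 : ContinuousOn (fun q : ℝ × 𝔼 => q.1 - (mm v e (q.2 + t • e) - t)) (univ ×ˢ B) := by
      have c0 : ContinuousOn (fun q : ℝ × 𝔼 => q.2 + t • e) (univ ×ˢ B) := by fun_prop
      exact continuous_fst.continuousOn.sub ((hmc.comp c0 fun q hq => hB3 _ hq.2).sub continuousOn_const)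
    have ho : IsOpen ((univ : Set ℝ) ×ˢ B) := isOpen_univ.prod isOpen_ball
    have := (c1.isOpen_inter_preimage ho (isOpen_Ioi (a := (0:ℝ)))).inter
      (c2.isOpen_inter_preimage ho (isOpen_Ioi (a := (0:ℝ))))
    convert this using 1
    ext q
    simp only [hE, mem_ofPred_eq, mem_inter_iff, mem_prod, mem_univ, true_and, mem_preimage, mem_Ioi, sub_pos]
    tauto
  have hEm := hEo.measurableSet
  -- lower bound
  have lower : volume B * ENNReal.ofReal (t / 2) ≤ (volume.prod volume) E := by
    rw [Measure.prod_apply_symm hEm]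
    calc volume B * ENNReal.ofReal (t / 2) = ∫⁻ _ in B, ENNReal.ofReal (t / 2) := by
          rw [setLIntegral_const, mul_comm]
      _ ≤ ∫⁻ X in B, volume ((fun s : ℝ => (s, X)) ⁻¹' E) := by
          refine setLIntegral_mono' measurableSet_ball fun X hX => ?_
          have hsec : (fun s : ℝ => (s, X)) ⁻¹' E = Ioo (mm v e (X + t • e) - t) (mm v e X) := by
            ext s
            constructor
            · intro h; exact h.2
            · intro h; exact ⟨hX, h⟩
          rw [hsec, Real.volume_Ioo]
          apply ENNReal.ofReal_le_ofReal
          have := DD_drop hS (hP X (hB2 X hX)).arc tpos (by linarith) (fun τ hτ => ((hP X (hB2 X hX)).gap τ hτ).2.1)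
            (hP _ (hB3 X hX)).arc
          have e1 : ⟪X + t • e, e⟫ = ⟪X, e⟫ + t := by
            rw [inner_add_left, real_inner_smul_left, real_inner_self_eq_norm_sq, he]; ring
          unfold mm
          rw [e1]; linarith
      _ ≤ ∫⁻ X, volume ((fun s : ℝ => (s, X)) ⁻¹' E) := setLIntegral_le_lintegral _ _
  have upper : (volume.prod volume) E ≤ ENNReal.ofReal (η * t) * ENNReal.ofReal (m0 + 1) := by
    rw [Measure.prod_apply hEm]
    calc ∫⁻ s, volume (Prod.mk s ⁻¹' E) ≤ ∫⁻ s, (Ioo 0 (m0 + 1)).indicator (fun _ => ENNReal.ofReal (η * t)) s := by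
          refine lintegral_mono fun s => ?_
          by_cases hs : s ∈ Ioo 0 (m0 + 1)
          · rw [indicator_of_mem hs]
            have hadm := vt_adm (s := s) (t := t) hS.adm hs.1.le tpos.le he
            have hae := hadm.lip.ae_differentiableAt (μ := (volume : Measure 𝔼))
            refine le_trans (measure_mono_ae ?_) (hgain t ⟨tpos, by linarith⟩ s hs.1.le e he)
            filter_upwards [hae] with X hX hXE
            have hXE' : X ∈ B ∧ mm v e (X + t • e) - t < s ∧ s < mm v e X := hXE
            refine ⟨hS.mem_of_fd (hP X (hB2 X hXE'.1)).arc.up.ne', ?_⟩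
            exact good_point hS he hc hC hμ hκ hh0 hP tpos (by linarith) (by linarith) hXE'.1 hXE'.2.1 hXE'.2.2 hX
          · rw [indicator_of_notMem hs]
            have : Prod.mk s ⁻¹' E = ∅ := by
              rw [eq_empty_iff_forall_notMem]
              intro X hX
              have hXE' : X ∈ B ∧ mm v e (X + t • e) - t < s ∧ s < mm v e X := hX
              apply hs
              have u1 := (hP X (hB2 X hXE'.1)).mu
              have u2 := (hP _ (hB3 X hXE'.1)).ml
              exact ⟨by linarith, by linarith⟩
            rw [this, measure_empty]
      _ = ENNReal.ofReal (η * t) * ENNReal.ofReal (m0 + 1) := by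
          rw [lintegral_indicator measurableSet_Ioo, setLIntegral_const, Real.volume_Ioo, sub_zero]
  have fin := lower.trans upper
  rw [hBb, ← ENNReal.ofReal_mul hb0.le, ← ENNReal.ofReal_mul (by positivity), ENNReal.ofReal_le_ofReal_iff (by positivity)] at fin
  have : η * t * (m0 + 1) = b * t / 4 := by rw [hη]; field_simp
  rw [this] at fin
  have := mul_pos hb0 tpos
  linarith
end
end CS
end

section
open Set Metric MeasureTheory Bornology Filter Topology
open scoped RealInnerProductSpace Classical NNReal

namespace CS
set_option linter.unusedSectionVars false
set_option linter.unusedVariables false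

section
variable {N : ℕ} {g : ℝ → ℝ} {f : ℝ → ℝ → ℝ} {K : ℝ≥0} {R M : ℝ} {v : EuclideanSpace ℝ (Fin N) → ℝ}
local notation "𝔼" => EuclideanSpace ℝ (Fin N)

lemma sym_of_mD {e x : 𝔼} (he : ‖e‖ = 1) {d : ℝ} (hA : Arc v e x d)
    (hm : ∀ h, mD v e x h = 0) (h : 𝔼) :
    fderiv ℝ v (x + d • e) h = fderiv ℝ v x h - 2 * fderiv ℝ v x e * ⟪h, e⟫ := by
  have hne := hA.dn.ne
  have h1 := hm e
  have h2 := hm h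
  unfold mD at h1 h2
  rw [hA.DD_eq] at h1 h2
  rw [real_inner_self_eq_norm_sq, he] at h1
  field_simp at h1 h2
  have h3 : fderiv ℝ v x e = - fderiv ℝ v (x + d • e) e := by linarith
  rw [h3]; linarith

theorem sym_unit (hS : Sol R K M g f v) {e x : 𝔼} (he : ‖e‖ = 1) {d : ℝ} (hA : Arc v e x d) (h : 𝔼) :
    fderiv ℝ v (x + d • e) h = fderiv ℝ v x h - 2 * fderiv ℝ v x e * ⟪h, e⟫ := by
  have step : ∀ {x : 𝔼} {d : ℝ} (hA : Arc v e x d), mm v e x ≠ 0 →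
      ∀ h, fderiv ℝ v (x + d • e) h = fderiv ℝ v x h - 2 * fderiv ℝ v x e * ⟪h, e⟫ := by
    intro x d hA hm h
    rcases hm.lt_or_gt with hm | hm
    · have hF := hA.flip
      have hm' : 0 < mm v (-e) (x + d • e) := by
        unfold mm at hm ⊢
        rw [hF.DD_eq]; rw [hA.DD_eq] at hm
        rw [inner_neg_right, inner_add_left, real_inner_smul_left, real_inner_self_eq_norm_sq, he]
        linarith
      have he' : ‖-e‖ = 1 := by rw [norm_neg, he]
      have key := sym_of_mD he' hF (symA hS he' hF hm')
      rw [show x + d • e + d • -e = x by simp] at key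
      have k1 := key e
      have k2 := key h
      rw [map_neg, inner_neg_right] at k1 k2
      rw [real_inner_self_eq_norm_sq, he] at k1
      have : fderiv ℝ v x e = - fderiv ℝ v (x + d • e) e := by linarith
      rw [this]; linarith
    · exact sym_of_mD he hA (symA hS he hA hm) h
  by_cases hz : ∀ᶠ y in 𝓝 x, mm v e y = 0
  · refine sym_of_mD he hA (fun k => ?_) h
    obtain ⟨L, hL, hL2⟩ := mm_deriv hS hA
    have : HasFDerivAt (mm v e) (0 : 𝔼 →L[ℝ] ℝ) x :=
      (hasFDerivAt_const (0:ℝ) x).congr_of_eventuallyEq hz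
    rw [← hL2, hL.unique this]; rfl
  · have hfr : ∃ᶠ y in 𝓝 x, mm v e y ≠ 0 := not_eventually.1 hz
    have tc : ContinuousAt (fun x : 𝔼 => (x, e)) x := by fun_prop
    have hev : ∀ᶠ y in 𝓝 x, Arc v e y (DD v (y, e)) := tc.eventually (hS.arc_near hA).1
    set F : 𝔼 → ℝ := fun y => fderiv ℝ v (y + DD v (y, e) • e) h - (fderiv ℝ v y h - 2 * fderiv ℝ v y e * ⟪h, e⟫)
    have cf : ∀ h, ContinuousAt (fun x => fderiv ℝ v x h) x := fun h =>
      (hS.contDv (hS.mem_of_fd hA.up.ne')).clm_apply continuousAt_const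
    have hF : ContinuousAt F x :=
      (fdbar_cont hS hA h).sub ((cf h).sub ((continuousAt_const.mul (cf e)).mul continuousAt_const))
    have hF0 : F x = 0 := by
      by_contra hne
      have := hF.eventually (isOpen_ne.mem_nhds hne)
      obtain ⟨y, hy1, hy2, hy3⟩ := (hfr.and_eventually (this.and hev)).exists
      apply hy2
      simp only [F]
      rw [step hy3 hy1 h, sub_self]
    simp only [F] at hF0
    rw [hA.DD_eq] at hF0
    linarith

theorem sym_gen (hS : Sol R K M g f v) {w x : 𝔼} {d : ℝ} (hA : Arc v w x d) (h : 𝔼) :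
    fderiv ℝ v (x + d • w) h = fderiv ℝ v x h - 2 * fderiv ℝ v x w * ⟪h, w⟫ / ‖w‖ ^ 2 := by
  have hw : w ≠ 0 := by rintro rfl; have := hA.up; simp at this
  have hn : 0 < ‖w‖ := norm_pos_iff.2 hw
  have hA' := hA.smul (inv_pos.2 hn)
  have he : ‖‖w‖⁻¹ • w‖ = 1 := by rw [norm_smul, norm_inv, norm_norm]; field_simp
  have key := sym_unit hS he hA' h
  rw [show (d / ‖w‖⁻¹) • ‖w‖⁻¹ • w = d • w by rw [smul_smul]; congr 1; field_simp] at key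
  rw [key, map_smul, real_inner_smul_right, smul_eq_mul]
  field_simp

/-- one-dimensional Sard on a line -/
lemma sard_line (hS : Sol R K M g f v) (x w : 𝔼) {a b : ℝ} (hab : a < b) :
    ∃ l ∈ Ioo a b, ∀ τ : ℝ, x + τ • w ∈ ball (0:𝔼) R → v (x + τ • w) = l → fderiv ℝ v (x + τ • w) w ≠ 0 := by
  set s : Set ℝ := {τ | x + τ • w ∈ ball (0:𝔼) R ∧ fderiv ℝ v (x + τ • w) w = 0}
  have h0 : volume ((fun τ : ℝ => v (x + τ • w)) '' s) = 0 := by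
    refine addHaar_image_eq_zero_of_det_fderivWithin_eq_zero volume (f' := fun _ => ContinuousLinearMap.toSpanSingleton ℝ (0:ℝ)) (fun τ hτ => ?_) (fun τ hτ => ?_)
    · have := hS.line hτ.1
      rw [hτ.2] at this
      exact this.hasFDerivAt.hasFDerivWithinAt
    · have : (ContinuousLinearMap.toSpanSingleton ℝ (0:ℝ) : ℝ →L[ℝ] ℝ) = 0 := by ext; simp
      show (ContinuousLinearMap.toSpanSingleton ℝ (0:ℝ) : ℝ →L[ℝ] ℝ).det = 0
      rw [this]; simp
  have hpos : 0 < volume (Ioo a b) := by simp [hab]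
  have : ¬ (Ioo a b ⊆ (fun τ : ℝ => v (x + τ • w)) '' s) := fun hsub => by
    have := measure_mono hsub (μ := volume); rw [h0] at this; exact absurd hpos (not_lt.2 this)
  obtain ⟨l, hl, hl2⟩ := not_subset.1 this
  exact ⟨l, hl, fun τ h1 h2 h3 => hl2 ⟨τ, ⟨h1, h3⟩, h2⟩⟩

/-- first hitting of a level from above -/
lemma first_hit {φ : ℝ → ℝ} (hφ : Continuous φ) {a b l : ℝ} (hab : a ≤ b) (ha : l < φ a) (hb : φ b ≤ l) :
    ∃ c ∈ Ioc a b, φ c = l ∧ ∀ τ ∈ Ico a c, l < φ τ := by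
  set s := Icc a b ∩ φ ⁻¹' Iic l
  have hs : IsCompact s := isCompact_Icc.inter_right (isClosed_Iic.preimage hφ)
  obtain ⟨c, hc, hmin⟩ := hs.exists_isLeast ⟨b, ⟨hab, le_rfl⟩, hb⟩
  have hlt : ∀ τ ∈ Ico a c, l < φ τ := fun τ hτ => by
    by_contra hcon
    push Not at hcon
    exact absurd (hmin ⟨⟨hτ.1, hτ.2.le.trans hc.1.2⟩, hcon⟩) (not_le.2 hτ.2)
  have hac : a < c := by
    rcases hc.1.1.lt_or_eq with h | h
    · exact h
    · have : φ c ≤ l := hc.2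
      rw [← h] at this; linarith
  refine ⟨c, ⟨hac, hc.1.2⟩, le_antisymm hc.2 ?_, hlt⟩
  have : c ∈ closure (Ico a c) := by rw [closure_Ico hac.ne]; exact ⟨hac.le, le_rfl⟩
  exact closure_minimal (fun τ hτ => (hlt τ hτ).le) (isClosed_Ici.preimage hφ) this

lemma deriv_nonpos_left {φ : ℝ → ℝ} {c a φ' : ℝ} (hac : a < c) (h : HasDerivAt φ φ' c) (hl : ∀ τ ∈ Ico a c, φ c ≤ φ τ) : φ' ≤ 0 := by
  by_contra hcon
  push Not at hcon
  have h1 := h.hasDerivWithinAt (s := Iio c)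
  have h2 := (hasDerivWithinAt_iff_tendsto_slope' (by simp)).1 h1
  have h3 := h2.eventually (lt_mem_nhds hcon)
  have h4 : ∀ᶠ τ in 𝓝[<] c, τ ∈ Ico a c := by
    filter_upwards [Ioo_mem_nhdsLT hac] with τ hτ using ⟨hτ.1.le, hτ.2⟩
  obtain ⟨τ, h5, h6⟩ := (h3.and h4).exists
  have h7 := hl τ h6
  rw [slope_def_field] at h5
  have : (φ τ - φ c) / (τ - c) ≤ 0 := div_nonpos_of_nonneg_of_nonpos (by linarith) (by linarith [h6.2])
  linarith

lemma far_zero (hS : Sol R K M g f v) (x : 𝔼) {w : 𝔼} (hw : w ≠ 0) : ∃ b : ℝ, 0 < b ∧ v (x + b • w) = 0 := by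
  have hn : 0 < ‖w‖ := norm_pos_iff.2 hw
  have hR := hS.hR
  refine ⟨(R + ‖x‖) / ‖w‖, by positivity, hS.adm.zero _ ?_⟩
  rw [mem_ball_zero_iff, not_lt]
  have h1 : ‖((R + ‖x‖) / ‖w‖) • w‖ = R + ‖x‖ := by
    rw [norm_smul, Real.norm_of_nonneg (by positivity)]; field_simp
  have h2 := norm_sub_le (x + ((R + ‖x‖) / ‖w‖) • w) x
  rw [add_sub_cancel_left, h1] at h2
  linarith

theorem arc_exists (hS : Sol R K M g f v) {x w : 𝔼} (hp : 0 < fderiv ℝ v x w) : ∃ d, Arc v w x d := by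
  have hw : w ≠ 0 := by rintro rfl; simp at hp
  have hvx := hS.pos_of_fd hp.ne'
  set φ : ℝ → ℝ := fun τ => v (x + τ • w) with hφd
  have hφ : Continuous φ := hS.cont.comp (by fun_prop)
  have hφ0 : φ 0 = v x := by simp [φ]
  obtain ⟨b, hb, hvb⟩ := far_zero hS x hw
  have hup : 0 < fderiv ℝ v (x + (0:ℝ) • w) w := by simpa using hp
  have hup' : fderiv ℝ v x w / 2 < fderiv ℝ v (x + (0:ℝ) • w) w := by simpa using half_lt_self hp
  -- small increasing segment with derivative > c
  have hcont := (hS.fd_joint (hS.mem_of_fd hup.ne')).eventually (lt_mem_nhds hup')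
  have tc : ContinuousAt (fun τ : ℝ => (((x, w), τ) : (𝔼 × 𝔼) × ℝ)) 0 := by fun_prop
  obtain ⟨δ0, hδ0, hδ'⟩ := Metric.eventually_nhds_iff_ball.1 (tc.eventually hcont)
  set δ := δ0 / 2 with hδ
  have hδp : 0 < δ := by positivity
  set c := fderiv ℝ v x w / 2 with hc
  have hcp : 0 < c := by positivity
  have hder : ∀ τ ∈ Icc 0 δ, c < fderiv ℝ v (x + τ • w) w := fun τ hτ => hδ' τ (by
    rw [mem_ball, Real.dist_eq, sub_zero, abs_of_nonneg hτ.1]; linarith [hτ.2])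
  have hmono : StrictMonoOn φ (Icc 0 δ) :=
    strictMono_seg (fun τ hτ => hS.line (hS.mem_of_fd (hcp.trans (hder τ hτ)).ne')) fun τ hτ => hcp.trans (hder τ hτ)
  have h0δ : v x < φ δ := by
    rw [← hφ0]; exact hmono ⟨le_rfl, hδp.le⟩ ⟨hδp.le, le_rfl⟩ hδp
  have hδb : δ < b := by
    by_contra hcon
    push Not at hcon
    have := hmono ⟨le_rfl, hδp.le⟩ ⟨hb.le, hcon⟩ hb
    rw [hφ0] at this
    have h2 : φ b = 0 := hvb
    linarith
  obtain ⟨d, hd, hd1, hd2⟩ := first_hit hφ hδb.le h0δ (by rw [show φ b = 0 from hvb]; exact hvx.le)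
  have hbtw : ∀ τ ∈ Ioo 0 d, v x < φ τ := fun τ hτ => by
    rcases le_or_gt τ δ with h | h
    · rw [← hφ0]; exact hmono ⟨le_rfl, hδp.le⟩ ⟨hτ.1.le, h⟩ hτ.1
    · exact hd2 τ ⟨h.le, hτ.2⟩
  have hdp : 0 < d := hδp.trans hd.1
  have hxb : x + d • w ∈ ball (0:𝔼) R := hS.mem_of_pos (by rw [show v (x + d • w) = v x from hd1]; exact hvx)
  refine ⟨d, hdp, hd1, hbtw, hp, ?_⟩
  by_contra hcon
  push Not at hcon
  -- near `d` the derivative exceeds `-c`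
  have hcont2 := (hS.fd_joint hxb).eventually (lt_mem_nhds (show -c < fderiv ℝ v (x + d • w) w by linarith))
  have tc2 : ContinuousAt (fun τ : ℝ => (((x, w), τ) : (𝔼 × 𝔼) × ℝ)) d := by fun_prop
  obtain ⟨ε0, hε0, hε'⟩ := Metric.eventually_nhds_iff_ball.1 (tc2.eventually hcont2)
  set ε := min (ε0 / 2) ((d - δ) / 2) with hε
  have hεp : 0 < ε := lt_min (by positivity) (by linarith [hd.1])
  have hε1 : ε ≤ ε0 / 2 := min_le_left _ _
  have hε2 : ε ≤ (d - δ) / 2 := min_le_right _ _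
  obtain ⟨y, hy, hymin⟩ := (isCompact_Icc (a := δ) (b := d - ε)).exists_isMinOn ⟨δ, le_rfl, by linarith⟩ hφ.continuousOn
  have hyv : v x < φ y := hd2 y ⟨hy.1, by linarith [hy.2]⟩
  obtain ⟨l, hl, hreg⟩ := sard_line hS x w hyv
  have hl1 : l < φ δ := hl.2.trans_le (hymin ⟨le_rfl, by linarith⟩)
  -- start point
  obtain ⟨a, ha, hal⟩ := intermediate_value_Ioo hδp.le hφ.continuousOn (show l ∈ Ioo (φ 0) (φ δ) from ⟨by rw [hφ0]; exact hl.1, hl1⟩)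
  obtain ⟨d', hd', hd1', hd2'⟩ := first_hit hφ hd.1.le hl1 (by rw [hd1]; exact hl.1.le)
  have hd'ε : d - ε < d' := by
    by_contra h
    push Not at h
    have := hymin (show d' ∈ Icc δ (d - ε) from ⟨hd'.1.le, h⟩)
    have h2 : φ y ≤ φ d' := this
    rw [hd1'] at h2; linarith [hl.2]
  have hlpos : 0 < l := hvx.trans hl.1
  have hb' : x + d' • w ∈ ball (0:𝔼) R := hS.mem_of_pos (by rw [show v (x + d' • w) = l from hd1']; exact hlpos)
  have hne := hreg d' hb' hd1'
  have hle : fderiv ℝ v (x + d' • w) w ≤ 0 :=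
    deriv_nonpos_left hd'.1 (hS.line hb') fun τ hτ => by
      show φ d' ≤ φ τ
      rw [hd1']; exact (hd2' τ hτ).le
  have hadd : ∀ τ : ℝ, x + a • w + τ • w = x + (a + τ) • w := fun τ => by rw [add_smul]; abel
  have hA : Arc v w (x + a • w) (d' - a) := by
    refine ⟨by linarith [ha.2, hd'.1], ?_, fun τ hτ => ?_, ?_, ?_⟩
    · rw [hadd, add_sub_cancel]; exact hd1'.trans hal.symm
    · rw [hadd]
      show φ a < φ (a + τ)
      rcases le_or_gt (a + τ) δ with h | h
      · exact hmono ⟨ha.1.le, ha.2.le⟩ ⟨by linarith [hτ.1, ha.1], h⟩ (by linarith [hτ.1])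
      · rw [hal]; exact hd2' _ ⟨h.le, by linarith [hτ.2]⟩
    · exact hcp.trans (hder a ⟨ha.1.le, ha.2.le⟩)
    · rw [hadd, add_sub_cancel]; exact lt_of_le_of_ne hle hne
  have hsym := sym_gen hS hA w
  rw [hadd, add_sub_cancel, real_inner_self_eq_norm_sq] at hsym
  have hn : 0 < ‖w‖ := norm_pos_iff.2 hw
  have h1 : fderiv ℝ v (x + d' • w) w = - fderiv ℝ v (x + a • w) w := by
    rw [hsym]; field_simp; ring
  have h2 : -c < fderiv ℝ v (x + d' • w) w := hε' d' (by
    rw [mem_ball, Real.dist_eq, abs_lt]; constructor <;> linarith [hd'.2])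
  have h3 := hder a ⟨ha.1.le, ha.2.le⟩
  linarith
end
end CS
end

section
open Set Metric MeasureTheory Bornology Filter Topology
open scoped RealInnerProductSpace Classical NNReal

namespace CS
set_option linter.unusedSectionVars false
set_option linter.unusedVariables false

section
variable {N : ℕ} {g : ℝ → ℝ} {f : ℝ → ℝ → ℝ} {K : ℝ≥0} {R M : ℝ} {v : EuclideanSpace ℝ (Fin N) → ℝ}
local notation "𝔼" => EuclideanSpace ℝ (Fin N)

/-- sphere radius parameter -/
noncomputable def CC (v : EuclideanSpace ℝ (Fin N) → ℝ) (x : EuclideanSpace ℝ (Fin N)) : ℝ :=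
  DD v (x, gradient v x)

/-- sphere center -/
noncomputable def ZZ (v : EuclideanSpace ℝ (Fin N) → ℝ) (x : EuclideanSpace ℝ (Fin N)) : EuclideanSpace ℝ (Fin N) :=
  x + (CC v x / 2) • gradient v x

lemma arc_half (hS : Sol R K M g f v) {x : 𝔼} {w : 𝔼} (hw : 0 < ⟪gradient v x, w⟫) :
    Arc v w x (DD v (x, w)) := by
  rw [← fderiv_eq_inner] at hw
  obtain ⟨d, hd⟩ := arc_exists hS hw
  rw [hd.DD_eq]; exact hd

lemma hasFD_inner (p w : 𝔼) : HasFDerivAt (fun w : 𝔼 => ⟪p, w⟫) (innerSL ℝ p) w :=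
  (innerSL ℝ p).hasFDerivAt

lemma DF_zero (hS : Sol R K M g f v) {x w : 𝔼} (hw : 0 < ⟪gradient v x, w⟫) :
    HasFDerivAt (fun w => DD v (x, w) * (⟪w, w⟫ * ⟪gradient v x, w⟫⁻¹)) (0 : 𝔼 →L[ℝ] ℝ) w := by
  set p := gradient v x with hp
  have hA := arc_half hS hw
  set d := DD v (x, w) with hd
  obtain ⟨L, hL, hL2⟩ := (hS.arc_near hA).2.2
  have i1 : HasFDerivAt (fun w : 𝔼 => (x, w)) (ContinuousLinearMap.inr ℝ 𝔼 𝔼) w := hasFDerivAt_prodMk_right x w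
  have i2 : HasFDerivAt (fun w : 𝔼 => DD v (x, w)) (L ∘L ContinuousLinearMap.inr ℝ 𝔼 𝔼) w :=
    HasFDerivAt.comp (g := DD v) w hL.hasFDerivAt i1
  have hq : HasFDerivAt (fun w : 𝔼 => ⟪p, w⟫⁻¹) (-(⟪p, w⟫ ^ 2)⁻¹ • innerSL ℝ p) w :=
    (hasDerivAt_inv hw.ne').comp_hasFDerivAt w (hasFD_inner p w)
  have hn : HasFDerivAt (fun w : 𝔼 => ⟪w, w⟫) ((2:ℝ) • innerSL ℝ w) w := by
    have := (hasFDerivAt_id w).inner ℝ (hasFDerivAt_id w)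
    refine this.congr_fderiv ?_
    ext k; simp [real_inner_comm]; ring
  refine (i2.mul (hn.mul hq)).congr_fderiv ?_
  ext k
  have hw0 : w ≠ 0 := by rintro rfl; simp at hw
  have hN : (0:ℝ) < ‖w‖ ^ 2 := by have := norm_pos_iff.2 hw0; positivity
  have hk := hL2 0 k
  rw [zero_add, map_zero, map_add, map_smul, map_smul, sym_gen hS hA, sym_gen hS hA, fderiv_eq_inner, fderiv_eq_inner,
    ← hp, real_inner_self_eq_norm_sq, smul_eq_mul, smul_eq_mul] at hk
  simp only [_root_.add_apply, _root_.smul_apply, Pi.mul_apply, ContinuousLinearMap.comp_apply,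
    ContinuousLinearMap.inr_apply, innerSL_apply_apply, smul_eq_mul, _root_.zero_apply]
  rw [real_inner_self_eq_norm_sq, ← hd]
  rw [real_inner_comm w k] at hk
  have hkk : L (0, k) = d * (⟪p, k⟫ / ⟪p, w⟫ - 2 * ⟪w, k⟫ / ‖w‖ ^ 2) := by
    field_simp at hk ⊢
    nlinarith [hk]
  rw [hkk]
  field_simp
  ring

lemma DD_formula (hS : Sol R K M g f v) {x w : 𝔼} (hw : 0 < ⟪gradient v x, w⟫) :
    DD v (x, w) = CC v x * ⟪gradient v x, w⟫ / ‖w‖ ^ 2 := by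
  set p := gradient v x with hp
  have hp0 : p ≠ 0 := by rintro h; rw [h] at hw; simp at hw
  have hpp : 0 < ⟪p, p⟫ := by rw [real_inner_self_eq_norm_sq]; have := norm_pos_iff.2 hp0; positivity
  have ho : IsOpen {w : 𝔼 | 0 < ⟪p, w⟫} := isOpen_lt continuous_const (by fun_prop)
  have hc : Convex ℝ {w : 𝔼 | 0 < ⟪p, w⟫} := convex_halfSpace_gt (innerSL ℝ p).toLinearMap.isLinear 0
  have := ho.is_const_of_fderiv_eq_zero (𝕜 := ℝ) hc.isPreconnected
    (f := fun w => DD v (x, w) * (⟪w, w⟫ * ⟪p, w⟫⁻¹))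
    (fun w hw => (DF_zero hS hw).differentiableAt.differentiableWithinAt)
    (fun w hw => (DF_zero hS hw).fderiv) (x := w) (y := p) hw hpp
  have hw0 : w ≠ 0 := by rintro rfl; simp at hw
  have hN : (0:ℝ) < ‖w‖ := norm_pos_iff.2 hw0
  rw [mul_inv_cancel₀ hpp.ne', mul_one, real_inner_self_eq_norm_sq] at this
  unfold CC
  rw [← hp, ← this]
  field_simp

lemma CC_pos (hS : Sol R K M g f v) {x : 𝔼} (hx : gradient v x ≠ 0) : 0 < CC v x := by
  have hpp : 0 < ⟪gradient v x, gradient v x⟫ := by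
    rw [real_inner_self_eq_norm_sq]; have := norm_pos_iff.2 hx; positivity
  exact (arc_half hS hpp).dpos

/-- the sphere through a regular point -/
theorem sphere_thm (hS : Sol R K M g f v) {x : 𝔼} (hx : gradient v x ≠ 0) :
    dist x (ZZ v x) = CC v x / 2 * ‖gradient v x‖ ∧ 0 < dist x (ZZ v x) ∧
    (∀ y ∈ ball (ZZ v x) (dist x (ZZ v x)), v x < v y) ∧
    ∀ y ∈ sphere (ZZ v x) (dist x (ZZ v x)), v y = v x ∧ gradient v y = (2 / CC v x) • (ZZ v x - y) := by
  set p := gradient v x with hp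
  set C := CC v x with hC
  have hCp : 0 < C := CC_pos hS hx
  have hn : 0 < ‖p‖ := norm_pos_iff.2 hx
  have hd : dist x (ZZ v x) = C / 2 * ‖p‖ := by
    unfold ZZ; rw [← hp, ← hC, dist_self_add_right, norm_smul, Real.norm_of_nonneg (by positivity)]
  have hz : ∀ y : 𝔼, ‖y - ZZ v x‖ ^ 2 = ‖y - x‖ ^ 2 - C * ⟪p, y - x⟫ + (C / 2 * ‖p‖) ^ 2 := by
    intro y
    have : y - ZZ v x = (y - x) - (C / 2) • p := by unfold ZZ; rw [← hp, ← hC]; abel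
    rw [this, norm_sub_sq_real, norm_smul, real_inner_smul_right, Real.norm_of_nonneg (by positivity), real_inner_comm]; ring
  refine ⟨hd, by rw [hd]; positivity, fun y hy => ?_, fun y hy => ?_⟩
  · rw [mem_ball, dist_eq_norm, hd] at hy
    have h1 : ‖y - ZZ v x‖ ^ 2 < (C / 2 * ‖p‖) ^ 2 := by gcongr
    rw [hz] at h1
    have h2 : ‖y - x‖ ^ 2 < C * ⟪p, y - x⟫ := by linarith
    have h3 : 0 < ⟪p, y - x⟫ := by
      by_contra hcon; push Not at hcon
      nlinarith [sq_nonneg ‖y - x‖]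
    have hA := arc_half hS h3
    rw [DD_formula hS h3] at hA
    have h0 : y - x ≠ 0 := by intro h; rw [h] at h3; simp at h3
    have h4 : 0 < ‖y - x‖ := norm_pos_iff.2 h0
    have := hA.btw 1 ⟨one_pos, by rw [lt_div_iff₀ (by positivity), one_mul]; exact h2⟩
    simpa using this
  · rw [mem_sphere, dist_eq_norm, hd] at hy
    have h2 : ‖y - x‖ ^ 2 = C * ⟪p, y - x⟫ := by have := hz y; rw [hy] at this; linarith
    by_cases hyx : y = x
    · subst hyx
      refine ⟨rfl, ?_⟩
      unfold ZZ
      rw [← hp, ← hC, add_sub_cancel_left, smul_smul, div_mul_div_cancel₀ (by positivity), div_self (by positivity), one_smul]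
    have h4 : 0 < ‖y - x‖ := norm_pos_iff.2 (sub_ne_zero.2 hyx)
    have h3 : 0 < ⟪p, y - x⟫ := by
      by_contra hcon; push Not at hcon
      nlinarith [sq_pos_of_pos h4]
    have hA := arc_half hS h3
    rw [DD_formula hS h3, ← hp, ← hC, ← h2, div_self (by positivity)] at hA
    have hr := hA.ret
    have hs := sym_gen hS hA
    rw [one_smul, add_sub_cancel] at hr hs
    refine ⟨hr, ?_⟩
    refine ext_inner_right ℝ fun h => ?_
    rw [← fderiv_eq_inner, hs, fderiv_eq_inner, fderiv_eq_inner, ← hp]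
    have : ZZ v x - y = (C / 2) • p - (y - x) := by unfold ZZ; rw [← hp, ← hC]; abel
    rw [this, real_inner_smul_left, inner_sub_left, real_inner_smul_left, real_inner_comm h, h2, real_inner_comm h (y - x)]
    field_simp

lemma inner_ZZ_unit (hS : Sol R K M g f v) {x e : 𝔼} (he : ‖e‖ = 1) (hw : 0 < ⟪gradient v x, e⟫) :
    ⟪ZZ v x, e⟫ = mm v e x := by
  unfold mm ZZ
  rw [DD_formula hS hw, he, inner_add_left, real_inner_smul_left]; ring

lemma mD_zero (hS : Sol R K M g f v) {x e : 𝔼} (he : ‖e‖ = 1) (hw : 0 < ⟪gradient v x, e⟫) (h : 𝔼) :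
    mD v e x h = 0 := by
  have hA := arc_half hS hw
  unfold mD
  have hne := hw.ne'
  rw [sym_gen hS hA, sym_gen hS hA, he, fderiv_eq_inner, fderiv_eq_inner, real_inner_self_eq_norm_sq, he]
  have : ⟪gradient v x, e⟫ - 2 * ⟪gradient v x, e⟫ * 1 ^ 2 / 1 ^ 2 = - ⟪gradient v x, e⟫ := by ring
  rw [this]
  field_simp
  ring

lemma grad_cont (hS : Sol R K M g f v) {x : 𝔼} (hx : x ∈ ball (0:𝔼) R) : ContinuousAt (gradient v) x := by
  have := hS.contDv hx
  exact (InnerProductSpace.toDual ℝ 𝔼).symm.continuous.continuousAt.comp this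

lemma mem_of_grad (hS : Sol R K M g f v) {x : 𝔼} (hx : gradient v x ≠ 0) : x ∈ ball (0:𝔼) R := by
  by_contra h; exact hx (hS.adm.fderiv_out h)

lemma pos_of_grad (hS : Sol R K M g f v) {x : 𝔼} (hx : gradient v x ≠ 0) : 0 < v x := by
  refine hS.pos_of_fd (w := gradient v x) ?_
  rw [fderiv_eq_inner]; simpa using hx

lemma ZZ_deriv_half (hS : Sol R K M g f v) {x w : 𝔼} (hw : 0 < ⟪gradient v x, w⟫) :
    HasFDerivAt (fun x => ⟪ZZ v x, w⟫) (0 : 𝔼 →L[ℝ] ℝ) x := by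
  have hw0 : w ≠ 0 := by rintro rfl; simp at hw
  have hp0 : gradient v x ≠ 0 := by rintro h; rw [h] at hw; simp at hw
  have hN : (0:ℝ) < ‖w‖ := norm_pos_iff.2 hw0
  set e := ‖w‖⁻¹ • w with he
  have he1 : ‖e‖ = 1 := by rw [he, norm_smul, norm_inv, norm_norm]; field_simp
  have hwe : w = ‖w‖ • e := by rw [he, smul_smul, mul_inv_cancel₀ hN.ne', one_smul]
  have hpe : 0 < ⟪gradient v x, e⟫ := by rw [he, real_inner_smul_right]; positivity
  have hc : ContinuousAt (fun y => ⟪gradient v y, e⟫) x :=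
    (grad_cont hS (mem_of_grad hS hp0)).inner continuousAt_const
  have hev := hc.eventually (lt_mem_nhds hpe)
  obtain ⟨L, hL, hL2⟩ := mm_deriv hS (arc_half hS hpe)
  have hL0 : L = 0 := by ext h; rw [hL2, mD_zero hS he1 hpe]; rfl
  rw [hL0] at hL
  have h3 : HasFDerivAt (fun x => ‖w‖ • mm v e x) (‖w‖ • (0 : 𝔼 →L[ℝ] ℝ)) x := hL.const_smul ‖w‖
  rw [smul_zero] at h3
  refine h3.congr_of_eventuallyEq (hev.mono fun y hy => ?_)
  show ⟪ZZ v y, w⟫ = ‖w‖ • mm v e y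
  rw [← inner_ZZ_unit hS he1 hy, smul_eq_mul, ← real_inner_smul_right, ← hwe]

theorem ZZ_deriv (hS : Sol R K M g f v) {x : 𝔼} (hx : gradient v x ≠ 0) (w : 𝔼) :
    HasFDerivAt (fun x => ⟪ZZ v x, w⟫) (0 : 𝔼 →L[ℝ] ℝ) x := by
  set p := gradient v x with hp
  have hn : 0 < ‖p‖ := norm_pos_iff.2 hx
  set t := (|⟪p, w⟫| + 1) / ‖p‖ ^ 2 with ht
  have htp : t * ‖p‖ ^ 2 = |⟪p, w⟫| + 1 := by rw [ht]; field_simp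
  have h1 := ZZ_deriv_half hS (x := x) (w := w + t • p) (by
    rw [← hp, inner_add_right, real_inner_smul_right, real_inner_self_eq_norm_sq, htp]
    linarith [neg_abs_le ⟪p, w⟫])
  have h2 := ZZ_deriv_half hS (x := x) (w := t • p) (by
    rw [← hp, real_inner_smul_right, real_inner_self_eq_norm_sq, htp]; positivity)
  have h3 := h1.sub h2
  rw [sub_zero] at h3
  refine h3.congr_of_eventuallyEq (.of_forall fun y => ?_)
  show ⟪ZZ v y, w⟫ = ⟪ZZ v y, w + t • p⟫ - ⟪ZZ v y, t • p⟫
  rw [← inner_sub_right, add_sub_cancel_right]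
end
end CS
end

section
open Set Metric MeasureTheory Bornology Filter Topology
open scoped RealInnerProductSpace Classical NNReal

namespace CS
set_option linter.unusedSectionVars false
set_option linter.unusedVariables false
set_option linter.unusedSimpArgs false

section
variable {N : ℕ} {g : ℝ → ℝ} {f : ℝ → ℝ → ℝ} {K : ℝ≥0} {R M : ℝ} {v : EuclideanSpace ℝ (Fin N) → ℝ}
local notation "𝔼" => EuclideanSpace ℝ (Fin N)

/-- a regular level sphere -/
structure Rad (v : EuclideanSpace ℝ (Fin N) → ℝ) (z : EuclideanSpace ℝ (Fin N)) (r : ℝ) : Prop where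
  pos : 0 < r
  prop : ∃ τ c : ℝ, 0 < c ∧ (∀ y ∈ ball z r, τ < v y) ∧ ∀ y ∈ sphere z r, v y = τ ∧ gradient v y = c • (z - y)

lemma Rad.of_reg (hS : Sol R K M g f v) {x : 𝔼} (hx : gradient v x ≠ 0) : Rad v (ZZ v x) (dist x (ZZ v x)) := by
  obtain ⟨h1, h2, h3, h4⟩ := sphere_thm hS hx
  have := CC_pos hS hx
  exact ⟨h2, v x, 2 / CC v x, by positivity, h3, h4⟩

lemma Rad.reg {z y : 𝔼} {r : ℝ} (h : Rad v z r) (hy : y ∈ sphere z r) : gradient v y ≠ 0 := by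
  obtain ⟨τ, c, hc, h1, h2⟩ := h.prop
  rw [(h2 y hy).2]
  have : z - y ≠ 0 := by
    rw [← norm_pos_iff, norm_sub_rev, ← dist_eq_norm, mem_sphere.1 hy]; exact h.pos
  exact smul_ne_zero hc.ne' this

lemma Rad.ZZ_eq (hS : Sol R K M g f v) {z y : 𝔼} {r : ℝ} (h : Rad v z r) (hy : y ∈ sphere z r) : ZZ v y = z := by
  have hreg := h.reg hy
  obtain ⟨τ, c, hc, h1, h2⟩ := h.prop
  have hr := h.pos
  have hzy : ‖z - y‖ = r := by rw [norm_sub_rev, ← dist_eq_norm]; exact mem_sphere.1 hy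
  have e1 : y + (2 / c) • gradient v y = z + (z - y) := by
    rw [(h2 y hy).2, smul_smul, div_mul_cancel₀ _ hc.ne', two_smul]; abel
  have hanti : z + (z - y) ∈ sphere z r := by simp [mem_sphere, dist_eq_norm, hzy]
  have hA : Arc v (gradient v y) y (2 / c) := by
    refine ⟨by positivity, ?_, fun t ht => ?_, ?_, ?_⟩
    · rw [e1, (h2 _ hanti).1, (h2 _ hy).1]
    · rw [(h2 y hy).1]
      apply h1
      have : y + t • gradient v y = z - (1 - t * c) • (z - y) := by
        rw [(h2 y hy).2, smul_smul, sub_smul, one_smul]; abel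
      rw [this, mem_ball, dist_eq_norm, sub_sub_cancel_left, norm_neg, norm_smul, hzy, Real.norm_eq_abs]
      have ht2 : t * c < 2 := (lt_div_iff₀ hc).1 ht.2
      have ht1 : 0 < t * c := mul_pos ht.1 hc
      have : |1 - t * c| < 1 := by rw [abs_lt]; constructor <;> linarith
      nlinarith
    · rw [fderiv_eq_inner, real_inner_self_eq_norm_sq]; have := norm_pos_iff.2 hreg; positivity
    · rw [e1, fderiv_eq_inner, (h2 _ hanti).2, (h2 y hy).2, real_inner_smul_left, real_inner_smul_right,
        sub_add_cancel_left, inner_neg_left, real_inner_self_eq_norm_sq, hzy]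
      have : 0 < c * (c * r ^ 2) := by positivity
      linarith
  unfold ZZ CC
  rw [hA.DD_eq, (h2 y hy).2, smul_smul, div_div_cancel_left' (two_ne_zero), inv_mul_cancel₀ hc.ne', one_smul]
  abel

lemma sph_mem {z e : 𝔼} (he : ‖e‖ = 1) {r : ℝ} (hr : 0 ≤ r) : z + r • e ∈ sphere z r := by
  simp [mem_sphere, dist_eq_norm, norm_smul, he, abs_of_nonneg hr]

lemma Rad.of_ZZ (hS : Sol R K M g f v) {z e : 𝔼} (he : ‖e‖ = 1) {r : ℝ} (hr : 0 < r) (hx : gradient v (z + r • e) ≠ 0)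
    (hz : ZZ v (z + r • e) = z) : Rad v z r := by
  have := Rad.of_reg hS hx
  rw [hz] at this
  rwa [mem_sphere.1 (sph_mem he hr.le)] at this

lemma Rad.opn (hS : Sol R K M g f v) {z e : 𝔼} (he : ‖e‖ = 1) {r : ℝ} (h : Rad v z r) : ∀ᶠ r' in 𝓝 r, Rad v z r' := by
  have hm := sph_mem he h.pos.le (z := z)
  have hreg := h.reg hm
  have hc : ContinuousAt (fun r : ℝ => gradient v (z + r • e)) r :=
    ContinuousAt.comp (g := gradient v) (f := fun r : ℝ => z + r • e) (grad_cont hS (mem_of_grad hS hreg)) (by fun_prop)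
  have hev := (hc.eventually (isOpen_ne.mem_nhds hreg)).and (lt_mem_nhds h.pos)
  obtain ⟨ε, hε, hb⟩ := Metric.eventually_nhds_iff_ball.1 hev
  refine Metric.eventually_nhds_iff_ball.2 ⟨ε, hε, fun r' hr' => ?_⟩
  refine Rad.of_ZZ hS he (hb r' hr').2 (hb r' hr').1 ?_
  refine ext_inner_right ℝ fun w => ?_
  have hd : ∀ s ∈ ball r ε, HasDerivAt (fun s : ℝ => ⟪ZZ v (z + s • e), w⟫) 0 s := fun s hs => by
    have h1 : HasDerivAt (fun τ : ℝ => z + τ • e) e s := by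
      simpa using ((hasDerivAt_id s).smul_const e).const_add z
    exact (ZZ_deriv hS (hb s hs).1 w).comp_hasDerivAt s h1
  have := isOpen_ball.is_const_of_deriv_eq_zero (𝕜 := ℝ) (convex_ball r ε).isPreconnected
    (f := fun s : ℝ => ⟪ZZ v (z + s • e), w⟫) (fun s hs => (hd s hs).differentiableAt.differentiableWithinAt)
    (fun s hs => (hd s hs).deriv) hr' (mem_ball_self hε)
  rw [h.ZZ_eq hS hm] at this
  exact this

lemma Rad.cls (hS : Sol R K M g f v) {z e : 𝔼} (he : ‖e‖ = 1) {r : ℝ} (hr : 0 < r) {l : Filter ℝ} [l.NeBot] (hl : l ≤ 𝓝 r)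
    (h : ∀ᶠ r' in l, Rad v z r') (hreg : gradient v (z + r • e) ≠ 0) : Rad v z r := by
  refine Rad.of_ZZ hS he hr hreg (ext_inner_right ℝ fun w => ?_)
  have h1 : ContinuousAt (fun s : ℝ => ⟪ZZ v (z + s • e), w⟫) r :=
    ContinuousAt.comp (g := fun x => ⟪ZZ v x, w⟫) (f := fun r : ℝ => z + r • e) (ZZ_deriv hS hreg w).continuousAt (by fun_prop)
  have h2 := h1.tendsto.mono_left hl
  have h3 : Tendsto (fun s : ℝ => ⟪ZZ v (z + s • e), w⟫) l (𝓝 ⟪z, w⟫) := by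
    refine tendsto_const_nhds.congr' (h.mono fun s hs => ?_)
    show ⟪z, w⟫ = ⟪ZZ v (z + s • e), w⟫
    rw [hs.ZZ_eq hS (sph_mem he hs.pos.le)]
  exact tendsto_nhds_unique h2 h3

/-- radial structure on an interval of regular spheres -/
lemma Rad.val {z : EuclideanSpace ℝ (Fin N)} {r : ℝ} (h : Rad v z r) {y y' : EuclideanSpace ℝ (Fin N)} (hy : y ∈ sphere z r) (hy' : y' ∈ sphere z r) : v y = v y' := by
  obtain ⟨τ, c, hc, h1, h2⟩ := h.prop
  rw [(h2 y hy).1, (h2 y' hy').1]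

lemma Rad.lt {z y x : 𝔼} {r : ℝ} (h : Rad v z r) (hy : y ∈ sphere z r) (hx : x ∈ ball z r) : v y < v x := by
  obtain ⟨τ, c, hc, h1, h2⟩ := h.prop
  rw [(h2 y hy).1]; exact h1 x hx

lemma Rad.dlt {z e : 𝔼} (he : ‖e‖ = 1) {r : ℝ} (h : Rad v z r) : fderiv ℝ v (z + r • e) e < 0 := by
  obtain ⟨τ, c, hc, h1, h2⟩ := h.prop
  rw [fderiv_eq_inner, (h2 _ (sph_mem he h.pos.le)).2, sub_add_cancel_left, real_inner_smul_left, inner_neg_left,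
    real_inner_smul_left, real_inner_self_eq_norm_sq, he]
  have := mul_pos hc h.pos
  nlinarith

lemma Rad.grad {z y e : 𝔼} (he : ‖e‖ = 1) {r : ℝ} (h : Rad v z r) (hy : y ∈ sphere z r) :
    gradient v y = (fderiv ℝ v (z + r • e) e / r) • (y - z) := by
  obtain ⟨τ, c, hc, h1, h2⟩ := h.prop
  rw [fderiv_eq_inner, (h2 _ (sph_mem he h.pos.le)).2, sub_add_cancel_left, real_inner_smul_left, inner_neg_left,
    real_inner_smul_left, real_inner_self_eq_norm_sq, he, (h2 y hy).2]
  have := h.pos.ne'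
  rw [show c * -(r * 1 ^ 2) / r = - c by field_simp, neg_smul, ← smul_neg, neg_sub]
end
end CS
end

section
open Set Metric MeasureTheory Bornology Filter Topology
open scoped RealInnerProductSpace Classical NNReal

namespace CS
set_option linter.unusedSectionVars false
set_option linter.unusedVariables false
set_option linter.unusedSimpArgs false

section
variable {g : ℝ → ℝ}

lemma H_diff (hg : GCond g) {p q : ℝ} (hp : 0 ≤ p) (hq : 0 ≤ q) : Hfun g q - Hfun g p ≤ q * (g q - g p) := by
  have := G_conv hg hp hq
  rw [H_eq, H_eq]; linarith

lemma H_mono_aux (hg : GCond g) {p q : ℝ} (hp : 0 ≤ p) (hq : 0 ≤ q) : p * (g q - g p) ≤ Hfun g q - Hfun g p := by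
  have := G_conv hg hq hp
  rw [H_eq, H_eq]; linarith

lemma H_smono (hg : GCond g) : StrictMonoOn (Hfun g) (Ici 0) := by
  have key : ∀ p q : ℝ, 0 < p → p < q → Hfun g p < Hfun g q := fun p q hp hpq => by
    have h1 := H_mono_aux hg hp.le (hp.trans hpq).le
    have h2 := g_smono hg (mem_Ici.2 hp.le) (mem_Ici.2 (hp.trans hpq).le) hpq
    have : 0 < p * (g q - g p) := mul_pos hp (by linarith)
    linarith
  intro p hp q hq hpq
  rcases (mem_Ici.1 hp).lt_or_eq with h | h
  · exact key p q h hpq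
  · rw [← h, H_zero]
    rw [← h] at hpq
    have := key (q / 2) q (by linarith) (by linarith)
    linarith [H_nonneg hg (t := q / 2) (by linarith)]

lemma H_cont (hg : GCond g) : ContinuousOn (Hfun g) (Ici 0) := by
  have : ContinuousOn (fun t => t * g t - Gfun g t) (Ici 0) := (continuousOn_id.mul hg.1).sub (G_cont hg)
  exact this

lemma Hinv_spec (hg : GCond g) {y : ℝ} (hy : ∃ t ∈ Ici (0:ℝ), Hfun g t = y) : 0 ≤ Hinv g y ∧ Hfun g (Hinv g y) = y :=
  ⟨Function.invFunOn_mem hy, Function.invFunOn_eq hy⟩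

lemma H_range (hg : GCond g) {y : ℝ} (h0 : 0 ≤ y) (h1 : y ≤ Hfun g 1) : ∃ t ∈ Ici (0:ℝ), Hfun g t = y := by
  have := intermediate_value_Icc (zero_le_one) ((H_cont hg).mono (fun t (ht : t ∈ Icc (0:ℝ) 1) => mem_Ici.2 ht.1))
  rw [H_zero] at this
  obtain ⟨t, ht, h⟩ := this ⟨h0, h1⟩
  exact ⟨t, ht.1, h⟩

theorem ode_contra (hg : GCond g) {φ : ℝ → ℝ} (hφ : MemAg g φ) {V w : ℝ → ℝ} {a b : ℝ} (hab : a < b)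
    (hVa : V a = 0) (hwa : w a = 0) (hV : ∀ r ∈ Icc a b, HasDerivAt V (w r) r)
    (hwc : ContinuousOn w (Icc a b)) (hwp : ∀ r ∈ Ioc a b, 0 < w r)
    (hineq : ∀ s t, a ≤ s → s < t → t ≤ b → g (w t) - g (w s) ≤ ∫ r in s..t, φ (V r)) : False := by
  obtain ⟨hφc, hφ0, hφz, hφA⟩ := hφ
  set φ' : ℝ → ℝ := fun t => φ (max t 0) with hφ'
  have hφ'c : Continuous φ' := hφc.comp_continuous (by fun_prop) fun t => mem_Ici.2 (le_max_right _ _)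
  set Φ : ℝ → ℝ := fun t => ∫ s in (0:ℝ)..t, φ' s with hΦ
  have hΦd : ∀ t, HasDerivAt Φ (φ' t) t := fun t => hφ'c.integral_hasStrictDerivAt 0 t |>.hasDerivAt
  have hφ'0 : ∀ t, 0 ≤ φ' t := fun t => hφ0 _ (le_max_right _ _)
  have hΦm : Monotone Φ := monotone_of_deriv_nonneg (fun t => (hΦd t).differentiableAt)
    (fun t => by rw [(hΦd t).deriv]; exact hφ'0 t)
  have hΦ0 : Φ 0 = 0 := by simp [hΦ]
  have hΦeq : ∀ t, 0 ≤ t → (∫ s in (0:ℝ)..t, φ s) = Φ t := fun t ht => by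
    refine intervalIntegral.integral_congr fun s hs => ?_
    rw [uIcc_of_le ht] at hs
    simp [hφ', hs.1]
  have hVc : ContinuousOn V (Icc a b) := fun r hr => (hV r hr).continuousAt.continuousWithinAt
  have hVs : StrictMonoOn V (Icc a b) := by
    refine strictMonoOn_of_deriv_pos (convex_Icc _ _) hVc fun r hr => ?_
    rw [interior_Icc] at hr
    rw [(hV r (Ioo_subset_Icc_self hr)).deriv]; exact hwp r ⟨hr.1, hr.2.le⟩
  have hVn : ∀ r ∈ Icc a b, 0 ≤ V r := fun r hr => by
    rw [← hVa]; exact hVs.monotoneOn ⟨le_rfl, hab.le⟩ hr hr.1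
  have hwn : ∀ r ∈ Icc a b, 0 ≤ w r := fun r hr => by
    rcases hr.1.lt_or_eq with h | h
    · exact (hwp r ⟨h, hr.2⟩).le
    · rw [← h, hwa]
  have hintg : ∀ s t, a ≤ s → s ≤ t → t ≤ b → (∫ r in s..t, φ (V r)) = ∫ r in s..t, φ' (V r) := fun s t h1 h2 h3 => by
    refine intervalIntegral.integral_congr fun r hr => ?_
    rw [uIcc_of_le h2] at hr
    simp [hφ', hVn r ⟨h1.trans hr.1, hr.2.trans h3⟩]
  -- Step 1
  have step1 : ∀ r ∈ Icc a b, Hfun g (w r) ≤ Φ (V r) := by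
    intro r hr
    refine image_le_of_liminf_slope_right_le_deriv_boundary (f := fun r => Hfun g (w r)) (B := fun r => Φ (V r))
      (B' := fun r => φ' (V r) * w r) (a := a) (b := b) ?_ ?_ ?_ ?_ ?_ hr
    · exact (H_cont hg).comp hwc fun r hr => mem_Ici.2 (hwn r hr)
    · show Hfun g (w a) ≤ Φ (V a)
      rw [hwa, hVa, H_zero, hΦ0]
    · exact fun r hr => ((hΦd (V r)).continuousAt.comp (hV r hr).continuousAt).continuousWithinAt
    · intro r hr
      exact ((hΦd (V r)).comp r (hV r ⟨hr.1, hr.2.le⟩)).hasDerivWithinAt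
    · intro x hx q hq
      apply Filter.Eventually.frequently
      have hxI : x ∈ Icc a b := ⟨hx.1, hx.2.le⟩
      have hmem : Ioc x b ∈ 𝓝[>] x := Ioc_mem_nhdsGT hx.2
      have hsub : 𝓝[>] x ≤ 𝓝[Icc a b] x := by
        rw [nhdsWithin_le_iff]
        exact mem_of_superset hmem fun y hy => ⟨hx.1.trans hy.1.le, hy.2⟩
      have hsub2 : 𝓝[>] x ≤ 𝓝[Icc x b] x := by
        rw [nhdsWithin_le_iff]
        exact mem_of_superset hmem fun y hy => ⟨hy.1.le, hy.2⟩
      have t1 : Tendsto w (𝓝[>] x) (𝓝 (w x)) := (hwc x hxI).tendsto.mono_left hsub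
      have hcV : ContinuousOn (fun r => φ' (V r)) (Icc a b) := hφ'c.comp_continuousOn hVc
      have t2 : Tendsto (fun y => (y - x)⁻¹ * ∫ r in x..y, φ' (V r)) (𝓝[>] x) (𝓝 (φ' (V x))) := by
        have hsm : StronglyMeasurableAtFilter (fun r => φ' (V r)) (𝓝[>] x) :=
          ⟨Ioc x b, hmem, (hcV.mono fun y hy => ⟨hx.1.trans hy.1.le, hy.2⟩).aestronglyMeasurable measurableSet_Ioc⟩
        have := intervalIntegral.integral_hasDerivWithinAt_right (a := x) (b := x) (f := fun r => φ' (V r)) (s := Ici x) (t := Ioi x)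
          (by simp) hsm (((hcV x hxI).tendsto.mono_left hsub))
        have h2 := (hasDerivWithinAt_iff_tendsto_slope.1 this)
        rw [show Ici x \ {x} = Ioi x by ext y; simp [lt_iff_le_and_ne, eq_comm]] at h2
        refine h2.congr fun y => ?_
        simp [slope_def_field, div_eq_inv_mul]
      have t3 := (t1.mul t2)
      have hev := t3.eventually (gt_mem_nhds (show w x * φ' (V x) < q by rw [mul_comm]; exact hq))
      filter_upwards [hev, hmem] with y hy hym
      refine lt_of_le_of_lt ?_ hy
      have hyI : y ∈ Icc a b := ⟨hx.1.trans hym.1.le, hym.2⟩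
      rw [slope_def_field]
      have hyx : 0 < y - x := by linarith [hym.1]
      have k1 := H_diff hg (hwn x hxI) (hwn y hyI)
      have k2 := hineq x y hx.1 hym.1 hym.2
      rw [hintg x y hx.1 hym.1.le hym.2] at k2
      have k3 := mul_le_mul_of_nonneg_left k2 (hwn y hyI)
      rw [div_le_iff₀ hyx]
      have : w y * ((y - x)⁻¹ * ∫ r in x..y, φ' (V r)) * (y - x) = w y * ∫ r in x..y, φ' (V r) := by field_simp
      rw [this]; linarith
  have hVa' : ContinuousAt V a := (hV a ⟨le_rfl, hab.le⟩).continuousAt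
  rcases hφA with ⟨d, hd, hφd⟩ | ⟨δ, hδ, hφδ, htop⟩
  · -- φ vanishes near 0
    have hev : ∀ᶠ r in 𝓝[>] a, V r < d :=
      (hVa'.eventually (gt_mem_nhds (by rw [hVa]; exact hd))).filter_mono nhdsWithin_le_nhds
    obtain ⟨r, hr1, hr2⟩ := (hev.and (Ioc_mem_nhdsGT hab)).exists
    have hrI : r ∈ Icc a b := ⟨hr2.1.le, hr2.2⟩
    have h1 := step1 r hrI
    have h2 : Φ (V r) = 0 := by
      rw [← hΦeq _ (hVn r hrI)]
      rw [intervalIntegral.integral_congr (g := fun _ => (0:ℝ))]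
      · simp
      · intro s hs
        rw [uIcc_of_le (hVn r hrI)] at hs
        exact hφd s ⟨hs.1, by linarith [hs.2]⟩
    have h3 := H_smono hg (mem_Ici.2 le_rfl) (mem_Ici.2 (hwn r hrI)) (hwp r hr2)
    rw [H_zero] at h3
    linarith
  · have hH1 : 0 < Hfun g 1 := by
      have := H_smono hg (mem_Ici.2 le_rfl) (mem_Ici.2 zero_le_one) one_pos
      rwa [H_zero] at this
    have hcΦ : ContinuousAt (fun r => Φ (V r)) a := ((hΦd (V a)).continuousAt).comp hVa'
    have hev : ∀ᶠ r in 𝓝[>] a, V r < δ ∧ Φ (V r) < Hfun g 1 :=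
      ((hVa'.eventually (gt_mem_nhds (by rw [hVa]; exact hδ))).and
        (hcΦ.eventually (gt_mem_nhds (by show Φ (V a) < _; rw [hVa, hΦ0]; exact hH1)))).filter_mono nhdsWithin_le_nhds
    obtain ⟨b', ⟨hb1, hb2⟩, hb3⟩ := (hev.and (Ioc_mem_nhdsGT hab)).exists
    have hb'I : b' ∈ Icc a b := ⟨hb3.1.le, hb3.2⟩
    set ε := V b' with hε
    have hεp : 0 < ε := by
      have := hVs ⟨le_rfl, hab.le⟩ hb'I hb3.1; rwa [hVa] at this
    have hΦp : 0 < Φ ε := by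
      have h3 := H_smono hg (mem_Ici.2 le_rfl) (mem_Ici.2 (hwn b' hb'I)) (hwp b' hb3)
      rw [H_zero] at h3
      linarith [step1 b' hb'I]
    set F : ℝ → ENNReal := fun t => ENNReal.ofReal (1 / Hinv g (∫ s in (0:ℝ)..t, φ s)) with hF
    have hsp : Ioc (0:ℝ) δ ⊆ V '' Ioo a b' ∪ Icc ε δ := by
      intro t ht
      rcases lt_or_ge t ε with h | h
      · left
        have := intermediate_value_Ioo hb3.1.le (hVc.mono (Icc_subset_Icc le_rfl hb3.2))
        rw [hVa] at this
        exact this ⟨ht.1, h⟩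
      · right; exact ⟨h, ht.2⟩
    have hle : ∫⁻ t in Ioc (0:ℝ) δ, F t ≤ (∫⁻ t in V '' Ioo a b', F t) + ∫⁻ t in Icc ε δ, F t :=
      (lintegral_mono_set hsp).trans (lintegral_union_le _ _ _)
    have hsubI : Ioo a b' ⊆ Icc a b := fun r hr => ⟨hr.1.le, hr.2.le.trans hb3.2⟩
    have h1 : (∫⁻ t in V '' Ioo a b', F t) ≤ volume (Ioo a b') := by
      rw [lintegral_image_eq_lintegral_abs_deriv_mul measurableSet_Ioo
        (fun r hr => (hV r (hsubI hr)).hasDerivWithinAt) (hVs.injOn.mono hsubI)]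
      calc _ ≤ ∫⁻ r in Ioo a b', 1 := by
            refine setLIntegral_mono measurable_const fun r hr => ?_
            have hrI := hsubI hr
            have hw : 0 < w r := hwp r ⟨hr.1, hrI.2⟩
            rw [hF]
            simp only []
            rw [hΦeq _ (hVn r hrI)]
            have hrange : ∃ t ∈ Ici (0:ℝ), Hfun g t = Φ (V r) := by
              refine H_range hg ?_ ?_
              · rw [← hΦ0]; exact hΦm (hVn r hrI)
              · exact (hΦm (hVs.monotoneOn hrI hb'I hr.2.le)).trans hb2.le
            obtain ⟨q1, q2⟩ := Hinv_spec hg hrange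
            have q3 : w r ≤ Hinv g (Φ (V r)) := by
              rw [← (H_smono hg).le_iff_le (mem_Ici.2 hw.le) (mem_Ici.2 q1), q2]
              exact step1 r hrI
            rw [← ENNReal.ofReal_mul (abs_nonneg _), abs_of_pos hw, mul_one_div]
            rw [← ENNReal.ofReal_one]
            exact ENNReal.ofReal_le_ofReal ((div_le_one (hw.trans_le q3)).2 q3)
        _ = _ := by simp
    have h2 : ∃ B : ENNReal, B ≠ ⊤ ∧ (∫⁻ t in Icc ε δ, F t) ≤ B * volume (Icc ε δ) := by
      set J : ℝ := Classical.choice (inferInstance : Nonempty ℝ) with hJ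
      refine ⟨max (ENNReal.ofReal (1 / Hinv g (Φ ε))) (ENNReal.ofReal (1 / J)), by simp, ?_⟩
      rw [← setLIntegral_const]
      refine setLIntegral_mono measurable_const fun t ht => ?_
      rw [hF]
      simp only []
      rw [hΦeq _ (hεp.le.trans ht.1)]
      by_cases hrange : ∃ t' ∈ Ici (0:ℝ), Hfun g t' = Φ t
      · refine le_trans ?_ (le_max_left _ _)
        obtain ⟨q1, q2⟩ := Hinv_spec hg hrange
        obtain ⟨p1, p2⟩ := Hinv_spec hg (H_range hg hΦp.le hb2.le)
        have p3 : 0 < Hinv g (Φ ε) := by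
          rcases p1.lt_or_eq with h | h
          · exact h
          · rw [← h, H_zero] at p2; linarith
        have q3 : Hinv g (Φ ε) ≤ Hinv g (Φ t) := by
          rw [← (H_smono hg).le_iff_le (mem_Ici.2 p1) (mem_Ici.2 q1), q2, p2]
          exact hΦm ht.1
        exact ENNReal.ofReal_le_ofReal (one_div_le_one_div_of_le p3 q3)
      · refine le_trans ?_ (le_max_right _ _)
        have : Hinv g (Φ t) = J := Function.invFunOn_neg hrange
        rw [this]
    obtain ⟨B, hB, h2⟩ := h2
    have : (⊤ : ENNReal) ≤ volume (Ioo a b') + B * volume (Icc ε δ) := by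
      rw [← htop]; exact hle.trans (add_le_add h1 h2)
    rw [top_le_iff] at this
    refine ENNReal.add_ne_top.2 ⟨by simp, ENNReal.mul_ne_top hB (by simp)⟩ this
end
end CS
end

section
open Set Metric MeasureTheory Bornology Filter Topology
open scoped RealInnerProductSpace Classical NNReal

namespace CS
set_option linter.unusedSectionVars false
set_option linter.unusedVariables false
set_option linter.unusedSimpArgs false

section
variable {N : ℕ} {g : ℝ → ℝ} {f : ℝ → ℝ → ℝ} {K : ℝ≥0} {R M : ℝ} {v : EuclideanSpace ℝ (Fin N) → ℝ}
local notation "𝔼" => EuclideanSpace ℝ (Fin N)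

/-- trapezoidal cut-off -/
noncomputable def tz (a b h y : ℝ) : ℝ := max 0 (min 1 (min ((y - a) / h) ((b - y) / h)))
noncomputable def jz (a b h : ℝ) : ℝ → ℝ := fun y => 
  (Ioo a (a + h)).indicator (fun _ => 1 / h) y - (Ioo (b - h) b).indicator (fun _ => 1 / h) y

lemma tz_nonneg (a b h y : ℝ) : 0 ≤ tz a b h y := le_max_left _ _
lemma tz_le (a b h y : ℝ) : tz a b h y ≤ 1 := max_le zero_le_one (min_le_left _ _)
lemma tz_zero {a b h y : ℝ} (hh : 0 < h) (hy : y ∉ Ioo a b) : tz a b h y = 0 := by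
  unfold tz
  apply max_eq_left
  apply (min_le_right _ _).trans
  by_cases h1 : a < y
  · have : b ≤ y := by by_contra hc; exact hy ⟨h1, not_le.1 hc⟩
    exact (min_le_right _ _).trans (div_nonpos_of_nonpos_of_nonneg (by linarith) hh.le)
  · exact (min_le_left _ _).trans (div_nonpos_of_nonpos_of_nonneg (by linarith) hh.le)

lemma tz_lip {a b h : ℝ} (hh : 0 < h) : LipschitzWith (Real.toNNReal (1 / h)) (tz a b h) := by
  have h1 : LipschitzWith (Real.toNNReal (1 / h)) (fun y : ℝ => (y - a) / h) := by
    refine LipschitzWith.of_dist_le_mul fun x y => ?_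
    rw [Real.coe_toNNReal _ (by positivity), Real.dist_eq, Real.dist_eq, ← sub_div, abs_div, abs_of_pos hh]
    apply le_of_eq; rw [show x - a - (y - a) = x - y by ring]; ring
  have h2 : LipschitzWith (Real.toNNReal (1 / h)) (fun y : ℝ => (b - y) / h) := by
    refine LipschitzWith.of_dist_le_mul fun x y => ?_
    rw [Real.coe_toNNReal _ (by positivity), Real.dist_eq, Real.dist_eq, ← sub_div, abs_div, abs_of_pos hh]
    apply le_of_eq; rw [show b - x - (b - y) = -(x - y) by ring, abs_neg]; ring
  have h3 := (((h1.min h2).const_min 1).const_max 0)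
  rw [max_self] at h3
  exact h3

lemma tz_deriv {a b h : ℝ} (hh : 0 < h) (hab : a + h ≤ b - h) {y : ℝ} (h1 : y ≠ a) (h2 : y ≠ a + h) (h3 : y ≠ b - h)
    (h4 : y ≠ b) : HasDerivAt (tz a b h) (jz a b h y) y := by
  have eqn : ∀ x, tz a b h x = max 0 (min 1 (min ((x - a) / h) ((b - x) / h))) := fun _ => rfl
  rcases lt_or_gt_of_ne h1 with k1 | k1
  · have : jz a b h y = 0 := by
      have n1 : y ∉ Ioo a (a + h) := fun k => by linarith [k.1]
      have n2 : y ∉ Ioo (b - h) b := fun k => by linarith [k.1]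
      simp [jz, indicator_of_notMem n1, indicator_of_notMem n2]
    rw [this]
    refine (hasDerivAt_const y (0:ℝ)).congr_of_eventuallyEq ?_
    filter_upwards [gt_mem_nhds k1] with x hx
    exact tz_zero hh fun k => by linarith [k.1]
  rcases lt_or_gt_of_ne h2 with k2 | k2
  · have : jz a b h y = 1 / h := by
      have n1 : y ∈ Ioo a (a + h) := ⟨k1, k2⟩
      have n2 : y ∉ Ioo (b - h) b := fun k => by linarith [k.1]
      simp [jz, indicator_of_mem n1, indicator_of_notMem n2]
    rw [this]
    refine (((hasDerivAt_id y).sub_const a).div_const h).congr_of_eventuallyEq ?_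
    filter_upwards [lt_mem_nhds k1, gt_mem_nhds k2] with x hx hx2
    rw [eqn, min_eq_left (a := (x - a) / h), min_eq_right, max_eq_right]; rfl
    · exact div_nonneg (by linarith) hh.le
    · rw [div_le_one hh]; linarith
    · exact div_le_div_of_nonneg_right (by linarith) hh.le
  rcases lt_or_gt_of_ne h3 with k3 | k3
  · have : jz a b h y = 0 := by
      have n1 : y ∉ Ioo a (a + h) := fun k => by linarith [k.2]
      have n2 : y ∉ Ioo (b - h) b := fun k => by linarith [k.1]
      simp [jz, indicator_of_notMem n1, indicator_of_notMem n2]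
    rw [this]
    refine (hasDerivAt_const y (1:ℝ)).congr_of_eventuallyEq ?_
    filter_upwards [lt_mem_nhds k2, gt_mem_nhds k3] with x hx hx2
    rw [eqn, min_eq_left (a := (1:ℝ)), max_eq_right zero_le_one]
    refine le_min ?_ ?_ <;> rw [le_div_iff₀ hh] <;> linarith
  rcases lt_or_gt_of_ne h4 with k4 | k4
  · have : jz a b h y = -1 / h := by
      have n1 : y ∉ Ioo a (a + h) := fun k => by linarith [k.2]
      have n2 : y ∈ Ioo (b - h) b := ⟨k3, k4⟩
      simp [jz, indicator_of_notMem n1, indicator_of_mem n2]; ring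
    rw [this]
    refine (((hasDerivAt_id y).const_sub b).div_const h).congr_of_eventuallyEq ?_
    filter_upwards [lt_mem_nhds k3, gt_mem_nhds k4] with x hx hx2
    rw [eqn, min_eq_right (b := (b - x) / h), min_eq_right, max_eq_right]; rfl
    · exact div_nonneg (by linarith) hh.le
    · rw [div_le_one hh]; linarith
    · exact div_le_div_of_nonneg_right (by linarith) hh.le
  · have : jz a b h y = 0 := by
      have n1 : y ∉ Ioo a (a + h) := fun k => by linarith [k.2]
      have n2 : y ∉ Ioo (b - h) b := fun k => by linarith [k.2]
      simp [jz, indicator_of_notMem n1, indicator_of_notMem n2]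
    rw [this]
    refine (hasDerivAt_const y (0:ℝ)).congr_of_eventuallyEq ?_
    filter_upwards [lt_mem_nhds k4] with x hx
    exact tz_zero hh fun k => by linarith [k.2]

lemma jz_zero {a b h y : ℝ} (hh : 0 < h) (hab : a + h ≤ b - h) (hy : y ∉ Ioo a b) : jz a b h y = 0 := by
  have n1 : y ∉ Ioo a (a + h) := fun k => hy ⟨k.1, by linarith [k.2]⟩
  have n2 : y ∉ Ioo (b - h) b := fun k => hy ⟨by linarith [k.1], k.2⟩
  simp [jz, indicator_of_notMem n1, indicator_of_notMem n2]

/-- the radial weak formulation -/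
lemma rad_weak (hS : Sol R K M g f v) {z e : 𝔼} (he : ‖e‖ = 1) {r1 r0 a b h : ℝ} (hr1 : 0 ≤ r1)
    (hrad : ∀ r ∈ Ioo r1 r0, Rad v z r) (ha : r1 < a) (hb : b < r0) (hh : 0 < h) (hab : a + h ≤ b - h) {q : ℝ → ℝ}
    (hq : Continuous q) (hq0 : ∀ r ∈ Ioo r1 r0, 0 ≤ q r)
    (hfq : ∀ x, ‖x - z‖ ∈ Ioo r1 r0 → f ‖x‖ (v x) ≤ q ‖x - z‖) :
    (∫ y in Ioi (0:ℝ), y ^ (N - 1) * (-g (-fderiv ℝ v (z + y • e) e) * jz a b h y)) ≤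
      ∫ y in Ioi (0:ℝ), y ^ (N - 1) * (q y * tz a b h y) := by
  have hN : 0 < N := by
    rcases Nat.eq_zero_or_pos N with h0 | h0
    · subst h0; rw [Subsingleton.elim e 0, norm_zero] at he; norm_num at he
    · exact h0
  set ψ : 𝔼 → ℝ := fun x => tz a b h ‖x - z‖ with hψ
  have hlip : LipschitzWith (Real.toNNReal (1 / h) * 1) ψ := by
    refine (tz_lip hh).comp (f := tz a b h) (g := fun x : 𝔼 => ‖x - z‖) ?_
    refine LipschitzWith.of_dist_le_mul fun x y => ?_
    rw [Real.dist_eq, dist_eq_norm]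
    simpa using abs_norm_sub_norm_le (x - z) (y - z)
  have hmem : ∀ x : 𝔼, ‖x - z‖ ∈ Ioo r1 r0 → x ∈ ball (0:𝔼) R := fun x hx =>
    mem_of_grad hS ((hrad _ hx).reg (by simp [mem_sphere, dist_eq_norm]))
  have hsub : ∀ y, y ∈ Ioo a b → y ∈ Ioo r1 r0 := fun y hy => ⟨ha.trans hy.1, hy.2.trans hb⟩
  have hadm : Adm (Real.toNNReal (1 / h) * 1) R ψ := ⟨hlip, fun x => tz_nonneg _ _ _ _, fun x hx => by
    apply tz_zero hh; intro hc; exact hx (hmem x (hsub _ hc))⟩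
  have key := hS.wk.adm hadm
  -- left-hand side
  have hL : (∫ x in ball (0:𝔼) R, fderiv ℝ ψ x (gvec g (gradient v x))) =
      ∫ x : 𝔼, (fun y : ℝ => -g (-fderiv ℝ v (z + y • e) e) * jz a b h y) ‖x - z‖ := by
    have hae : ∀ᵐ x : 𝔼, ‖x - z‖ ≠ a ∧ ‖x - z‖ ≠ a + h ∧ ‖x - z‖ ≠ b - h ∧ ‖x - z‖ ≠ b := by
      have hs : ∀ c : ℝ, c ≠ 0 → ∀ᵐ x : 𝔼, ‖x - z‖ ≠ c := fun c hc => by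
        have := Measure.addHaar_sphere_of_ne_zero (volume : Measure 𝔼) z hc
        rw [ae_iff]
        convert this using 2
        ext x; simp [dist_eq_norm]
      filter_upwards [hs a (by linarith), hs (a + h) (by linarith), hs (b - h) (by linarith), hs b (by linarith)] with x k1 k2 k3 k4
      exact ⟨k1, k2, k3, k4⟩
    have hfd : ∀ᵐ x : 𝔼, fderiv ℝ ψ x (gvec g (gradient v x)) = (fun y : ℝ => -g (-fderiv ℝ v (z + y • e) e) * jz a b h y) ‖x - z‖ := by
      filter_upwards [hae] with x ⟨k1, k2, k3, k4⟩
      have hd := tz_deriv hh hab k1 k2 k3 k4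
      by_cases hx : ‖x - z‖ ∈ Ioo a b
      · have hpos : 0 < ‖x - z‖ := by linarith [hx.1]
        have hne : x - z ≠ 0 := norm_pos_iff.1 hpos
        have hR := hrad _ (hsub _ hx)
        have hgr := hR.grad he (y := x) (by simp [mem_sphere, dist_eq_norm])
        have hdl := hR.dlt he
        set D := fderiv ℝ v (z + ‖x - z‖ • e) e
        have hn : ‖gradient v x‖ = -D := by
          rw [hgr, norm_smul, Real.norm_eq_abs, abs_div, abs_of_neg hdl, abs_of_pos hpos]; field_simp
        have hgv : gvec g (gradient v x) = (-g (-D) / ‖x - z‖) • (x - z) := by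
          have : gradient v x ≠ 0 := by rw [← norm_pos_iff, hn]; linarith
          rw [gvec, if_neg this, hn, hgr, smul_smul]
          congr 1
          have := hdl.ne
          field_simp
        have hnd : HasFDerivAt (fun x : 𝔼 => ‖x - z‖) ((1 / ‖x - z‖) • innerSL ℝ (x - z)) x := by
          have h1 := (hasStrictFDerivAt_norm_sq (x - z)).hasFDerivAt.comp x ((hasFDerivAt_id x).sub_const z)
          have h2 := h1.sqrt (by simpa using hne)
          refine (h2.congr_fderiv ?_).congr_of_eventuallyEq (.of_forall fun y => ?_)
          · ext y
            simp [Real.sqrt_sq hpos.le]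
            field_simp
          · simp [Real.sqrt_sq (norm_nonneg (y - z))]
        have hψd := (hd.comp_hasFDerivAt x hnd).fderiv
        have : fderiv ℝ ψ x = jz a b h ‖x - z‖ • (1 / ‖x - z‖) • innerSL ℝ (x - z) := hψd
        rw [this, hgv]
        simp only [_root_.smul_apply, innerSL_apply_apply, real_inner_smul_right, real_inner_self_eq_norm_sq, smul_eq_mul]
        show _ = -g (-D) * jz a b h ‖x - z‖
        field_simp
      · have hj := jz_zero hh hab hx
        have : fderiv ℝ ψ x = 0 := by
          have h0 : ψ x = 0 := tz_zero hh hx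
          exact IsLocalMin.fderiv_eq_zero (.of_forall fun y => by rw [h0]; exact tz_nonneg _ _ _ _)
        rw [this]; simp [hj]
    rw [← integral_congr_ae hfd, setIntegral_eq_integral_of_forall_compl_eq_zero]
    intro x hx
    have : fderiv ℝ ψ x = 0 := by
      have h0 : ψ x = 0 := hadm.zero x hx
      exact IsLocalMin.fderiv_eq_zero (.of_forall fun y => by rw [h0]; exact tz_nonneg _ _ _ _)
    simp [this]
  have hcq : Continuous (fun x : 𝔼 => q ‖x - z‖ * ψ x) := by
    exact (hq.comp (by fun_prop : Continuous fun x : 𝔼 => ‖x - z‖)).mul hlip.continuous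
  have hRr : (∫ x in ball (0:𝔼) R, f ‖x‖ (v x) * ψ x) ≤ ∫ x : 𝔼, (fun y : ℝ => q y * tz a b h y) ‖x - z‖ := by
    have h1 : (∫ x in ball (0:𝔼) R, f ‖x‖ (v x) * ψ x) ≤ ∫ x in ball (0:𝔼) R, q ‖x - z‖ * ψ x := by
      refine setIntegral_mono_on (hS.wk.int_h hadm) (cont_intOn hcq) measurableSet_ball fun x hx => ?_
      by_cases hx : ‖x - z‖ ∈ Ioo a b
      · exact mul_le_mul_of_nonneg_right (hfq x (hsub _ hx)) (tz_nonneg _ _ _ _)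
      · have : ψ x = 0 := tz_zero hh hx
        simp [this]
    refine h1.trans (le_of_eq ?_)
    rw [setIntegral_eq_integral_of_forall_compl_eq_zero]
    intro x hx
    rw [hadm.zero x hx, mul_zero]
  rw [hL] at key
  rw [key.symm] at hRr
  rw [integral_sub_right_eq_self (μ := volume) (fun x : 𝔼 => (fun y : ℝ => -g (-fderiv ℝ v (z + y • e) e) * jz a b h y) ‖x‖) z,
    integral_sub_right_eq_self (μ := volume) (fun x : 𝔼 => (fun y : ℝ => q y * tz a b h y) ‖x‖) z] at hRr
  have : Nonempty (Fin N) := ⟨⟨0, hN⟩⟩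
  rw [integral_fun_norm_addHaar (volume : Measure 𝔼) (fun y : ℝ => -g (-fderiv ℝ v (z + y • e) e) * jz a b h y),
    integral_fun_norm_addHaar (volume : Measure 𝔼) (fun y : ℝ => q y * tz a b h y)] at hRr
  simp only [finrank_euclideanSpace_fin, smul_eq_mul, nsmul_eq_mul] at hRr
  have hv : 0 < (volume : Measure 𝔼).real (ball 0 1) := by
    rw [Measure.real]; exact ENNReal.toReal_pos (measure_ball_pos _ _ one_pos).ne' measure_ball_lt_top.ne
  have hN' : (0:ℝ) < N := by exact_mod_cast hN
  exact le_of_mul_le_mul_left (le_of_mul_le_mul_left hRr hN') hv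

lemma rad_ineq0 (hS : Sol R K M g f v) {z e : 𝔼} (he : ‖e‖ = 1) {r1 r0 a b : ℝ} (hr1 : 0 ≤ r1)
    (hrad : ∀ r ∈ Ioo r1 r0, Rad v z r) (ha : r1 < a) (hb : b < r0) (hab : a < b) {q : ℝ → ℝ}
    (hq : Continuous q) (hq0 : ∀ r ∈ Ioo r1 r0, 0 ≤ q r)
    (hfq : ∀ x, ‖x - z‖ ∈ Ioo r1 r0 → f ‖x‖ (v x) ≤ q ‖x - z‖) :
    b ^ (N - 1) * g (-fderiv ℝ v (z + b • e) e) - a ^ (N - 1) * g (-fderiv ℝ v (z + a • e) e) ≤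
      ∫ y in a..b, y ^ (N - 1) * q y := by
  set P : ℝ → ℝ := fun y => y ^ (N - 1) * g (-fderiv ℝ v (z + y • e) e) with hP
  have hPc : ∀ y ∈ Ioo r1 r0, ContinuousAt P y := fun y hy => by
    have h1 := hrad y hy
    have h2 := mem_of_grad hS (h1.reg (sph_mem he h1.pos.le))
    have h3 : ContinuousAt (fun y : ℝ => fderiv ℝ v (z + y • e) e) y :=
      (ContinuousAt.comp (g := fderiv ℝ v) (f := fun y : ℝ => z + y • e) (hS.contDv h2) (by fun_prop)).clm_apply continuousAt_const
    have h4 : ContinuousAt g (-fderiv ℝ v (z + y • e) e) :=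
      (hS.hg.1.continuousAt (Ici_mem_nhds (by have := h1.dlt he; linarith)))
    have h5 : ContinuousAt (fun y : ℝ => g (-fderiv ℝ v (z + y • e) e)) y :=
      ContinuousAt.comp (g := g) (f := fun y : ℝ => -fderiv ℝ v (z + y • e) e) h4 h3.neg
    exact (by fun_prop : ContinuousAt (fun y : ℝ => y ^ (N - 1)) y).mul h5
  refine le_of_forall_pos_le_add fun ε hε => ?_
  show P b - P a ≤ _
  obtain ⟨δ1, hδ1, k1⟩ := Metric.continuousAt_iff.1 (hPc a ⟨ha, hab.trans hb⟩) (ε / 2) (by positivity)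
  obtain ⟨δ2, hδ2, k2⟩ := Metric.continuousAt_iff.1 (hPc b ⟨ha.trans hab, hb⟩) (ε / 2) (by positivity)
  set h := min (min δ1 δ2) ((b - a) / 2) with hh
  have hh0 : 0 < h := lt_min (lt_min hδ1 hδ2) (by linarith)
  have hhab : a + h ≤ b - h := by have := min_le_right (min δ1 δ2) ((b - a) / 2); linarith
  have hhδ1 : h ≤ δ1 := (min_le_left _ _).trans (min_le_left _ _)
  have hhδ2 : h ≤ δ2 := (min_le_left _ _).trans (min_le_right _ _)
  have key := rad_weak hS he hr1 hrad ha hb hh0 hhab hq hq0 hfq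
  have ha0 : 0 < a := by linarith
  have hPcon : ContinuousOn P (Icc a b) := fun y hy => (hPc y ⟨by linarith [hy.1], by linarith [hy.2]⟩).continuousWithinAt
  have i1 : IntegrableOn P (Ioo a (a + h)) := (hPcon.integrableOn_Icc).mono_set fun y hy => ⟨hy.1.le, by linarith [hy.2]⟩
  have i2 : IntegrableOn P (Ioo (b - h) b) := (hPcon.integrableOn_Icc).mono_set fun y hy => ⟨by linarith [hy.1], hy.2.le⟩
  have e1 : (∫ y in Ioi (0:ℝ), y ^ (N - 1) * (-g (-fderiv ℝ v (z + y • e) e) * jz a b h y)) =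
      (1 / h) * (∫ y in Ioo (b - h) b, P y) - (1 / h) * ∫ y in Ioo a (a + h), P y := by
    have : (fun y : ℝ => y ^ (N - 1) * (-g (-fderiv ℝ v (z + y • e) e) * jz a b h y)) =
        fun y => (1 / h) * (Ioo (b - h) b).indicator P y - (1 / h) * (Ioo a (a + h)).indicator P y := by
      funext y
      by_cases c1 : y ∈ Ioo a (a + h) <;> by_cases c2 : y ∈ Ioo (b - h) b <;>
        simp only [jz, indicator_of_mem, indicator_of_notMem, c1, c2, hP, not_false_eq_true] <;> ring
    rw [this, integral_sub, integral_const_mul, integral_const_mul, setIntegral_indicator measurableSet_Ioo, setIntegral_indicator measurableSet_Ioo,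
      inter_eq_right.2, inter_eq_right.2]
    · exact fun y hy => lt_trans ha0 hy.1
    · exact fun y hy => mem_Ioi.2 (by linarith [hy.1])
    · exact ((i2.integrable_indicator measurableSet_Ioo).const_mul _).integrableOn
    · exact ((i1.integrable_indicator measurableSet_Ioo).const_mul _).integrableOn
  have b1 : (∫ y in Ioo a (a + h), P y) ≤ h * (P a + ε / 2) := by
    have : (∫ y in Ioo a (a + h), P y) ≤ ∫ y in Ioo a (a + h), (P a + ε / 2) := by
      refine setIntegral_mono_on i1 (by simp) measurableSet_Ioo fun y hy => ?_
      have := k1 (x := y) (by rw [Real.dist_eq, abs_lt]; constructor <;> linarith [hy.1, hy.2])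
      rw [Real.dist_eq, abs_lt] at this; linarith [this.2]
    refine this.trans (le_of_eq ?_)
    simp [Measure.real, hh0.le]
  have b2 : h * (P b - ε / 2) ≤ ∫ y in Ioo (b - h) b, P y := by
    have : (∫ y in Ioo (b - h) b, (P b - ε / 2)) ≤ ∫ y in Ioo (b - h) b, P y := by
      refine setIntegral_mono_on (by simp) i2 measurableSet_Ioo fun y hy => ?_
      have := k2 (x := y) (by rw [Real.dist_eq, abs_lt]; constructor <;> linarith [hy.1, hy.2])
      rw [Real.dist_eq, abs_lt] at this; linarith [this.1]
    refine le_trans (le_of_eq ?_) this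
    simp [Measure.real, hh0.le]
  have b3 : (∫ y in Ioi (0:ℝ), y ^ (N - 1) * (q y * tz a b h y)) ≤ ∫ y in a..b, y ^ (N - 1) * q y := by
    have hcont : Continuous fun y : ℝ => y ^ (N - 1) * q y := by fun_prop
    rw [intervalIntegral.integral_of_le hab.le, ← inter_eq_right.2 (fun y (hy : y ∈ Ioc a b) => (mem_Ioi.2 (ha0.trans hy.1) : y ∈ Ioi (0:ℝ))),
      ← setIntegral_indicator measurableSet_Ioc]
    have hc2 : Continuous fun y : ℝ => y ^ (N - 1) * (q y * tz a b h y) := by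
      have := (tz_lip (a := a) (b := b) hh0).continuous
      fun_prop
    have hintg : Integrable (fun y : ℝ => y ^ (N - 1) * (q y * tz a b h y)) := by
      refine hc2.integrable_of_hasCompactSupport (HasCompactSupport.intro isCompact_Icc (K := Icc a b) fun y hy => ?_)
      rw [tz_zero hh0 (fun k => hy ⟨k.1.le, k.2.le⟩)]; ring
    have hint2 : Integrable ((Ioc a b).indicator fun y : ℝ => y ^ (N - 1) * q y) :=
      ((hcont.integrableOn_Icc (a := a) (b := b)).mono_set Ioc_subset_Icc_self).integrable_indicator measurableSet_Ioc
    refine integral_mono_of_nonneg ?_ hint2.integrableOn ?_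
    · filter_upwards [ae_restrict_mem measurableSet_Ioi] with y hy
      show 0 ≤ y ^ (N - 1) * (q y * tz a b h y)
      by_cases c : y ∈ Ioo a b
      · have := hq0 y ⟨ha.trans c.1, c.2.trans hb⟩
        have := tz_nonneg a b h y
        have : 0 < y := hy
        positivity
      · rw [tz_zero hh0 c]; simp
    · filter_upwards [ae_restrict_mem measurableSet_Ioi] with y hy
      have hy0 : 0 < y := hy
      by_cases c : y ∈ Ioo a b
      · rw [indicator_of_mem (show y ∈ Ioc a b from ⟨c.1, c.2.le⟩)]
        have h1 := hq0 y ⟨ha.trans c.1, c.2.trans hb⟩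
        exact mul_le_mul_of_nonneg_left (mul_le_of_le_one_right h1 (tz_le _ _ _ _)) (by positivity)
      · rw [tz_zero hh0 c, mul_zero, mul_zero]
        by_cases d : y ∈ Ioc a b
        · rw [indicator_of_mem d]
          have h1 := hq0 y ⟨ha.trans d.1, d.2.trans_lt hb⟩
          positivity
        · rw [indicator_of_notMem d]
  rw [e1] at key
  have c1 : P b - ε / 2 ≤ (1 / h) * (∫ y in Ioo (b - h) b, P y) := by
    rw [one_div, ← div_eq_inv_mul, le_div_iff₀ hh0]; linarith
  have c2 : (1 / h) * (∫ y in Ioo a (a + h), P y) ≤ P a + ε / 2 := by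
    rw [one_div, ← div_eq_inv_mul, div_le_iff₀ hh0]; linarith
  linarith

lemma rad_ineq1 (hS : Sol R K M g f v) {z e : 𝔼} (he : ‖e‖ = 1) {r1 r0 a b : ℝ} (hr1 : 0 ≤ r1)
    (hrad : ∀ r ∈ Ioo r1 r0, Rad v z r) (ha : r1 < a) (hb : b < r0) (hab : a < b) {q : ℝ → ℝ}
    (hq : Continuous q) (hq0 : ∀ r ∈ Ioo r1 r0, 0 ≤ q r)
    (hfq : ∀ x, ‖x - z‖ ∈ Ioo r1 r0 → f ‖x‖ (v x) ≤ q ‖x - z‖) :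
    g (-fderiv ℝ v (z + b • e) e) - g (-fderiv ℝ v (z + a • e) e) ≤ ∫ y in a..b, q y := by
  have h1 := rad_ineq0 hS he hr1 hrad ha hb hab hq hq0 hfq
  have ha0 : 0 < a := by linarith
  have hb0 : 0 < b := by linarith
  have h2 : (∫ y in a..b, y ^ (N - 1) * q y) ≤ b ^ (N - 1) * ∫ y in a..b, q y := by
    rw [← intervalIntegral.integral_const_mul]
    refine intervalIntegral.integral_mono_on hab.le ?_ ?_ fun y hy => ?_
    · exact (by fun_prop : Continuous fun y : ℝ => y ^ (N - 1) * q y).intervalIntegrable _ _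
    · exact (by fun_prop : Continuous fun y : ℝ => b ^ (N - 1) * q y).intervalIntegrable _ _
    · refine mul_le_mul_of_nonneg_right (pow_le_pow_left₀ (by linarith [hy.1]) hy.2 _) (hq0 y ⟨by linarith [hy.1], by linarith [hy.2]⟩)
  have h3 : a ^ (N - 1) * g (-fderiv ℝ v (z + a • e) e) ≤ b ^ (N - 1) * g (-fderiv ℝ v (z + a • e) e) := by
    refine mul_le_mul_of_nonneg_right (pow_le_pow_left₀ ha0.le hab.le _) (g_nonneg hS.hg ?_)
    have := (hrad a ⟨ha, hab.trans hb⟩).dlt he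
    linarith
  have h4 : 0 < b ^ (N - 1) := by positivity
  refine le_of_mul_le_mul_left ?_ h4
  rw [mul_sub]; linarith

lemma rad_ineq (hS : Sol R K M g f v) {z e : 𝔼} (he : ‖e‖ = 1) {r1 r0 : ℝ} (hr1 : 0 ≤ r1)
    (hrad : ∀ r ∈ Ioo r1 r0, Rad v z r) (hm : z + r1 • e ∈ ball (0:𝔼) R) (h0 : fderiv ℝ v (z + r1 • e) e ≤ 0) {q : ℝ → ℝ}
    (hq : Continuous q) (hq0 : ∀ r ∈ Ioo r1 r0, 0 ≤ q r)
    (hfq : ∀ x, ‖x - z‖ ∈ Ioo r1 r0 → f ‖x‖ (v x) ≤ q ‖x - z‖) {a b : ℝ} (ha : r1 ≤ a) (hb : b < r0) (hab : a < b) :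
    g (-fderiv ℝ v (z + b • e) e) - g (-fderiv ℝ v (z + a • e) e) ≤ ∫ y in a..b, q y := by
  rcases ha.lt_or_eq with ha | ha
  · exact rad_ineq1 hS he hr1 hrad ha hb hab hq hq0 hfq
  subst ha
  have h3 : ContinuousAt (fun y : ℝ => fderiv ℝ v (z + y • e) e) r1 :=
    (ContinuousAt.comp (g := fderiv ℝ v) (f := fun y : ℝ => z + y • e) (hS.contDv hm) (by fun_prop)).clm_apply continuousAt_const
  have h4 : Tendsto (fun y : ℝ => g (-fderiv ℝ v (z + y • e) e)) (𝓝[>] r1) (𝓝 (g (-fderiv ℝ v (z + r1 • e) e))) := by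
    have h5 : Tendsto (fun y : ℝ => -fderiv ℝ v (z + y • e) e) (𝓝[>] r1) (𝓝[Ici 0] (-fderiv ℝ v (z + r1 • e) e)) := by
      refine tendsto_nhdsWithin_iff.2 ⟨h3.neg.tendsto.mono_left nhdsWithin_le_nhds, ?_⟩
      filter_upwards [Ioo_mem_nhdsGT (hab.trans hb)] with y hy
      have := (hrad y hy).dlt he
      exact mem_Ici.2 (by linarith)
    exact (hS.hg.1 _ (mem_Ici.2 (by linarith))).tendsto.comp h5
  have h6 : Tendsto (fun y : ℝ => ∫ x in y..b, q x) (𝓝[>] r1) (𝓝 (∫ x in r1..b, q x)) := by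
    have h7 : Continuous fun y : ℝ => ∫ x in y..b, q x := by
      have := intervalIntegral.continuous_primitive (μ := volume) (f := q) (fun a b => hq.intervalIntegrable a b) b
      have e : (fun y : ℝ => ∫ x in y..b, q x) = fun y => -∫ x in b..y, q x := funext fun y => intervalIntegral.integral_symm b y
      rw [e]; exact this.neg
    exact h7.continuousAt.tendsto.mono_left nhdsWithin_le_nhds
  refine le_of_tendsto_of_tendsto (tendsto_const_nhds.sub h4) h6 ?_
  filter_upwards [Ioo_mem_nhdsGT hab] with y hy
  exact rad_ineq1 hS he hr1 hrad hy.1 hb hy.2 hq hq0 hfq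
end
end CS
end

section
open Set Metric MeasureTheory Bornology Filter Topology
open scoped RealInnerProductSpace Classical NNReal

namespace CS
set_option linter.unusedSectionVars false
set_option linter.unusedVariables false
set_option linter.unusedSimpArgs false

section
variable {N : ℕ} {g : ℝ → ℝ} {f : ℝ → ℝ → ℝ} {K : ℝ≥0} {R M : ℝ} {v : EuclideanSpace ℝ (Fin N) → ℝ}
local notation "𝔼" => EuclideanSpace ℝ (Fin N)

/-- a bounded inverse of `g` near zero -/
lemma beta_exists (hg : GCond g) {k ρ : ℝ} (hk : 0 < k) (hρ : 0 < ρ) (hkρ : k * ρ ≤ g 1) :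
    ∃ β : ℝ → ℝ, Continuous β ∧ (∀ y, 0 ≤ β y) ∧ (∀ y, β y ≤ 1) ∧ ∀ y ∈ Icc 0 ρ, g (β y) = k * y := by
  set cl : ℝ → ℝ := fun t => max 0 (min t 1) with hcl
  have cl0 : ∀ t, 0 ≤ cl t := fun t => le_max_left _ _
  have cl1 : ∀ t, cl t ≤ 1 := fun t => max_le zero_le_one (min_le_right _ _)
  have clm : Monotone cl := fun a b hab => max_le_max le_rfl (min_le_min hab le_rfl)
  have cle : ∀ t ∈ Icc (0:ℝ) 1, cl t = t := fun t ht => by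
    show max 0 (min t 1) = t
    rw [min_eq_left ht.2, max_eq_right ht.1]
  have clid : ∀ a b, a ≤ b → cl b - cl a ≤ b - a := fun a b hab => by
    show max 0 (min b 1) - max 0 (min a 1) ≤ b - a
    rcases max_cases 0 (min b 1) with h | h <;> rcases max_cases 0 (min a 1) with h' | h' <;>
    rcases min_cases b 1 with h2 | h2 <;> rcases min_cases a 1 with h3 | h3 <;> linarith
  set G : ℝ → ℝ := fun t => g (cl t) + (t - cl t) with hG
  have hgc : Continuous fun t => g (cl t) := hg.1.comp_continuous (by fun_prop) fun t => mem_Ici.2 (cl0 t)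
  have hGc : Continuous G := hgc.add (by fun_prop)
  have hGm : StrictMono G := fun a b hab => by
    show g (cl a) + (a - cl a) < g (cl b) + (b - cl b)
    have h1 := clid a b hab.le
    rcases (clm hab.le).lt_or_eq with h | h
    · have := g_smono hg (mem_Ici.2 (cl0 a)) (mem_Ici.2 (cl0 b)) h
      linarith
    · rw [h]; linarith
  have hGs : Function.Surjective G := by
    refine hGc.surjective ?_ ?_
    · refine tendsto_atTop_mono (f := fun t => t - 1) (fun t => ?_) (tendsto_atTop_add_const_right _ _ tendsto_id)
      have := g_nonneg hg (cl0 t)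
      show t - 1 ≤ g (cl t) + (t - cl t)
      linarith [cl1 t]
    · refine tendsto_atBot_mono (f := fun t => t + g 1) (fun t => ?_) (tendsto_atBot_add_const_right _ _ tendsto_id)
      have := (g_smono hg).monotoneOn (mem_Ici.2 (cl0 t)) (mem_Ici.2 zero_le_one) (cl1 t)
      show g (cl t) + (t - cl t) ≤ t + g 1
      linarith [cl0 t]
  set E := hGm.orderIsoOfSurjective G hGs with hE
  have hEv : ∀ t, E t = G t := fun t => rfl
  have G0 : G 0 = 0 := by
    show g (cl 0) + (0 - cl 0) = 0
    rw [cle 0 ⟨le_rfl, zero_le_one⟩, hg.2.2.1]; ring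
  have G1 : G 1 = g 1 := by
    show g (cl 1) + (1 - cl 1) = g 1
    rw [cle 1 ⟨zero_le_one, le_rfl⟩]; ring
  have cy0 : ∀ y, 0 ≤ max 0 (min y ρ) := fun y => le_max_left _ _
  have cy1 : ∀ y, max 0 (min y ρ) ≤ ρ := fun y => max_le hρ.le (min_le_right _ _)
  have b0 : ∀ y, 0 ≤ E.symm (k * max 0 (min y ρ)) := fun y => by
    rw [OrderIso.le_symm_apply, hEv, G0]
    exact mul_nonneg hk.le (cy0 y)
  have b1 : ∀ y, E.symm (k * max 0 (min y ρ)) ≤ 1 := fun y => by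
    rw [OrderIso.symm_apply_le, hEv, G1]
    exact (mul_le_mul_of_nonneg_left (cy1 y) hk.le).trans hkρ
  refine ⟨fun y => E.symm (k * max 0 (min y ρ)), ?_, b0, b1, fun y hy => ?_⟩
  · exact E.symm.continuous.comp (by fun_prop)
  · have h1 : E (E.symm (k * max 0 (min y ρ))) = k * max 0 (min y ρ) := E.apply_symm_apply _
    rw [hEv] at h1
    have h2 : G (E.symm (k * max 0 (min y ρ))) = g (E.symm (k * max 0 (min y ρ))) := by
      show g (cl _) + (_ - cl _) = _
      rw [cle _ ⟨b0 y, b1 y⟩]; ring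
    rw [h2, min_eq_left hy.2, max_eq_right hy.1] at h1
    show g (E.symm (k * max 0 (min y ρ))) = k * y
    rw [min_eq_left hy.2, max_eq_right hy.1]; exact h1

/-- divergence identity for the radial field -/
lemma div_int {φ : 𝔼 → ℝ} (hφ : LipschitzWith K φ) (hc : HasCompactSupport φ) (c : 𝔼) :
    (∫ x, fderiv ℝ φ x (x - c)) = -(N * ∫ x, φ x) := by
  have h1 : ∀ i : Fin N, (∫ x, fderiv ℝ φ x (EuclideanSpace.single i 1) * (x i - c i)) = - ∫ x, φ x := fun i => by
    set ei : 𝔼 := EuclideanSpace.single i 1 with hei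
    have hl : LipschitzWith 1 (fun x : 𝔼 => x i - c i) := by
      refine LipschitzWith.of_dist_le_mul fun x y => ?_
      rw [Real.dist_eq, dist_eq_norm]
      have := PiLp.norm_apply_le (x - y) i
      simpa using this
    have h2 := hl.integral_lineDeriv_mul_eq (μ := volume) hφ hc ei
    have h3 : ∀ x : 𝔼, lineDeriv ℝ (fun x : 𝔼 => x i - c i) x ei = 1 := fun x => by
      have : HasDerivAt (fun t : ℝ => (x + t • ei) i - c i) 1 0 := by
        have h4 : (fun t : ℝ => (x + t • ei) i - c i) = fun t => x i + t - c i := by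
          funext t; simp [hei]
        rw [h4]
        simpa using ((hasDerivAt_id (0:ℝ)).const_add (x i)).sub_const (c i)
      exact this.deriv
    simp only [h3, one_mul] at h2
    rw [h2, ← integral_neg]
    refine integral_congr_ae ?_
    filter_upwards [hφ.ae_differentiableAt (μ := volume)] with x hx
    rw [hx.lineDeriv_eq_fderiv, map_neg]; ring
  have h5 : ∀ x : 𝔼, fderiv ℝ φ x (x - c) = ∑ i, fderiv ℝ φ x (EuclideanSpace.single i 1) * (x i - c i) := fun x => by
    have : x - c = ∑ i, (x i - c i) • (EuclideanSpace.single i (1:ℝ) : 𝔼) := by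
      have := (EuclideanSpace.basisFun (Fin N) ℝ).sum_repr (x - c)
      simpa using this.symm
    conv_lhs => rw [this]
    rw [map_sum]
    refine Finset.sum_congr rfl fun i _ => ?_
    rw [map_smul, smul_eq_mul, mul_comm]
  simp only [h5]
  rw [integral_finsetSum]
  · simp [h1]
  · intro i _
    obtain ⟨r, hr⟩ := hc.isBounded.subset_closedBall (0:𝔼)
    have hz : ∀ x, x ∉ closedBall (0:𝔼) r → fderiv ℝ φ x (EuclideanSpace.single i 1) * (x i - c i) = 0 := fun x hx => by
      have : fderiv ℝ φ x = 0 := by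
        by_contra hne
        exact hx (hr (support_fderiv_subset ℝ hne))
      rw [this]; simp
    have hio : IntegrableOn (fun x : 𝔼 => fderiv ℝ φ x (EuclideanSpace.single i 1) * (x i - c i)) (closedBall (0:𝔼) r) := by
      refine Integrable.mono' (g := fun _ => K * (r + ‖c‖)) ?_ ?_ ?_
      · exact integrableOn_const measure_closedBall_lt_top.ne
      · refine AEStronglyMeasurable.mul ?_ (by fun_prop : Continuous fun x : 𝔼 => x i - c i).aestronglyMeasurable
        exact (((ContinuousLinearMap.apply ℝ ℝ) (EuclideanSpace.single i 1 : 𝔼)).continuous.comp_stronglyMeasurable (fderiv_meas' φ)).aestronglyMeasurable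
      · filter_upwards [ae_restrict_mem measurableSet_closedBall] with x hx
        rw [norm_mul]
        have k1 : ‖fderiv ℝ φ x (EuclideanSpace.single i 1)‖ ≤ K := by
          refine (ContinuousLinearMap.le_opNorm _ _).trans ?_
          simpa using fderiv_le hφ x
        have k2 : ‖x i - c i‖ ≤ r + ‖c‖ := by
          have k3 := PiLp.norm_apply_le (x - c) i
          have k4 := norm_sub_le x c
          have k5 := mem_closedBall_zero_iff.1 hx
          have : (x - c) i = x i - c i := rfl
          rw [this] at k3; linarith
        gcongr
    rwa [integrableOn_iff_integrable_of_support_subset] at hio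
    intro x hx
    by_contra hn
    exact hx (hz x hn)

lemma gvec_mono (hg : GCond g) (p q : 𝔼) : 0 ≤ (⟪gvec g p - gvec g q, p - q⟫ : ℝ) := by
  have h1 := Br_nonneg hg p q
  have h2 := Br_nonneg hg q p
  unfold Br at h1 h2
  have : (⟪gvec g p - gvec g q, p - q⟫ : ℝ) = -⟪gvec g p, q - p⟫ - ⟪gvec g q, p - q⟫ := by
    rw [inner_sub_left, ← neg_sub q p, inner_neg_right]
  linarith

/-- Hopf boundary point argument -/
lemma hopf (hS : Sol R K M g f v) {c e : 𝔼} (he : ‖e‖ = 1) {ρ τ k : ℝ} (hρ : 0 < ρ) (hk : 0 < k)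
    (hsub : ball c ρ ⊆ ball (0:𝔼) R) (hmem : c + ρ • e ∈ ball (0:𝔼) R) (hge : ∀ x ∈ ball c ρ, τ ≤ v x) (hval : v (c + ρ • e) = τ)
    (hgrad : gradient v (c + ρ • e) = 0) (hfk : ∀ x ∈ ball c ρ, k ≤ f ‖x‖ (v x)) : False := by
  have hN : 0 < N := by
    rcases Nat.eq_zero_or_pos N with h0 | h0
    · subst h0; rw [Subsingleton.elim e 0, norm_zero] at he; norm_num at he
    · exact h0
  have hN' : (0:ℝ) < N := by exact_mod_cast hN
  have hne : Nonempty (Fin N) := ⟨⟨0, hN⟩⟩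
  have hg1 := g_pos hS.hg one_pos
  set k' := min (k / (2 * N)) (g 1 / ρ) with hk'
  have hk'0 : 0 < k' := lt_min (by positivity) (by positivity)
  have hk'1 : k' * ρ ≤ g 1 := by
    rw [← le_div_iff₀ hρ]; exact min_le_right _ _
  have hk'2 : k' * N ≤ k / 2 := by
    have : k' ≤ k / (2 * N) := min_le_left _ _
    calc k' * N ≤ k / (2 * N) * N := by gcongr
      _ = k / 2 := by field_simp
  obtain ⟨β, hβc, hβ0, hβ1, hβg⟩ := beta_exists hS.hg hk'0 hρ hk'1
  set Θ : ℝ → ℝ := fun s => -∫ y in ρ..s, β y with hΘ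
  have hΘd : ∀ s, HasDerivAt Θ (-β s) s := fun s =>
    (intervalIntegral.integral_hasDerivAt_right (hβc.intervalIntegrable _ _) hβc.stronglyMeasurable.stronglyMeasurableAtFilter hβc.continuousAt).neg
  have hΘl : LipschitzWith 1 Θ := by
    refine lipschitzWith_of_nnnorm_deriv_le (fun s => (hΘd s).differentiableAt) fun s => ?_
    rw [(hΘd s).deriv, ← NNReal.coe_le_coe, coe_nnnorm, norm_neg, Real.norm_of_nonneg (hβ0 s)]
    exact hβ1 s
  have hΘneg : ∀ s, ρ ≤ s → Θ s ≤ 0 := fun s hs => by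
    show -∫ y in ρ..s, β y ≤ 0
    have := intervalIntegral.integral_nonneg (μ := volume) hs (fun y _ => hβ0 y)
    linarith
  set ψ : 𝔼 → ℝ := fun x => τ + Θ ‖x - c‖ with hψ
  have hnl : LipschitzWith 1 fun x : 𝔼 => ‖x - c‖ := by
    refine LipschitzWith.of_dist_le_mul fun x y => ?_
    rw [Real.dist_eq, dist_eq_norm]
    simpa using abs_norm_sub_norm_le (x - c) (y - c)
  have hψl : LipschitzWith (1 * 1) ψ := by
    have := hΘl.comp hnl
    refine LipschitzWith.of_dist_le_mul fun x y => ?_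
    have h1 := this.dist_le_mul x y
    rw [Real.dist_eq] at h1 ⊢
    simpa [hψ] using h1
  set φ : 𝔼 → ℝ := fun x => max (ψ x - max (v x) τ) 0 with hφ
  have hφl : LipschitzWith (1 * 1 + K) φ := (hψl.sub (hS.adm.lip.max_const τ)).max_const 0
  have hφ0 : ∀ x, 0 ≤ φ x := fun x => le_max_right _ _
  have hφout : ∀ x, x ∉ ball c ρ → φ x = 0 := fun x hx => by
    show max (ψ x - max (v x) τ) 0 = 0
    apply max_eq_right
    have h1 : ρ ≤ ‖x - c‖ := by rw [← dist_eq_norm]; simpa using hx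
    have h2 := hΘneg _ h1
    have h3 := le_max_right (v x) τ
    show τ + Θ ‖x - c‖ - max (v x) τ ≤ 0
    linarith
  have hadm : Adm (1 * 1 + K) R φ := ⟨hφl, hφ0, fun x hx => hφout x fun h => hx (hsub h)⟩
  have key := hS.wk.adm hadm
  have hcs := hadm.compact
  have hdiv := div_int hφl hcs c
  -- pointwise inequality
  have hpt : ∀ x : 𝔼, x ≠ c → fderiv ℝ φ x (gvec g (gradient v x)) ≤ -k' * fderiv ℝ φ x (x - c) := fun x hxc => by
    rcases (hφ0 x).lt_or_eq with hpos | h0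
    · have hxb : x ∈ ball c ρ := by by_contra h; rw [hφout x h] at hpos; exact lt_irrefl _ hpos
      have hp : 0 < ‖x - c‖ := norm_pos_iff.2 (sub_ne_zero.2 hxc)
      have hxρ : ‖x - c‖ < ρ := by rw [← dist_eq_norm]; exact hxb
      have hnd : HasFDerivAt (fun x : 𝔼 => ‖x - c‖) ((1 / ‖x - c‖) • innerSL ℝ (x - c)) x := by
        have h1 := (hasStrictFDerivAt_norm_sq (x - c)).hasFDerivAt.comp x ((hasFDerivAt_id x).sub_const c)
        have h2 := h1.sqrt (by simpa using sub_ne_zero.2 hxc)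
        refine (h2.congr_fderiv ?_).congr_of_eventuallyEq (.of_forall fun y => ?_)
        · ext y
          simp [Real.sqrt_sq hp.le]
          field_simp
        · simp [Real.sqrt_sq (norm_nonneg (y - c))]
      have hψd : HasFDerivAt ψ ((-β ‖x - c‖) • (1 / ‖x - c‖) • innerSL ℝ (x - c)) x := by
        have h1 := (HasDerivAt.comp_hasFDerivAt (h₂ := Θ) x (hΘd ‖x - c‖) hnd).const_add τ
        exact h1
      have hvd : HasFDerivAt v (fderiv ℝ v x) x := (hS.strict (hsub hxb)).hasFDerivAt
      have hφd : HasFDerivAt φ ((-β ‖x - c‖) • (1 / ‖x - c‖) • innerSL ℝ (x - c) - fderiv ℝ v x) x := by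
        refine (hψd.sub hvd).congr_of_eventuallyEq ?_
        filter_upwards [isOpen_ball.mem_nhds hxb, (isOpen_lt continuous_const hφl.continuous).mem_nhds hpos] with y hy hy2
        have e1 : max (v y) τ = v y := max_eq_left (hge y hy)
        have hy2' : 0 < max (ψ y - max (v y) τ) 0 := hy2
        show max (ψ y - max (v y) τ) 0 = ψ y - v y
        rw [e1] at hy2' ⊢
        apply max_eq_left
        by_contra hc
        rw [max_eq_right (not_le.1 hc).le] at hy2'
        exact lt_irrefl _ hy2'
      set P : 𝔼 := (-β ‖x - c‖ / ‖x - c‖) • (x - c) with hP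
      have hφP : ∀ y, fderiv ℝ φ x y = ⟪P - gradient v x, y⟫ := fun y => by
        rw [hφd.fderiv, inner_sub_left, ← fderiv_eq_inner]
        simp only [_root_.sub_apply, _root_.smul_apply, innerSL_apply_apply, smul_eq_mul, hP, real_inner_smul_left]
        ring
      have hgP : gvec g P = -k' • (x - c) := by
        have hb := hβg ‖x - c‖ ⟨hp.le, hxρ.le⟩
        have hβp : 0 < β ‖x - c‖ := by
          rcases (hβ0 ‖x - c‖).lt_or_eq with h | h
          · exact h
          · rw [← h, hS.hg.2.2.1] at hb
            have := mul_pos hk'0 hp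
            linarith
        have hPn : ‖P‖ = β ‖x - c‖ := by
          rw [hP, norm_smul, Real.norm_eq_abs, abs_div, abs_neg, abs_of_pos hβp, abs_of_pos hp]; field_simp
        have hP0 : P ≠ 0 := by rw [← norm_pos_iff, hPn]; exact hβp
        rw [gvec, if_neg hP0, hPn, hb, hP, smul_smul]
        congr 1
        field_simp
      have hm := gvec_mono hS.hg P (gradient v x)
      rw [hφP, hφP]
      rw [hgP, real_inner_comm, inner_sub_right, real_inner_smul_right] at hm
      linarith
    · have : fderiv ℝ φ x = 0 := IsLocalMin.fderiv_eq_zero (.of_forall fun y => by rw [← h0]; exact hφ0 y)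
      rw [this]; simp
  have hfdout : ∀ x, x ∉ ball (0:𝔼) R → fderiv ℝ φ x = 0 := fun x hx =>
    IsLocalMin.fderiv_eq_zero (.of_forall fun y => by rw [hadm.zero x hx]; exact hφ0 y)
  have hi : IntegrableOn (fun x => fderiv ℝ φ x (x - c)) (ball (0:𝔼) R) := by
    refine Integrable.mono' (g := fun _ => ((1 * 1 + K : ℝ≥0) : ℝ) * (R + ‖c‖)) (integrable_const _) ?_ ?_
    · exact (ContinuousLinearMap.apply ℝ ℝ).aestronglyMeasurable_comp₂ (by fun_prop : Continuous fun x : 𝔼 => x - c).aestronglyMeasurable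
        (fderiv_meas' _).aestronglyMeasurable
    · filter_upwards [ae_restrict_mem measurableSet_ball] with x hx
      refine (ContinuousLinearMap.le_opNorm _ _).trans ?_
      have k4 := norm_sub_le x c
      have k5 := mem_ball_zero_iff.1 hx
      exact mul_le_mul (fderiv_le hφl x) (by linarith) (norm_nonneg _) (NNReal.coe_nonneg _)
  have h1 : (∫ x in ball (0:𝔼) R, fderiv ℝ φ x (gvec g (gradient v x))) ≤ k' * N * ∫ x, φ x := by
    have h2 : (∫ x in ball (0:𝔼) R, fderiv ℝ φ x (gvec g (gradient v x))) ≤ ∫ x in ball (0:𝔼) R, -k' * fderiv ℝ φ x (x - c) := by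
      refine integral_mono_ae (hS.wk.int_A hadm) (hi.const_mul _) ?_
      have : ∀ᵐ x : 𝔼, x ≠ c := by
        rw [ae_iff]; simp
      filter_upwards [ae_restrict_of_ae this] with x hx
      exact hpt x hx
    refine h2.trans (le_of_eq ?_)
    rw [setIntegral_eq_integral_of_forall_compl_eq_zero, integral_const_mul, hdiv]
    · ring
    · intro x hx; rw [hfdout x hx]; simp
  have h3 : k * ∫ x, φ x ≤ ∫ x in ball (0:𝔼) R, f ‖x‖ (v x) * φ x := by
    rw [← adm_int_ball hadm, ← integral_const_mul]
    refine setIntegral_mono_on ((cont_intOn hφl.continuous).const_mul _) (hS.wk.int_h hadm) measurableSet_ball fun x hx => ?_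
    by_cases hxb : x ∈ ball c ρ
    · exact mul_le_mul_of_nonneg_right (hfk x hxb) (hφ0 x)
    · rw [hφout x hxb]; simp
  have h4 : (∫ x, φ x) ≤ 0 := by
    by_contra hc
    push Not at hc
    have : k' * N * ∫ x, φ x ≤ k / 2 * ∫ x, φ x := by gcongr
    nlinarith
  have h5 : ∀ x, φ x = 0 := by
    by_contra hc
    push Not at hc
    obtain ⟨x, hx⟩ := hc
    have := hφl.continuous.integral_pos_of_hasCompactSupport_nonneg_nonzero (μ := volume) hcs hφ0 hx
    linarith
  -- conclusion
  have hline := hS.line hmem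
  rw [fderiv_eq_inner, hgrad, inner_zero_left] at hline
  have hd := hline.sub ((hΘd ρ).const_add τ)
  have hle := deriv_nonpos_left hρ hd fun s hs => by
    have hΘρ : Θ ρ = 0 := by simp [hΘ]
    have hn : ‖c + s • e - c‖ = s := by rw [add_sub_cancel_left, norm_smul, he, Real.norm_of_nonneg hs.1, mul_one]
    have hb : c + s • e ∈ ball c ρ := by rw [mem_ball, dist_eq_norm, hn]; exact hs.2
    have h6 := h5 (c + s • e)
    have h7 : ψ (c + s • e) - max (v (c + s • e)) τ ≤ 0 := by rw [← h6]; exact le_max_left _ _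
    have h8 : ψ (c + s • e) = τ + Θ s := by show τ + Θ ‖c + s • e - c‖ = _; rw [hn]
    rw [max_eq_left (hge _ hb), h8] at h7
    simp only [Pi.sub_apply, hval, hΘρ]
    linarith
  have hb := hβg ρ ⟨hρ.le, le_rfl⟩
  have : β ρ = 0 := le_antisymm (by linarith) (hβ0 ρ)
  rw [this, hS.hg.2.2.1] at hb
  have := mul_pos hk'0 hρ
  linarith
end
end CS
end

section
open Set Metric MeasureTheory Bornology Filter Topology
open scoped RealInnerProductSpace Classical NNReal

namespace CS
set_option linter.unusedSectionVars false
set_option linter.unusedVariables false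
set_option linter.unusedSimpArgs false

section
variable {N : ℕ} {g : ℝ → ℝ} {f : ℝ → ℝ → ℝ} {K : ℝ≥0} {R M : ℝ} {v : EuclideanSpace ℝ (Fin N) → ℝ}
local notation "𝔼" => EuclideanSpace ℝ (Fin N)

lemma sph_repr {z y : 𝔼} {r : ℝ} (hr : 0 < r) (hy : y ∈ sphere z r) : ‖(1 / r) • (y - z)‖ = 1 ∧ z + r • ((1 / r) • (y - z)) = y := by
  constructor
  · rw [norm_smul, ← dist_eq_norm, mem_sphere.1 hy, Real.norm_of_nonneg (by positivity)]; field_simp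
  · rw [smul_smul, mul_one_div_cancel hr.ne', one_smul]; abel

lemma memAg_zero : MemAg g (fun _ => 0) :=
  ⟨continuousOn_const, fun _ _ => le_rfl, rfl, Or.inl ⟨1, one_pos, fun _ _ => rfl⟩⟩

/-- the two non-Hopf cases give the same one-sided bound -/
lemma bound_phi (hR : 0 < R) (hf : FCond R f) (ha : CondA R g f) {ρ τ : ℝ} (hρ : ρ ∈ Ico (0:ℝ) R) (hτ : 0 < τ) (h : f ρ τ ≤ 0) :
    ∃ δ ∈ Ioo (0:ℝ) τ, ∃ φ : ℝ → ℝ, MemAg g φ ∧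
      ∀ t ∈ Icc (τ - δ) τ, ∀ r ∈ Icc (ρ - δ) (ρ + δ) ∩ Icc (0:ℝ) R, f r t ≤ φ (τ - t) := by
  rcases h.lt_or_eq with h | h
  · have h1 := hf.1 (ρ, τ) ⟨⟨hρ.1, hρ.2.le⟩, mem_Ici.2 hτ.le⟩
    obtain ⟨ε, hε, h2⟩ := Metric.continuousWithinAt_iff.1 h1 (-f ρ τ) (by linarith)
    have hm : 0 < min (ε / 2) (τ / 2) := lt_min (by linarith) (by linarith)
    have ml := min_le_left (ε / 2) (τ / 2)
    have mr := min_le_right (ε / 2) (τ / 2)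
    refine ⟨min (ε / 2) (τ / 2), ⟨hm, by linarith⟩, fun _ => 0, memAg_zero, fun t ht r hr => ?_⟩
    have h3 := h2 (x := (r, t)) ⟨hr.2, mem_Ici.2 (by linarith [ht.1])⟩ (by
      rw [Prod.dist_eq, max_lt_iff, Real.dist_eq, Real.dist_eq, abs_lt, abs_lt]
      refine ⟨⟨?_, ?_⟩, ?_, ?_⟩ <;> simp only <;> linarith [ht.1, ht.2, hr.1.1, hr.1.2])
    rw [Real.dist_eq, abs_lt] at h3
    have := h3.2
    simp only at this
    linarith
  · exact ha ρ hρ τ hτ h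

lemma exists_near (z e : 𝔼) (he : ‖e‖ = 1) {r : ℝ} (hr : 0 < r) : ∃ d : 𝔼, ‖d‖ = 1 ∧ ‖z + r • d‖ = |‖z‖ - r| := by
  by_cases hz : z = 0
  · exact ⟨e, he, by rw [hz]; simp [norm_smul, he]⟩
  · have hz' := norm_pos_iff.2 hz
    refine ⟨(-1 / ‖z‖) • z, ?_, ?_⟩
    · rw [norm_smul, Real.norm_eq_abs, abs_div, abs_neg, abs_one, abs_norm]; field_simp
    · have : z + r • ((-1 / ‖z‖) • z) = ((‖z‖ - r) / ‖z‖) • z := by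
        rw [smul_smul, sub_div, sub_smul, div_self hz'.ne', one_smul, sub_eq_add_neg, ← neg_smul]
        congr 2; ring
      rw [this, norm_smul, Real.norm_eq_abs, abs_div, abs_norm]; field_simp

lemma rad_close (hS : Sol R K M g f v) (ha : CondA R g f) {z e : 𝔼} (he : ‖e‖ = 1) {r1 r0 : ℝ} (hr1 : 0 < r1) (h10 : r1 < r0)
    (hrad : ∀ r ∈ Ioc r1 r0, Rad v z r) : Rad v z r1 := by
  by_contra hn
  have hev : ∀ᶠ r in 𝓝[>] r1, Rad v z r := by
    filter_upwards [Ioc_mem_nhdsGT h10] with r hr using hrad r hr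
  have hgr : ∀ d : 𝔼, ‖d‖ = 1 → gradient v (z + r1 • d) = 0 := fun d hd => by
    by_contra hc
    exact hn (Rad.cls hS hd hr1 nhdsWithin_le_nhds hev hc)
  set U : ℝ → ℝ := fun r => v (z + r • e) with hU
  have hUc : Continuous U := hS.cont.comp (by fun_prop)
  set τ := U r1 with hτ
  have hsame : ∀ d : 𝔼, ‖d‖ = 1 → v (z + r1 • d) = τ := fun d hd => by
    have h1 : Tendsto (fun r : ℝ => v (z + r • d)) (𝓝[>] r1) (𝓝 (v (z + r1 • d))) :=
      ((hS.cont.comp (by fun_prop : Continuous fun r : ℝ => z + r • d)).continuousAt.tendsto).mono_left nhdsWithin_le_nhds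
    have h2 : Tendsto U (𝓝[>] r1) (𝓝 τ) := hUc.continuousAt.tendsto.mono_left nhdsWithin_le_nhds
    refine tendsto_nhds_unique h1 (h2.congr' ?_)
    filter_upwards [hev] with r hr
    exact hr.val (sph_mem he hr.pos.le) (sph_mem hd hr.pos.le)
  have hin : ∀ x ∈ ball z r1, τ ≤ v x := fun x hx => by
    have h2 : Tendsto U (𝓝[>] r1) (𝓝 τ) := hUc.continuousAt.tendsto.mono_left nhdsWithin_le_nhds
    refine le_of_tendsto h2 ?_
    filter_upwards [hev, self_mem_nhdsWithin] with r hr hr2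
    exact (hr.lt (sph_mem he hr.pos.le) (ball_subset_ball (le_of_lt hr2) hx)).le
  have hUlt : ∀ r ∈ Ioc r1 r0, U r < τ := fun r hr => by
    refine (hrad r hr).lt (sph_mem he (hr1.trans hr.1).le) ?_
    rw [mem_ball, mem_sphere.1 (sph_mem he hr1.le)]; exact hr.1
  have hτ0 : 0 < τ := (hS.adm.nn _).trans_lt (hUlt r0 ⟨h10, le_rfl⟩)
  have hbR : ball z r1 ⊆ ball (0:𝔼) R := fun x hx => hS.mem_of_pos (hτ0.trans_le (hin x hx))
  obtain ⟨d, hd, hdn⟩ := exists_near z e he hr1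
  set ρ := |‖z‖ - r1| with hρ
  have hy0R : z + r1 • d ∈ ball (0:𝔼) R := hS.mem_of_pos (by rw [hsame d hd]; exact hτ0)
  have hρR : ρ ∈ Ico (0:ℝ) R := ⟨abs_nonneg _, by rw [← hdn]; exact mem_ball_zero_iff.1 hy0R⟩
  rcases lt_or_ge 0 (f ρ τ) with hfp | hfn
  · -- Hopf case
    have hfc : ContinuousAt (fun x : 𝔼 => f ‖x‖ (v x)) (z + r1 • d) := by
      have h1 : ContinuousOn (fun x : 𝔼 => f ‖x‖ (v x)) (ball (0:𝔼) R) :=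
        hS.hf.1.comp (f := fun x : 𝔼 => (‖x‖, v x)) (by have := hS.cont; fun_prop) fun x hx =>
          ⟨⟨norm_nonneg _, (mem_ball_zero_iff.1 hx).le⟩, mem_Ici.2 (hS.adm.nn x)⟩
      exact h1.continuousAt (isOpen_ball.mem_nhds hy0R)
    have hv0 : f ‖z + r1 • d‖ (v (z + r1 • d)) = f ρ τ := by rw [hdn, hsame d hd]
    have hev2 := hfc.eventually (lt_mem_nhds (show f ρ τ / 2 < f ‖z + r1 • d‖ (v (z + r1 • d)) by rw [hv0]; linarith))
    obtain ⟨ε, hε, hb⟩ := Metric.eventually_nhds_iff_ball.1 hev2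
    set s := min (r1 / 2) (ε / 2) with hs
    have hs0 : 0 < s := lt_min (by linarith) (by linarith)
    have hs1 : s ≤ r1 / 2 := min_le_left _ _
    have hs2 : s ≤ ε / 2 := min_le_right _ _
    have hc : z + (r1 - s) • d + s • d = z + r1 • d := by rw [add_assoc, ← add_smul]; congr 2; ring
    have hbz : ball (z + (r1 - s) • d) s ⊆ ball z r1 := by
      refine ball_subset_ball' ?_
      rw [dist_eq_norm, add_sub_cancel_left, norm_smul, hd, Real.norm_of_nonneg (by linarith)]; linarith
    have hby : ball (z + (r1 - s) • d) s ⊆ ball (z + r1 • d) ε := by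
      refine ball_subset_ball' ?_
      rw [← hc, dist_eq_norm, sub_add_cancel_left, norm_neg, norm_smul, hd, Real.norm_of_nonneg hs0.le]; linarith
    refine hopf hS hd (c := z + (r1 - s) • d) hs0 (half_pos hfp) (hbz.trans hbR) ?_ (fun x hx => hin x (hbz hx)) ?_ ?_
      (fun x hx => (hb x (hby hx)).le)
    · rw [hc]; exact hy0R
    · rw [hc]; exact hsame d hd
    · rw [hc]; exact hgr d hd
  · obtain ⟨δ, hδ, φ, hφ, hb⟩ := bound_phi hS.hR hS.hf ha hρR hτ0 hfn
    obtain ⟨ε, hε, hε2⟩ := Metric.continuousAt_iff.1 (hUc.continuousAt (x := r1)) δ hδ.1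
    set r2 := min r0 (r1 + min δ ε) with hr2
    have hmin : 0 < min δ ε := lt_min hδ.1 hε
    have hr12 : r1 < r2 := lt_min h10 (by linarith)
    have hr20 : r2 ≤ r0 := min_le_left _ _
    have hr2δ : r2 ≤ r1 + δ := (min_le_right _ _).trans (by linarith [min_le_left δ ε])
    have hr2ε : r2 ≤ r1 + ε := (min_le_right _ _).trans (by linarith [min_le_right δ ε])
    have hrad2 : ∀ r ∈ Ioo r1 r2, Rad v z r := fun r hr => hrad r ⟨hr.1, hr.2.le.trans hr20⟩
    set q : ℝ → ℝ := fun r => φ (max (τ - U r) 0) with hq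
    have hqc : Continuous q := hφ.1.comp_continuous (by fun_prop) fun r => mem_Ici.2 (le_max_right _ _)
    have hq0 : ∀ r, 0 ≤ q r := fun r => hφ.2.1 _ (le_max_right _ _)
    have hqe : ∀ r ∈ Ico r1 r2, q r = φ (τ - U r) := fun r hr => by
      show φ (max (τ - U r) 0) = _
      rw [max_eq_left]
      rcases hr.1.lt_or_eq with h | h
      · have := hUlt r ⟨h, hr.2.le.trans hr20⟩; linarith
      · rw [← h, hτ, sub_self]
    have hfq : ∀ x, ‖x - z‖ ∈ Ioo r1 r2 → f ‖x‖ (v x) ≤ q ‖x - z‖ := fun x hx => by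
      have hRx := hrad2 _ hx
      have hxs : x ∈ sphere z ‖x - z‖ := by simp [mem_sphere, dist_eq_norm]
      have hxR := mem_ball_zero_iff.1 (mem_of_grad hS (hRx.reg hxs))
      have hvx : v x = U ‖x - z‖ := hRx.val hxs (sph_mem he hRx.pos.le)
      have hle : |‖z‖ - ‖x - z‖| ≤ ‖x‖ := by
        have h1 := abs_norm_sub_norm_le z (z - x)
        rw [norm_sub_rev z x, sub_sub_cancel] at h1
        exact h1
      rw [hqe _ ⟨hx.1.le, hx.2⟩, hvx]
      refine (hS.hf.2 _ (hvx ▸ hS.adm.nn x) _ ⟨abs_nonneg _, hle.trans hxR.le⟩ _ ⟨norm_nonneg _, hxR.le⟩ hle).trans ?_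
      have hUr := hUlt _ ⟨hx.1, hx.2.le.trans hr20⟩
      refine hb _ ⟨?_, hUr.le⟩ _ ⟨⟨?_, ?_⟩, abs_nonneg _, hle.trans hxR.le⟩
      · have := hε2 (x := ‖x - z‖) (by rw [Real.dist_eq, abs_of_pos (by linarith [hx.1])]; linarith [hx.2])
        rw [Real.dist_eq, abs_lt] at this
        linarith [this.1]
      · have := abs_abs_sub_abs_le_abs_sub (‖z‖ - ‖x - z‖) (‖z‖ - r1)
        rw [show ‖z‖ - ‖x - z‖ - (‖z‖ - r1) = -(‖x - z‖ - r1) by ring, abs_neg, abs_of_pos (by linarith [hx.1] : 0 < ‖x - z‖ - r1)] at this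
        have := (abs_le.1 this).1
        linarith [hx.2]
      · have := abs_abs_sub_abs_le_abs_sub (‖z‖ - ‖x - z‖) (‖z‖ - r1)
        rw [show ‖z‖ - ‖x - z‖ - (‖z‖ - r1) = -(‖x - z‖ - r1) by ring, abs_neg, abs_of_pos (by linarith [hx.1] : 0 < ‖x - z‖ - r1)] at this
        have := (abs_le.1 this).2
        linarith [hx.2]
    have hm : z + r1 • e ∈ ball (0:𝔼) R := hS.mem_of_pos hτ0
    have hw1 : fderiv ℝ v (z + r1 • e) e = 0 := by rw [fderiv_eq_inner, hgr e he, inner_zero_left]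
    set b := (r1 + r2) / 2 with hbb
    have hb1 : r1 < b := by linarith
    have hb2 : b < r2 := by linarith
    have hmem : ∀ r ∈ Icc r1 b, z + r • e ∈ ball (0:𝔼) R := fun r hr => by
      rcases hr.1.lt_or_eq with h | h
      · exact mem_of_grad hS ((hrad2 r ⟨h, hr.2.trans_lt hb2⟩).reg (sph_mem he (hr1.trans h).le))
      · rw [← h]; exact hm
    refine ode_contra hS.hg hφ (V := fun r => τ - U r) (w := fun r => -fderiv ℝ v (z + r • e) e) hb1 (by simp [hτ]) (by simp [hw1])
      ?_ ?_ ?_ ?_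
    · intro r hr
      exact (hS.line (hmem r hr)).const_sub τ
    · intro r hr
      have h3 : ContinuousAt (fun y : ℝ => fderiv ℝ v (z + y • e) e) r :=
        (ContinuousAt.comp (g := fderiv ℝ v) (f := fun y : ℝ => z + y • e) (hS.contDv (hmem r hr)) (by fun_prop)).clm_apply continuousAt_const
      exact h3.neg.continuousWithinAt
    · intro r hr
      have := (hrad2 r ⟨hr.1, hr.2.trans_lt hb2⟩).dlt he
      show 0 < -fderiv ℝ v (z + r • e) e
      linarith
    · intro s t hs hst ht
      have := rad_ineq hS he hr1.le hrad2 hm hw1.le hqc (fun r _ => hq0 r) hfq hs (ht.trans_lt hb2) hst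
      refine this.trans (le_of_eq ?_)
      refine intervalIntegral.integral_congr fun r hr => ?_
      rw [uIcc_of_le hst.le] at hr
      exact hqe r ⟨hs.trans hr.1, (hr.2.trans ht).trans_lt hb2⟩

/-- a regular sphere is the boundary of a ball filled by regular spheres -/
lemma rad_all (hS : Sol R K M g f v) (ha : CondA R g f) {z e : 𝔼} (he : ‖e‖ = 1) {r0 : ℝ} (h : Rad v z r0) :
    ∀ r ∈ Ioc 0 r0, Rad v z r := by
  by_contra hc
  push Not at hc
  obtain ⟨r', hr', hn⟩ := hc
  set S : Set ℝ := {r | r ∈ Ioc 0 r0 ∧ ¬ Rad v z r} with hSS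
  have hbdd : BddAbove S := ⟨r0, fun r hr => hr.1.2⟩
  have hne : S.Nonempty := ⟨r', hr', hn⟩
  set r1 := sSup S with hr1
  have h1 : r' ≤ r1 := le_csSup hbdd ⟨hr', hn⟩
  have h2 : r1 ≤ r0 := csSup_le hne fun r hr => hr.1.2
  have h3 : ∀ r ∈ Ioc r1 r0, Rad v z r := fun r hr => by
    by_contra hcc
    exact absurd (le_csSup hbdd (show r ∈ S from ⟨⟨(hr'.1.trans_le h1).trans hr.1, hr.2⟩, hcc⟩)) (not_le.2 hr.1)
  have h4 : Rad v z r1 := by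
    rcases h2.lt_or_eq with h5 | h5
    · exact rad_close hS ha he (hr'.1.trans_le h1) h5 h3
    · rw [h5]; exact h
  obtain ⟨ε, hε, hb⟩ := Metric.eventually_nhds_iff_ball.1 (h4.opn hS he)
  obtain ⟨r, hr, hlt⟩ := exists_lt_of_lt_csSup hne (show r1 - ε < sSup S by linarith)
  refine hr.2 (hb r ?_)
  have := le_csSup hbdd hr
  rw [mem_ball, Real.dist_eq, abs_lt]
  constructor <;> linarith
end
end CS
end

section
open Set Metric MeasureTheory Bornology Filter Topology
open scoped RealInnerProductSpace Classical NNReal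

namespace CS
set_option linter.unusedSectionVars false
set_option linter.unusedVariables false
set_option linter.unusedSimpArgs false

section
variable {N : ℕ} {g : ℝ → ℝ} {f : ℝ → ℝ → ℝ} {K : ℝ≥0} {R M : ℝ} {v : EuclideanSpace ℝ (Fin N) → ℝ}
local notation "𝔼" => EuclideanSpace ℝ (Fin N)

/-- every point of positivity lies inside a regular level sphere -/
lemma cover (hS : Sol R K M g f v) {e y0 : 𝔼} (he : ‖e‖ = 1) (hy : 0 < v y0) :
    ∃ z r, Rad v z r ∧ y0 ∈ ball z r := by
  have he0 : e ≠ 0 := by rintro rfl; simp at he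
  obtain ⟨l, hl, hreg⟩ := sard_line hS y0 e hy
  obtain ⟨b, hb, hvb⟩ := far_zero hS y0 he0
  have hφ : Continuous (fun τ : ℝ => v (y0 + τ • e)) := hS.cont.comp (by fun_prop)
  obtain ⟨c, hc, hc1, hc2⟩ := first_hit (φ := fun τ : ℝ => v (y0 + τ • e)) (l := l) hφ hb.le
    (by simpa using hl.2) (by show v (y0 + b • e) ≤ l; rw [hvb]; exact hl.1.le)
  have hc1' : v (y0 + c • e) = l := hc1
  have hxm : y0 + c • e ∈ ball (0:𝔼) R := hS.mem_of_pos (by rw [hc1']; exact hl.1)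
  have hd := hS.line (x := y0) (τ := c) (w := e) hxm
  have h1 : fderiv ℝ v (y0 + c • e) e ≤ 0 := deriv_nonpos_left hc.1 hd fun τ hτ => by
    have : l < v (y0 + τ • e) := hc2 τ hτ
    show v (y0 + c • e) ≤ v (y0 + τ • e)
    linarith
  have h2 : fderiv ℝ v (y0 + c • e) e < 0 := lt_of_le_of_ne h1 (hreg c hxm hc1')
  rw [fderiv_eq_inner] at h2
  have hg0 : gradient v (y0 + c • e) ≠ 0 := by intro h; rw [h] at h2; simp at h2
  set x := y0 + c • e with hx
  have hRad := Rad.of_reg hS hg0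
  set z := ZZ v x with hz
  set r := dist x z with hr
  have hxs : x ∈ sphere z r := mem_sphere.2 rfl
  refine ⟨z, r, hRad, ?_⟩
  obtain ⟨τ, k, hk, hin, hon⟩ := hRad.prop
  rw [(hon x hxs).2, real_inner_smul_left] at h2
  have hs : 0 < ⟪x - z, e⟫ := by
    have : ⟪z - x, e⟫ < 0 := by
      by_contra hcc; push Not at hcc
      nlinarith [mul_nonneg hk.le hcc]
    rw [← neg_sub, inner_neg_left] at this; linarith
  set s := ⟪x - z, e⟫ with hsd
  have key : ∀ t : ℝ, ‖y0 + t • e - z‖ ^ 2 = r ^ 2 + 2 * (t - c) * s + (t - c) ^ 2 := fun t => by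
    have : y0 + t • e - z = (x - z) + (t - c) • e := by rw [hx, sub_smul]; abel
    rw [this, norm_add_sq_real, real_inner_smul_right, norm_smul, he, hr, dist_eq_norm, Real.norm_eq_abs, mul_one, sq_abs]
    ring
  by_contra hcon
  rw [mem_ball, not_lt, dist_eq_norm] at hcon
  have k0 := key 0
  rw [zero_smul, add_zero] at k0
  have hrp := hRad.pos
  have h3 : r ^ 2 ≤ ‖y0 - z‖ ^ 2 := by gcongr
  have h4 : 2 * s ≤ c := by
    by_contra hcc; push Not at hcc
    nlinarith [hc.1]
  have k1 := key (c - 2 * s)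
  have k2 : ‖y0 + (c - 2 * s) • e - z‖ = r := by
    have : ‖y0 + (c - 2 * s) • e - z‖ ^ 2 = r ^ 2 := by rw [k1]; ring
    exact (pow_left_inj₀ (norm_nonneg _) hrp.le two_ne_zero).1 this
  have h5 := hRad.val (show y0 + (c - 2 * s) • e ∈ sphere z r by rw [mem_sphere, dist_eq_norm, k2]) hxs
  have h6 : l < v (y0 + (c - 2 * s) • e) := hc2 _ ⟨by linarith, by linarith⟩
  linarith

/-- a maximal ball -/
structure MB (v : EuclideanSpace ℝ (Fin N) → ℝ) (z : EuclideanSpace ℝ (Fin N)) (r : ℝ) : Prop where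
  pos : 0 < r
  rad : ∀ ρ ∈ Ioo 0 r, Rad v z ρ
  bd : ∀ y ∈ sphere z r, v y = 0
  ins : ∀ y ∈ ball z r, 0 < v y

lemma Rad.maxi (hS : Sol R K M g f v) (ha : CondA R g f) {z e : 𝔼} (he : ‖e‖ = 1) {r0 : ℝ} (h : Rad v z r0) :
    ∃ r, r0 ≤ r ∧ MB v z r := by
  set S : Set ℝ := {r | Rad v z r} with hSS
  have hbdd : BddAbove S := by
    refine ⟨R, fun r hr => ?_⟩
    have hr' : Rad v z r := hr
    have a1 := mem_of_grad hS (hr'.reg (sph_mem he hr'.pos.le))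
    have he' : ‖-e‖ = 1 := by rwa [norm_neg]
    have a2 := mem_of_grad hS (hr'.reg (sph_mem he' hr'.pos.le))
    rw [mem_ball_zero_iff] at a1 a2
    have a3 : ‖(z + r • e) - (z + r • (-e))‖ = 2 * r := by
      have : (z + r • e) - (z + r • (-e)) = (2 * r) • e := by rw [smul_neg, mul_smul, two_smul]; abel
      rw [this, norm_smul, he, mul_one, Real.norm_of_nonneg (by linarith [hr'.pos])]
    have a4 := norm_sub_le (z + r • e) (z + r • (-e))
    linarith
  have hne : S.Nonempty := ⟨r0, h⟩
  set r2 := sSup S with hr2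
  have h0 : r0 ≤ r2 := le_csSup hbdd h
  have hpos : 0 < r2 := h.pos.trans_le h0
  have hrad : ∀ ρ ∈ Ioo 0 r2, Rad v z ρ := fun ρ hρ => by
    obtain ⟨r', hr', hlt⟩ := exists_lt_of_lt_csSup hne hρ.2
    exact rad_all hS ha he hr' ρ ⟨hρ.1, hlt.le⟩
  have hnot : ¬ Rad v z r2 := fun hc => by
    obtain ⟨ε, hε, hb⟩ := Metric.eventually_nhds_iff_ball.1 (hc.opn hS he)
    have := le_csSup hbdd (show r2 + ε / 2 ∈ S from hb _ (by rw [mem_ball, Real.dist_eq, abs_lt]; constructor <;> linarith))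
    linarith
  refine ⟨r2, h0, hpos, hrad, fun y hy => ?_, fun y hy => ?_⟩
  · obtain ⟨he', hye⟩ := sph_repr hpos hy
    set e' := (1 / r2) • (y - z) with hee
    have hg0 : gradient v y = 0 := by
      by_contra hc
      refine hnot (Rad.cls hS he' hpos (l := 𝓝[<] r2) nhdsWithin_le_nhds ?_ (by rw [hye]; exact hc))
      filter_upwards [Ioo_mem_nhdsLT hpos] with ρ hρ using hrad ρ hρ
    by_contra hv0
    have hvp : 0 < v y := lt_of_le_of_ne (hS.adm.nn y) (Ne.symm hv0)
    obtain ⟨z', r', hR', hy'⟩ := cover hS he hvp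
    have hzy : y = z' := by
      by_contra hne'
      have hd : 0 < dist y z' := dist_pos.2 hne'
      exact (rad_all hS ha he hR' (dist y z') ⟨hd, (mem_ball.1 hy').le⟩).reg (mem_sphere.2 rfl) hg0
    set m := min (r2 / 2) r' with hm
    have hmp : 0 < m := lt_min (by linarith) hR'.pos
    have hm1 : m ≤ r2 / 2 := min_le_left _ _
    have hm2 : m ≤ r' := min_le_right _ _
    have hRm : Rad v y m := by rw [hzy]; exact rad_all hS ha he hR' m ⟨hmp, hm2⟩
    have b1 : v (z + (r2 - m) • e') < v y := by
      refine hRm.lt ?_ (mem_ball_self hmp)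
      rw [mem_sphere, dist_eq_norm]
      have : z + (r2 - m) • e' - y = (-m) • e' := by rw [← hye, sub_smul, neg_smul]; abel
      rw [this, norm_smul, he', mul_one, norm_neg, Real.norm_of_nonneg hmp.le]
    have b2 : v (z + r2 • e') ≤ v (z + (r2 - m) • e') := by
      have hcon : Continuous (fun t : ℝ => v (z + t • e')) := hS.cont.comp (by fun_prop)
      have ht : Tendsto (fun t : ℝ => v (z + t • e')) (𝓝[<] r2) (𝓝 (v (z + r2 • e'))) :=
        (hcon.tendsto r2).mono_left nhdsWithin_le_nhds
      refine le_of_tendsto ht ?_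
      filter_upwards [Ioo_mem_nhdsLT (show r2 - m < r2 by linarith)] with t ht
      have ht0 : 0 < t := by linarith [ht.1]
      refine ((hrad t ⟨ht0, ht.2⟩).lt (sph_mem he' ht0.le) ?_).le
      have := sph_mem (z := z) he' (show 0 ≤ r2 - m by linarith)
      rw [mem_ball, mem_sphere.1 this]; exact ht.1
    rw [hye] at b2
    linarith
  · obtain ⟨t, ht1, ht2⟩ := exists_between (mem_ball.1 hy)
    have ht0 : 0 < t := dist_nonneg.trans_lt ht1
    have := (hrad t ⟨ht0, ht2⟩).lt (sph_mem he ht0.le) (mem_ball.2 ht1)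
    exact (hS.adm.nn _).trans_lt this

lemma MB.sub {z z' x : 𝔼} {r r' : ℝ} (h : MB v z r) (h' : MB v z' r') (hx : x ∈ ball z r) (hx' : x ∈ ball z' r') :
    ball z' r' ⊆ ball z r := by
  intro y hy
  by_contra hc
  rw [mem_ball, not_lt] at hc
  have hp : IsPreconnected (ball z' r') := (convex_ball z' r').isPreconnected
  obtain ⟨w, hw, hwr⟩ := hp.intermediate_value hx' hy (f := fun y => dist y z) (by fun_prop) (show r ∈ Icc (dist x z) (dist y z) from ⟨(mem_ball.1 hx).le, hc⟩)
  exact (h'.ins w hw).ne' (h.bd w (mem_sphere.2 hwr))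

lemma MB.exists (hS : Sol R K M g f v) (ha : CondA R g f) {e y : 𝔼} (he : ‖e‖ = 1) (hy : 0 < v y) :
    ∃ z r, MB v z r ∧ y ∈ ball z r := by
  obtain ⟨z, r, h1, h2⟩ := cover hS he hy
  obtain ⟨r2, h3, h4⟩ := h1.maxi hS ha he
  exact ⟨z, r2, h4, ball_subset_ball h3 h2⟩

end
end CS
end

section
open Set Metric MeasureTheory Bornology Filter Topology
open scoped RealInnerProductSpace Classical NNReal

namespace CS
set_option linter.unusedSectionVars false
set_option linter.unusedVariables false
set_option linter.unusedSimpArgs false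

section
variable {N : ℕ} {g : ℝ → ℝ} {f : ℝ → ℝ → ℝ} {K : ℝ≥0} {R M : ℝ} {v : EuclideanSpace ℝ (Fin N) → ℝ}
local notation "𝔼" => EuclideanSpace ℝ (Fin N)

lemma MB.mem (hS : Sol R K M g f v) {z : 𝔼} {r : ℝ} (h : MB v z r) : ball z r ⊆ ball (0:𝔼) R :=
  fun y hy => hS.mem_of_pos (h.ins y hy)

lemma MB.profile {u : EuclideanSpace ℝ (Fin N) → ℝ} (hS : Sol R K M g f (ut R u)) (hu : ContDiffOn ℝ 1 u (closedBall 0 R))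
    (hu0 : ∀ x ∈ sphere (0:EuclideanSpace ℝ (Fin N)) R, u x = 0) {e z : 𝔼} (he : ‖e‖ = 1) {r : ℝ}
    (h : MB (ut R u) z r) :
    C1On (fun t => u (z + t • e)) (fun t => fderivWithin ℝ u (closedBall 0 R) (z + t • e) e) 0 r ∧
    (∀ x ∈ ball z r, u x = u (z + ‖x - z‖ • e)) ∧ u (z + r • e) = 0 ∧
    ∀ t ∈ Ioo (0:ℝ) r, fderivWithin ℝ u (closedBall 0 R) (z + t • e) e < 0 := by
  have hsub := h.mem hS
  have hR := hS.hR
  have hcl : closedBall z r ⊆ closedBall (0:𝔼) R := by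
    have := closure_mono hsub
    rwa [closure_ball _ h.pos.ne', closure_ball _ hR.ne'] at this
  have hpm : MapsTo (fun t : ℝ => z + t • e) (Icc 0 r) (closedBall (0:𝔼) R) := fun t ht => hcl (by
    have := sph_mem (z := z) he ht.1
    rw [mem_closedBall, mem_sphere.1 this]; exact ht.2)
  have hpb : ∀ t ∈ Ico 0 r, z + t • e ∈ ball z r := fun t ht => by
    have := sph_mem (z := z) he ht.1
    rw [mem_ball, mem_sphere.1 this]; exact ht.2
  have hud : UniqueDiffOn ℝ (closedBall (0:𝔼) R) :=
    uniqueDiffOn_convex (convex_closedBall _ _) (by rw [interior_closedBall _ hR.ne']; exact ⟨0, mem_ball_self hR⟩)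
  refine ⟨⟨?_, fun t ht => ?_⟩, fun x hx => ?_, ?_, fun t ht => ?_⟩
  · have h1 := hu.continuousOn_fderivWithin hud le_rfl
    have h2 : ContinuousOn (fun t : ℝ => z + t • e) (Icc 0 r) := by fun_prop
    exact (h1.comp h2 hpm).clm_apply continuousOn_const
  · have h1 := ((hu.differentiableOn (by norm_num)) _ (hpm ht)).hasFDerivWithinAt
    have h2 : HasDerivAt (fun t : ℝ => z + t • e) e t := by
      simpa using ((hasDerivAt_id t).smul_const e).const_add z
    exact h1.comp_hasDerivWithinAt t h2.hasDerivWithinAt hpm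
  · by_cases hxz : x = z
    · subst hxz; simp
    have hd : 0 < dist x z := dist_pos.2 hxz
    have hd' : dist x z < r := mem_ball.1 hx
    rw [← dist_eq_norm, ← ut_eq (u := u) (hsub hx), ← ut_eq (u := u) (hsub (hpb _ ⟨hd.le, hd'⟩))]
    exact (h.rad _ ⟨hd, hd'⟩).val (mem_sphere.2 rfl) (sph_mem he hd.le)
  · have hm := hpm (show r ∈ Icc 0 r from ⟨h.pos.le, le_rfl⟩)
    have hm' : z + r • e ∈ closedBall (0:𝔼) R := hm
    rcases (mem_closedBall.1 hm').lt_or_eq with h1 | h1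
    · rw [← ut_eq (u := u) (mem_ball.2 h1)]; exact h.bd _ (sph_mem he h.pos.le)
    · exact hu0 _ (mem_sphere.2 h1)
  · have hm := hsub (hpb t ⟨ht.1.le, ht.2⟩)
    have h1 := (h.rad t ht).dlt he
    rw [fderivWithin_of_mem_nhds (mem_of_superset (isOpen_ball.mem_nhds hm) ball_subset_closedBall)]
    have : ut R u =ᶠ[𝓝 (z + t • e)] u := by
      filter_upwards [isOpen_ball.mem_nhds hm] with y hy using ut_eq hy
    rwa [this.fderiv_eq] at h1

end
end CS
end


theorem decomposition_into_balls
    {N : ℕ} (hN : 1 ≤ N) (R : ℝ) (hR : 0 < R) (g : ℝ → ℝ) (f : ℝ → ℝ → ℝ)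
    (hg : GCond g) (hf : FCond R f) (ha : CondA R g f)
    (u : EuclideanSpace ℝ (Fin N) → ℝ) (hu : IsWeakSolP R g f u) :
    ∃ (K : Set ℕ) (z : ℕ → EuclideanSpace ℝ (Fin N)) (ro : ℕ → ℝ) (U U' : ℕ → ℝ → ℝ),
      (∀ k ∈ K, z k ∈ ball (0:EuclideanSpace ℝ (Fin N)) R ∧ 0 < ro k ∧
        ball (z k) (ro k) ⊆ ball (0:EuclideanSpace ℝ (Fin N)) R) ∧
      K.PairwiseDisjoint (fun k => ball (z k) (ro k)) ∧
      ball (0:EuclideanSpace ℝ (Fin N)) R =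
        (⋃ k ∈ K, ball (z k) (ro k)) ∪
          {x ∈ ball (0:EuclideanSpace ℝ (Fin N)) R | u x = 0} ∧
      ∀ k ∈ K,
        C1On (U k) (U' k) 0 (ro k) ∧
        (∀ x ∈ ball (z k) (ro k), u x = U k ‖x - z k‖) ∧
        U k (ro k) = 0 ∧
        ∀ r ∈ Ioo (0:ℝ) (ro k), U' k r < 0 := by
  obtain ⟨KK, M, hS⟩ := CS.sol_of_weak hR hg hf hu
  set e : EuclideanSpace ℝ (Fin N) := EuclideanSpace.single ⟨0, hN⟩ 1 with hedef
  have he : ‖e‖ = 1 := by rw [hedef, EuclideanSpace.norm_single]; norm_num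
  have hex : ∀ y : EuclideanSpace ℝ (Fin N), ∃ p : EuclideanSpace ℝ (Fin N) × ℝ,
      0 < CS.ut R u y → CS.MB (CS.ut R u) p.1 p.2 ∧ y ∈ ball p.1 p.2 := fun y => by
    by_cases hy : 0 < CS.ut R u y
    · obtain ⟨z, r, h⟩ := CS.MB.exists hS ha he hy
      exact ⟨(z, r), fun _ => h⟩
    · exact ⟨(0, 0), fun h => absurd h hy⟩
  choose p hp using hex
  obtain ⟨q, hq⟩ := TopologicalSpace.exists_dense_seq (EuclideanSpace ℝ (Fin N))
  set K : Set ℕ := {n | 0 < CS.ut R u (q n) ∧ ∀ m < n, q m ∉ ball (p (q n)).1 (p (q n)).2} with hK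
  have hKM : ∀ k ∈ K, CS.MB (CS.ut R u) (p (q k)).1 (p (q k)).2 := fun k hk => (hp (q k) hk.1).1
  refine ⟨K, fun k => (p (q k)).1, fun k => (p (q k)).2, fun k t => u ((p (q k)).1 + t • e),
    fun k t => fderivWithin ℝ u (closedBall 0 R) ((p (q k)).1 + t • e) e, fun k hk => ?_, ?_, ?_, fun k hk => ?_⟩
  · have h := hKM k hk
    exact ⟨h.mem hS (mem_ball_self h.pos), h.pos, h.mem hS⟩
  · intro k hk k' hk' hne
    rw [Function.onFun, Set.disjoint_left]
    intro x hx hx'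
    have s1 := (hKM k hk).sub (hKM k' hk') hx hx'
    have s2 := (hKM k' hk').sub (hKM k hk) hx' hx
    rcases lt_or_gt_of_ne hne with h | h
    · exact hk'.2 k h (s2 (hp (q k) hk.1).2)
    · exact hk.2 k' h (s1 (hp (q k') hk'.1).2)
  · apply Set.Subset.antisymm
    · intro x hx
      by_cases hux : u x = 0
      · exact Or.inr ⟨hx, hux⟩
      left
      have hvx : 0 < CS.ut R u x := by
        rw [CS.ut_eq hx]; exact lt_of_le_of_ne (hu.2.1 x (ball_subset_closedBall hx)) (Ne.symm hux)
      obtain ⟨hM, hxm⟩ := hp x hvx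
      have hex : ∃ n, q n ∈ ball (p x).1 (p x).2 := by
        obtain ⟨n, hn⟩ := hq.exists_mem_open isOpen_ball ⟨x, hxm⟩
        exact ⟨n, hn⟩
      have hn := Nat.find_spec hex
      have hmin := fun m (hm : m < Nat.find hex) => Nat.find_min hex hm
      set n := Nat.find hex
      have hvn := hM.ins _ hn
      obtain ⟨hM', hn'⟩ := hp (q n) hvn
      have s1 := hM.sub hM' hn hn'
      have s2 := hM'.sub hM hn' hn
      exact mem_biUnion (show n ∈ K from ⟨hvn, fun m hm hmem => hmin m hm (s1 hmem)⟩) (s2 hxm)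
    · rintro x (hx | hx)
      · obtain ⟨k, hk, hxk⟩ := mem_iUnion₂.1 hx
        exact (hKM k hk).mem hS hxk
      · exact hx.1
  · exact (hKM k hk).profile hS hu.1 hu.2.2.2.1 he
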